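/- arXiv:2304.02164 — 2 statements merged into one kernel-verified Lean document; each statement's English description precedes it below -/
import Mathlib

section
/- For every ε > 0 there exists n₀ such that for all integers n ≥ n₀, H_n(C_{10}) ≤ n^{(4/5 + ε)n}; that is, the maximum size of a family of Hamilton paths in K_n the union of any two of which contains a 10-cycle is at most n^{(4/5)n + o(n)}. -/
open SimpleGraph

/-- `H` is contained in `G` as a subgraph:
there is an injective map preserving adjacency. -/
def ContainsCopy {W V : Type*} (H : SimpleGraph W) (G : SimpleGraph V) : Prop :=
  ∃ f : W ↪ V, ∀ ⦃a b : W⦄, H.Adj a b → G.Adj (f a) (f b)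

/-- The union of (the edge sets of) two walks in the complete graph on `Fin n`,
as a simple graph on `Fin n`. -/
def walkUnion {n : ℕ} {u v u' v' : Fin n}
    (p : (⊤ : SimpleGraph (Fin n)).Walk u v) (q : (⊤ : SimpleGraph (Fin n)).Walk u' v') :
    SimpleGraph (Fin n) :=
  (p.toSubgraph ⊔ q.toSubgraph).spanningCoe

/-- Involutions of `V` which move vertices only along edges of `G` and fix `D` pointwise;
these encode the matchings of `G - D`. -/
noncomputable def matchings {V : Type*} [Fintype V] [DecidableEq V] (G : SimpleGraph V)
    (D : Finset V) : Finset (V → V) :=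
  open Classical in
  Finset.univ.filter fun f =>
    (∀ v, f (f v) = v) ∧ (∀ v, f v ≠ v → G.Adj v (f v)) ∧ ∀ v ∈ D, f v = v

/-- The vertices moved by `f`. -/
def moved {V : Type*} [Fintype V] [DecidableEq V] (f : V → V) : Finset V :=
  Finset.univ.filter fun v => f v ≠ v

/-- The monomer-dimer partition function of `G - D`, with weight `a` per covered vertex. -/
noncomputable def partitionFn {V : Type*} [Fintype V] [DecidableEq V] (G : SimpleGraph V) (a : ℝ)
    (D : Finset V) : ℝ :=
  ∑ f ∈ matchings G D, a ^ (moved f).card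

section Matching

variable {V : Type*} [Fintype V] [DecidableEq V] {G : SimpleGraph V} {D : Finset V} {a : ℝ}

lemma mem_matchings {f : V → V} : f ∈ matchings G D ↔
    (∀ v, f (f v) = v) ∧ (∀ v, f v ≠ v → G.Adj v (f v)) ∧ ∀ v ∈ D, f v = v := by
  simp [matchings]

lemma partitionFn_edge {u v : V} (hu : u ∉ D) (hv : v ∉ D) (h : G.Adj u v) :
    ∑ f ∈ matchings G D with f u = v, a ^ (moved f).card
      = a ^ 2 * partitionFn G a (insert u (insert v D)) := by
  have huv : u ≠ v := h.ne
  rw [partitionFn, Finset.mul_sum]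
  refine Finset.sum_bij' (fun f _ => Function.update (Function.update f u u) v v)
    (fun f _ => Function.update (Function.update f u v) v u) ?_ ?_ ?_ ?_ ?_
  · intro f hf
    simp only [Finset.mem_filter, mem_matchings] at hf ⊢
    obtain ⟨⟨h1, h2, h3⟩, h4⟩ := hf
    have h5 : f v = u := by rw [← h4, h1]
    refine ⟨?_, ?_, ?_⟩
    · intro w
      simp only [Function.update_apply]
      grind
    · intro w
      simp only [Function.update_apply]
      grind
    · intro w hw
      simp only [Function.update_apply]
      grind
  · intro f hf
    simp only [Finset.mem_filter, mem_matchings] at hf ⊢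
    obtain ⟨h1, h2, h3⟩ := hf
    have hfu := h3 u (by simp)
    have hfv := h3 v (by simp)
    have h' := h.symm
    refine ⟨⟨?_, ?_, ?_⟩, ?_⟩
    · intro w
      simp only [Function.update_apply]
      grind
    · intro w
      simp only [Function.update_apply]
      grind
    · intro w hw
      simp only [Function.update_apply]
      grind
    · simp [huv]
  · intro f hf
    simp only [Finset.mem_filter, mem_matchings] at hf
    obtain ⟨⟨h1, h2, h3⟩, h4⟩ := hf
    have h5 : f v = u := by rw [← h4, h1]
    funext w
    simp only [Function.update_apply]
    grind
  · intro f hf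
    simp only [mem_matchings] at hf
    obtain ⟨h1, h2, h3⟩ := hf
    have hfu := h3 u (by simp)
    have hfv := h3 v (by simp)
    funext w
    simp only [Function.update_apply]
    grind
  · intro f hf
    simp only [Finset.mem_filter, mem_matchings] at hf
    obtain ⟨⟨h1, h2, h3⟩, h4⟩ := hf
    have h5 : f v = u := by rw [← h4, h1]
    have : moved f = insert u (insert v
        (moved (Function.update (Function.update f u u) v v))) := by
      ext w
      simp only [moved, Finset.mem_filter, Finset.mem_univ, true_and, Finset.mem_insert,
        Function.update_apply]
      grind
    rw [this, Finset.card_insert_of_notMem, Finset.card_insert_of_notMem]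
    · ring
    · simp [moved]
    · simp [moved, huv]

open Classical in
lemma partitionFn_eq {u : V} (hu : u ∉ D) :
    partitionFn G a D = partitionFn G a (insert u D) +
      ∑ v ∈ Finset.univ.filter (fun v => G.Adj u v ∧ v ∉ D),
        a ^ 2 * partitionFn G a (insert v (insert u D)) := by
  have key : ∀ v, ∑ f ∈ matchings G D with f u = v, a ^ (moved f).card =
      (if v = u then partitionFn G a (insert u D) else 0) +
      (if G.Adj u v ∧ v ∉ D then a ^ 2 * partitionFn G a (insert v (insert u D)) else 0) := by
    intro v
    by_cases hv : v = u
    · subst hv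
      simp only [if_true, SimpleGraph.irrefl, false_and, if_false, add_zero]
      rw [partitionFn]
      congr 1
      ext f
      simp only [Finset.mem_filter, mem_matchings, Finset.mem_insert]
      grind
    · rw [if_neg hv, zero_add]
      split_ifs with hc
      · rw [partitionFn_edge hu hc.2 hc.1, Finset.insert_comm]
      · refine Finset.sum_eq_zero fun f hf => ?_
        exfalso
        simp only [Finset.mem_filter, mem_matchings] at hf
        grind
  rw [partitionFn, ← Finset.sum_fiberwise (s := matchings G D) (g := fun f => f u)]
  simp only [key, Finset.sum_add_distrib, Finset.sum_ite_eq', Finset.mem_univ, if_true,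
    Finset.sum_filter]

lemma partitionFn_pos (ha : 0 < a) : 0 < partitionFn G a D :=
  Finset.sum_pos (fun _ _ => by positivity) ⟨id, by simp [mem_matchings]⟩

lemma one_le_partitionFn (ha : 0 < a) : 1 ≤ partitionFn G a D := by
  have h : a ^ (moved (id : V → V)).card ≤ partitionFn G a D :=
    Finset.single_le_sum (f := fun f : V → V => a ^ (moved f).card) (fun _ _ => by positivity)
      (by simp [mem_matchings])
  simpa [moved] using h


open Classical in
lemma partitionFn_step {d c : ℕ} {U : ℝ} (ha : 0 < a) (hU0 : 0 ≤ U)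
    (hdeg : ∀ u, (Finset.univ.filter (G.Adj u)).card = d)
    (hU : ∀ D : Finset V, D.card ≤ c + 2 → ∀ u ∉ D,
      partitionFn G a (insert u D) ≤ U * partitionFn G a D)
    (hD : D.card ≤ c) {u : V} (hu : u ∉ D) :
    partitionFn G a (insert u D) * (1 + a ^ 2 * (d - c) / (1 + a ^ 2 * d * U)) ≤
      partitionFn G a D := by
  have hden : 0 < 1 + a ^ 2 * d * U := by positivity
  have h1 : ∀ v ∈ Finset.univ.filter (fun v => G.Adj u v ∧ v ∉ D),
      partitionFn G a (insert u D) / (1 + a ^ 2 * d * U) ≤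
        partitionFn G a (insert v (insert u D)) := by
    intro v hv
    simp only [Finset.mem_filter, Finset.mem_univ, true_and] at hv
    have hv' : v ∉ insert u D := by
      simp only [Finset.mem_insert, not_or]
      exact ⟨hv.1.ne', hv.2⟩
    have hcard : (insert v (insert u D)).card ≤ c + 2 := by
      have := Finset.card_insert_le v (insert u D)
      have := Finset.card_insert_le u D
      omega
    rw [div_le_iff₀ hden, partitionFn_eq hv']
    have h2 : ∑ w ∈ Finset.univ.filter (fun w => G.Adj v w ∧ w ∉ insert u D),
        a ^ 2 * partitionFn G a (insert w (insert v (insert u D))) ≤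
        d * (a ^ 2 * (U * partitionFn G a (insert v (insert u D)))) := by
      have hpos := partitionFn_pos (G := G) (D := insert v (insert u D)) ha
      calc _ ≤ ∑ w ∈ Finset.univ.filter (fun w => G.Adj v w ∧ w ∉ insert u D),
            a ^ 2 * (U * partitionFn G a (insert v (insert u D))) := by
            refine Finset.sum_le_sum fun w hw => ?_
            simp only [Finset.mem_filter, Finset.mem_univ, true_and] at hw
            refine mul_le_mul_of_nonneg_left (hU _ hcard w ?_) (by positivity)
            rw [Finset.mem_insert, not_or]
            exact ⟨hw.1.ne', hw.2⟩
        _ ≤ _ := by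
            rw [Finset.sum_const, nsmul_eq_mul]
            refine mul_le_mul_of_nonneg_right ?_ (by positivity)
            rw [← hdeg v]
            refine Nat.cast_le.2 (Finset.card_le_card fun w hw => ?_)
            simp only [Finset.mem_filter, Finset.mem_univ, true_and] at hw ⊢
            exact hw.1
    linarith
  have h3 : (d : ℝ) - c ≤ (Finset.univ.filter (fun v => G.Adj u v ∧ v ∉ D)).card := by
    have : d ≤ (Finset.univ.filter (fun v => G.Adj u v ∧ v ∉ D)).card + D.card := by
      rw [← hdeg u]
      refine le_trans (Finset.card_le_card ?_) (Finset.card_union_le _ _)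
      intro w hw
      simp only [Finset.mem_filter, Finset.mem_univ, true_and, Finset.mem_union] at hw ⊢
      tauto
    have : (d : ℝ) ≤ (Finset.univ.filter (fun v => G.Adj u v ∧ v ∉ D)).card + c := by
      exact_mod_cast this.trans (by omega)
    linarith
  have hpos := partitionFn_pos (G := G) (D := insert u D) ha
  rw [partitionFn_eq hu]
  have h4 := Finset.sum_le_sum fun v hv => mul_le_mul_of_nonneg_left (h1 v hv) (sq_nonneg a)
  rw [Finset.sum_const, nsmul_eq_mul] at h4
  have h5 := mul_le_mul_of_nonneg_right h3
    (show 0 ≤ a ^ 2 * (partitionFn G a (insert u D) / (1 + a ^ 2 * d * U)) by positivity)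
  calc _ = partitionFn G a (insert u D) + (d - c) *
        (a ^ 2 * (partitionFn G a (insert u D) / (1 + a ^ 2 * d * U))) := by ring
    _ ≤ _ := by linarith

open Classical in
lemma partitionFn_ratio {d J : ℕ} {δ : ℝ} (hδ : 0 < δ) (ha : 0 < a)
    (haC : a ^ 2 * d = 4 / δ ^ 2) (hdJ : 8 * J ≤ δ * d)
    (hdeg : ∀ u, (Finset.univ.filter (G.Adj u)).card = d) (j : ℕ) :
    ∀ c, c + 2 * j ≤ 2 * J → ∀ D : Finset V, D.card ≤ c → ∀ u ∉ D,
      partitionFn G a (insert u D) ≤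
        max δ (((1 + δ / 4) / (1 + 3 * δ / 4)) ^ j) * partitionFn G a D := by
  set ρ := (1 + δ / 4) / (1 + 3 * δ / 4) with hρ
  have hρ0 : 0 < ρ := by positivity
  have hρ1 : ρ ≤ 1 := by
    rw [hρ, div_le_one (by positivity)]
    linarith
  induction j with
  | zero =>
    intro c _ D _ u hu
    have hpos := partitionFn_pos (G := G) (D := D) ha
    rw [pow_zero]
    have h1 : partitionFn G a (insert u D) ≤ partitionFn G a D := by
      rw [partitionFn_eq hu]
      refine le_add_of_nonneg_right (Finset.sum_nonneg fun v _ => ?_)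
      have := partitionFn_pos (G := G) (D := insert v (insert u D)) ha
      positivity
    nlinarith [le_max_right δ 1]
  | succ j ih =>
    intro c hc D hD u hu
    set U := max δ (ρ ^ j) with hU
    have hUδ : δ ≤ U := le_max_left _ _
    have hstep := partitionFn_step ha (hδ.le.trans hUδ) hdeg (ih (c + 2) (by omega)) hD hu
    rw [haC] at hstep
    have hpos := partitionFn_pos (G := G) (D := insert u D) ha
    have hpos' := partitionFn_pos (G := G) (D := D) ha
    set C := 4 / δ ^ 2 with hC
    have hC0 : 0 < C := by positivity
    have hCδ : C * δ ^ 2 = 4 := by rw [hC]; field_simp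
    have hq : C * (1 - δ / 4) ≤ a ^ 2 * (d - c) := by
      rw [← haC]
      have h1 : (c : ℝ) ≤ 2 * J := by exact_mod_cast (by omega : c ≤ 2 * J)
      have : (c : ℝ) ≤ δ * d / 4 := by linarith
      have := mul_le_mul_of_nonneg_left this (sq_nonneg a)
      nlinarith
    have hden : 0 < 1 + C * U := by positivity
    have hρU : 1 ≤ ρ * U * (1 + a ^ 2 * (d - c) / (1 + C * U)) := by
      rw [one_add_div hden.ne', mul_div_assoc', one_le_div hden]
      have h1 : ρ * (1 + 3 * δ / 4) = 1 + δ / 4 := by rw [hρ]; field_simp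
      have h2 : C * (1 + 3 * δ / 4) ≤ 1 + C * U + a ^ 2 * (d - c) := by nlinarith
      have h3 := mul_le_mul_of_nonneg_left h2 (by positivity : 0 ≤ ρ * U)
      have h4 : ρ * U * (C * (1 + 3 * δ / 4)) = U * C * (1 + δ / 4) := by rw [← h1]; ring
      have h5 : 4 ≤ U * C * δ := by
        rw [← hCδ]
        have := mul_le_mul_of_nonneg_left hUδ (by positivity : 0 ≤ C * δ)
        nlinarith
      nlinarith
    have h1 : partitionFn G a (insert u D) ≤ ρ * U * partitionFn G a D := by
      have h2 := mul_le_mul_of_nonneg_left hstep (by positivity : 0 ≤ ρ * U)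
      have h3 := mul_le_mul_of_nonneg_left hρU hpos.le
      nlinarith
    refine h1.trans (mul_le_mul_of_nonneg_right ?_ hpos'.le)
    rw [hU, mul_max_of_nonneg _ _ hρ0.le, pow_succ']
    exact max_le_max (by nlinarith) le_rfl

end Matching

open Classical in
/-- A regular graph of large degree `d` has about `d ^ (|V| / 2)` almost perfect matchings. -/
lemma exists_many_matchings {δ : ℝ} (hδ : 0 < δ) :
    ∃ d₀ : ℕ, ∀ d : ℕ, d₀ ≤ d → ∀ {V : Type} [Fintype V] [DecidableEq V] [Nonempty V]
      (G : SimpleGraph V), (∀ u, (Finset.univ.filter (G.Adj u)).card = d) →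
      1 / 2 ≤ ((matchings G ∅).filter fun f : V → V =>
          ((Finset.univ.filter fun v => f v = v).card : ℝ) ≤ 2 * δ * Fintype.card V).card *
        (4 / δ ^ 2 / d) ^ ((1 - 2 * δ) * Fintype.card V / 2) := by
  set ρ := (1 + δ / 4) / (1 + 3 * δ / 4) with hρ
  have hρ0 : 0 < ρ := by positivity
  have hρ1 : ρ < 1 := by
    rw [hρ, div_lt_one (by positivity)]
    linarith
  obtain ⟨J, hJ⟩ := exists_pow_lt_of_lt_one hδ hρ1
  refine ⟨⌈8 * (J : ℝ) / δ⌉₊ + ⌈4 / δ ^ 2⌉₊ + 1, fun d hd V _ _ _ G hdeg => ?_⟩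
  have hd1 : 8 * J / δ ≤ d := (Nat.le_ceil _).trans (Nat.cast_le.2 (by omega))
  have hd2 : 4 / δ ^ 2 ≤ d := (Nat.le_ceil _).trans (Nat.cast_le.2 (by omega))
  have hd0 : (0 : ℝ) < d := by exact_mod_cast (by omega : 0 < d)
  set b := 4 / δ ^ 2 / (d : ℝ) with hb
  have hb0 : 0 < b := by positivity
  have hb1 : b ≤ 1 := by rw [hb, div_le_one hd0]; exact hd2
  set a := Real.sqrt b with ha
  have ha0 : 0 < a := Real.sqrt_pos.2 hb0
  have ha1 : a ≤ 1 := Real.sqrt_le_one.2 hb1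
  have ha2 : a ^ 2 = b := Real.sq_sqrt hb0.le
  have haC : a ^ 2 * d = 4 / δ ^ 2 := by rw [ha2, hb]; field_simp
  have hratio : ∀ u : V, partitionFn G a {u} ≤ δ * partitionFn G a ∅ := by
    intro u
    have := partitionFn_ratio (G := G) hδ ha0 haC (by rwa [div_le_iff₀ hδ, mul_comm (d : ℝ)] at hd1)
      hdeg J 0 (by omega) ∅ (by simp) u (by simp)
    rwa [max_eq_left hJ.le] at this
  set N : ℝ := (Fintype.card V : ℝ) with hN
  have hN0 : 0 < N := by rw [hN]; exact_mod_cast Fintype.card_pos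
  set fix : (V → V) → Finset V := fun f => Finset.univ.filter fun v => f v = v with hfix
  have hsum : ∑ f ∈ matchings G ∅, a ^ (moved f).card * ((fix f).card : ℝ) ≤
      δ * N * partitionFn G a ∅ := by
    have h1 : ∑ f ∈ matchings G ∅, a ^ (moved f).card * ((fix f).card : ℝ) =
        ∑ u : V, partitionFn G a {u} := by
      have h2 : ∀ u, partitionFn G a {u} =
          ∑ f ∈ matchings G ∅, if f u = u then a ^ (moved f).card else 0 := by
        intro u
        rw [partitionFn, ← Finset.sum_filter]
        congr 1
        ext f
        simp only [mem_matchings, Finset.mem_filter, Finset.mem_singleton]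
        grind
      simp only [h2]
      rw [Finset.sum_comm]
      refine Finset.sum_congr rfl fun f _ => ?_
      rw [← Finset.sum_filter, Finset.sum_const, nsmul_eq_mul, mul_comm]
    rw [h1]
    refine (Finset.sum_le_sum fun u _ => hratio u).trans (le_of_eq ?_)
    rw [Finset.sum_const, nsmul_eq_mul, Finset.card_univ]
    ring
  have hsplit := Finset.sum_filter_add_sum_filter_not (matchings G ∅)
    (fun f => ((fix f).card : ℝ) ≤ 2 * δ * N) (fun f => a ^ (moved f).card)
  have hbad : 2 * δ * N * ∑ f ∈ matchings G ∅ with ¬ ((fix f).card : ℝ) ≤ 2 * δ * N,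
      a ^ (moved f).card ≤ δ * N * partitionFn G a ∅ := by
    refine le_trans ?_ hsum
    rw [Finset.mul_sum]
    refine le_trans (Finset.sum_le_sum fun f hf => ?_)
      (Finset.sum_le_sum_of_subset_of_nonneg (Finset.filter_subset _ _) fun f _ _ => ?_)
    · rw [Finset.mem_filter, not_le] at hf
      rw [mul_comm]
      exact mul_le_mul_of_nonneg_left hf.2.le (by positivity)
    · positivity
  have hZ : 1 ≤ partitionFn G a ∅ := one_le_partitionFn ha0
  have hgood : 1 / 2 ≤ ∑ f ∈ matchings G ∅ with ((fix f).card : ℝ) ≤ 2 * δ * N,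
      a ^ (moved f).card := by
    have h1 : 2 * ∑ f ∈ matchings G ∅ with ¬ ((fix f).card : ℝ) ≤ 2 * δ * N,
        a ^ (moved f).card ≤ partitionFn G a ∅ := by
      refine le_of_mul_le_mul_left ?_ (by positivity : 0 < δ * N)
      linarith
    change _ = partitionFn G a ∅ at hsplit
    linarith
  refine hgood.trans ?_
  rw [← nsmul_eq_mul]
  refine Finset.sum_le_card_nsmul _ _ _ fun f hf => ?_
  rw [Finset.mem_filter] at hf
  have hcard : ((moved f).card : ℝ) = N - (fix f).card := by
    rw [eq_sub_iff_add_eq, hN]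
    have := Finset.card_filter_add_card_filter_not (s := (Finset.univ : Finset V)) (fun v => f v = v)
    rw [Finset.card_univ] at this
    rw [← this, add_comm]
    push_cast
    rfl
  rw [← ha2, ← Real.rpow_natCast, ← Real.rpow_natCast, ← Real.rpow_mul ha0.le]
  refine Real.rpow_le_rpow_of_exponent_ge ha0 ha1 ?_
  rw [hcard]
  push_cast
  nlinarith [hf.2]

/-- The bipartite graph on two copies of `W` given by the relation `R`. -/
def bipGraph {W : Type*} (R : W → W → Prop) : SimpleGraph (W ⊕ W) where
  Adj
    | .inl a, .inr b => R a b
    | .inr b, .inl a => R a b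
    | _, _ => False
  symm := ⟨by rintro (a | a) (b | b) h <;> exact h⟩
  loopless := ⟨by rintro (a | a) h <;> exact h⟩

open Classical in
lemma bipGraph_degree {W : Type*} [Fintype W] {R : W → W → Prop} {d : ℕ}
    (h₁ : ∀ w, (Finset.univ.filter fun w' => R w w').card = d)
    (h₂ : ∀ w', (Finset.univ.filter fun w => R w w').card = d) (u : W ⊕ W) :
    (Finset.univ.filter ((bipGraph R).Adj u)).card = d := by
  rcases u with u | u
  · rw [← h₁ u, ← Finset.card_map (s := Finset.univ.filter fun w' => R u w')
      (Function.Embedding.inr : W ↪ W ⊕ W)]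
    refine congrArg Finset.card ?_
    ext (x | x) <;> rw [Finset.mem_filter] <;> simp [bipGraph]
  · rw [← h₂ u, ← Finset.card_map (s := Finset.univ.filter fun w => R w u)
      (Function.Embedding.inl : W ↪ W ⊕ W)]
    refine congrArg Finset.card ?_
    ext (x | x) <;> rw [Finset.mem_filter] <;> simp [bipGraph]

/-- A matching of a bipartite graph extends to a permutation. -/
lemma exists_perm_extending {W : Type*} [Fintype W] [DecidableEq W] {R : W → W → Prop}
    {f : W ⊕ W → W ⊕ W} (hf : f ∈ matchings (bipGraph R) ∅) :
    ∃ σ : Equiv.Perm W, ∀ w, f (.inl w) ≠ .inl w → f (.inl w) = .inr (σ w) := by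
  rw [mem_matchings] at hf
  obtain ⟨h1, h2, -⟩ := hf
  have h3 : ∀ w, f (.inl w) ≠ .inl w → ∃ w', f (.inl w) = .inr w' := by
    intro w hw
    have := h2 _ hw
    rcases hx : f (.inl w) with x | x
    · rw [hx] at this
      exact this.elim
    · exact ⟨x, rfl⟩
  choose! g hg using h3
  obtain ⟨e, he⟩ := Finset.exists_equiv_extend_of_card_eq (t := (Finset.univ : Finset W))
    Finset.card_univ.symm (s := Finset.univ.filter fun w => f (.inl w) ≠ .inl w) (f := g)
    (Finset.subset_univ _) (by
      intro x hx y hy hxy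
      simp only [Finset.coe_filter, Finset.mem_univ, true_and, Set.mem_ofPred_eq] at hx hy
      have h4 : f (.inl x) = f (.inl y) := by rw [hg x hx, hg y hy, hxy]
      have h5 := h1 (.inl x)
      rw [h4, h1] at h5
      exact (Sum.inl.inj h5).symm)
  refine ⟨e.trans (Equiv.subtypeUnivEquiv Finset.mem_univ), fun w hw => ?_⟩
  rw [hg w hw, ← he w (by simpa using hw)]
  rfl

open Classical in
/-- A regular bipartite graph of large degree `d` has about `d ^ |W|` almost perfect matchings,
counted as permutations. -/
lemma exists_many_perms {δ : ℝ} (hδ : 0 < δ) :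
    ∃ d₀ : ℕ, ∀ d : ℕ, d₀ ≤ d → ∀ {W : Type} [Fintype W] [Nonempty W]
      (R : W → W → Prop), (∀ w, (Finset.univ.filter fun w' => R w w').card = d) →
      (∀ w', (Finset.univ.filter fun w => R w w').card = d) →
      1 / 2 ≤ 2 ^ Fintype.card W * ((Finset.univ.filter fun σ : Equiv.Perm W =>
          ((Finset.univ.filter fun w => ¬ R w (σ w)).card : ℝ) ≤ 4 * δ * Fintype.card W).card : ℝ) *
        (4 / δ ^ 2 / d) ^ ((1 - 2 * δ) * Fintype.card W) := by
  obtain ⟨d₀, h⟩ := exists_many_matchings hδ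
  refine ⟨d₀, fun d hd W _ _ R h₁ h₂ => ?_⟩
  have key := h d hd (bipGraph R) (fun u => by convert bipGraph_degree h₁ h₂ u)
  set M := (matchings (bipGraph R) ∅).filter fun f : W ⊕ W → W ⊕ W =>
    ((Finset.univ.filter fun v => f v = v).card : ℝ) ≤ 2 * δ * Fintype.card (W ⊕ W) with hM
  set P := Finset.univ.filter fun σ : Equiv.Perm W =>
    ((Finset.univ.filter fun w => ¬ R w (σ w)).card : ℝ) ≤ 4 * δ * Fintype.card W with hP
  have hcW : (Fintype.card (W ⊕ W) : ℝ) = 2 * Fintype.card W := by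
    rw [Fintype.card_sum]; push_cast; ring
  have hcard : M.card ≤ 2 ^ Fintype.card W * P.card := by
    rw [← Finset.card_univ (α := W), ← Finset.card_powerset, ← Finset.card_product]
    have hex : ∀ f : W ⊕ W → W ⊕ W, ∃ σ : Equiv.Perm W, f ∈ matchings (bipGraph R) ∅ →
        ∀ w, f (.inl w) ≠ .inl w → f (.inl w) = .inr (σ w) := fun f => by
      by_cases hf : f ∈ matchings (bipGraph R) ∅
      · obtain ⟨σ, hσ⟩ := exists_perm_extending hf
        exact ⟨σ, fun _ => hσ⟩
      · exact ⟨1, fun h => (hf h).elim⟩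
    choose s hs using hex
    refine Finset.card_le_card_of_injOn
      (fun f => (Finset.univ.filter fun w => f (.inl w) ≠ .inl w, s f)) ?_ ?_
    · intro f hf
      simp only [hM, Finset.coe_filter, Set.mem_ofPred_eq] at hf
      simp only [Finset.coe_product, Set.mem_prod, Finset.mem_coe, Finset.mem_powerset,
        Finset.subset_univ, true_and, hP, Finset.mem_filter, Finset.mem_univ]
      refine le_trans ?_ (hf.2.trans (le_of_eq (by rw [hcW]; ring)))
      rw [← Finset.card_map Function.Embedding.inl]
      refine Nat.cast_le.2 (Finset.card_le_card fun x hx => ?_)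
      simp only [Finset.mem_map, Finset.mem_filter, Finset.mem_univ, true_and,
        Function.Embedding.inl_apply] at hx ⊢
      obtain ⟨w, hw, rfl⟩ := hx
      by_contra hne
      have h3 := (mem_matchings.1 hf.1).2.1 _ hne
      rw [hs f hf.1 w hne] at h3
      exact hw h3
    · intro f hf f' hf' hff
      simp only [hM, Finset.coe_filter, Set.mem_ofPred_eq] at hf hf'
      rw [Prod.mk.injEq] at hff
      obtain ⟨hS, hσ⟩ := hff
      have hl : ∀ w, f (.inl w) = f' (.inl w) := by
        intro w
        have hw : f (.inl w) ≠ .inl w ↔ f' (.inl w) ≠ .inl w := by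
          have := Finset.ext_iff.1 hS w
          simpa only [Finset.mem_filter, Finset.mem_univ, true_and] using this
        by_cases h3 : f (.inl w) = .inl w
        · rw [h3]
          by_contra h4
          exact hw.2 (Ne.symm h4) h3
        · rw [hs f hf.1 w h3, hs f' hf'.1 w (hw.1 h3), hσ]
      have hr : ∀ {f f' : W ⊕ W → W ⊕ W}, f ∈ matchings (bipGraph R) ∅ →
          f' ∈ matchings (bipGraph R) ∅ → (∀ w, f (.inl w) = f' (.inl w)) →
          ∀ w, f (.inr w) ≠ .inr w → f (.inr w) = f' (.inr w) := by
        intro f f' hf hf' hl w hw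
        rw [mem_matchings] at hf hf'
        have h3 := hf.2.1 _ hw
        rcases hx : f (.inr w) with x | x
        · rw [← hf'.1 (.inl x), ← hl, ← hx, hf.1]
        · rw [hx] at h3
          exact h3.elim
      funext x
      rcases x with w | w
      · exact hl w
      · by_cases h3 : f (.inr w) = .inr w
        · by_cases h4 : f' (.inr w) = .inr w
          · rw [h3, h4]
          · exact (hr hf'.1 hf.1 (fun w => (hl w).symm) w h4).symm
        · exact hr hf.1 hf'.1 hl w h3
  have hexp : (1 - 2 * δ) * (Fintype.card (W ⊕ W) : ℝ) / 2 = (1 - 2 * δ) * Fintype.card W := by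
    rw [hcW]; ring
  rw [hexp] at key
  refine key.trans (mul_le_mul_of_nonneg_right ?_ (by positivity))
  exact_mod_cast hcard

/-- Adjacency in the Hamilton path which visits `σ 0, σ 1, …` in this order. -/
def PathAdj {n : ℕ} (σ : Equiv.Perm (Fin n)) (a b : Fin n) : Prop :=
  (σ.symm a : ℕ) + 1 = σ.symm b ∨ (σ.symm b : ℕ) + 1 = σ.symm a

/-- The relation `r` contains a cycle of length ten. -/
def HasC10 {V : Type*} (r : V → V → Prop) : Prop :=
  ∃ f : Fin 10 → V, Function.Injective f ∧ ∀ i, r (f i) (f (i + 1))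

lemma exists_perm_of_isHamiltonian {n : ℕ} {u v : Fin n} (p : (⊤ : SimpleGraph (Fin n)).Walk u v)
    (hp : p.IsHamiltonian) :
    ∃ σ : Equiv.Perm (Fin n), ∀ i : Fin n, σ i = p.getVert i := by
  have hn : p.length = n - 1 := by simpa using hp.length_eq
  have h : Function.Injective fun i : Fin n => p.getVert i := by
    intro i j hij
    have := hp.isPath.getVert_injOn (by rw [Set.mem_ofPred_eq, hn]; omega)
      (by rw [Set.mem_ofPred_eq, hn]; omega) hij
    exact Fin.ext this
  exact ⟨Equiv.ofBijective _ (Finite.injective_iff_bijective.1 h), fun i => rfl⟩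

lemma pathAdj_of_toSubgraph_adj {n : ℕ} {u v : Fin n} {p : (⊤ : SimpleGraph (Fin n)).Walk u v}
    (hp : p.IsHamiltonian) {σ : Equiv.Perm (Fin n)} (hσ : ∀ i : Fin n, σ i = p.getVert i)
    {a b : Fin n} (hab : p.toSubgraph.Adj a b) : PathAdj σ a b := by
  rw [Walk.toSubgraph_adj_iff] at hab
  obtain ⟨i, hi, hlt⟩ := hab
  have hn : p.length = n - 1 := by simpa using hp.length_eq
  have h1 : σ.symm (p.getVert i) = ⟨i, by omega⟩ := by rw [Equiv.symm_apply_eq, hσ]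
  have h2 : σ.symm (p.getVert (i + 1)) = ⟨i + 1, by omega⟩ := by rw [Equiv.symm_apply_eq, hσ]
  rw [Sym2.eq_iff] at hi
  rcases hi with ⟨rfl, rfl⟩ | ⟨rfl, rfl⟩
  · left; rw [h1, h2]
  · right; rw [h1, h2]

/-- If no two Hamilton paths with orderings in `A` have a 10-cycle in their union, then a family
of Hamilton paths pairwise creating a 10-cycle has at most `n ! / |A|` members. -/
lemma card_mul_card_le_factorial {n m : ℕ}
    (P : Fin m → Σ u : Fin n, Σ v : Fin n, (⊤ : SimpleGraph (Fin n)).Walk u v)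
    (hham : ∀ i, (P i).2.2.IsHamiltonian)
    (hP : ∀ i j, i ≠ j → ContainsCopy (cycleGraph 10) (walkUnion (P i).2.2 (P j).2.2))
    (A : Finset (Equiv.Perm (Fin n)))
    (hA : ∀ σ ∈ A, ∀ τ ∈ A, ¬ HasC10 fun a b => PathAdj σ a b ∨ PathAdj τ a b) :
    m * A.card ≤ n.factorial := by
  choose o ho using fun i => exists_perm_of_isHamiltonian (P i).2.2 (hham i)
  have hcard : (Finset.univ ×ˢ A : Finset (Fin m × Equiv.Perm (Fin n))).card = m * A.card := by
    simp
  have hfac : (Finset.univ : Finset (Equiv.Perm (Fin n))).card = n.factorial := by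
    rw [Finset.card_univ, Fintype.card_perm, Fintype.card_fin]
  rw [← hcard, ← hfac]
  refine Finset.card_le_card_of_injOn (fun x => x.2 * (o x.1)⁻¹) (by simp) ?_
  rintro ⟨i, σ⟩ hσ ⟨j, τ⟩ hτ h
  simp only [Finset.coe_product, Set.mem_prod, Finset.mem_coe, Finset.mem_univ, true_and] at hσ hτ h
  by_cases hij : i = j
  · subst hij
    rw [mul_left_injective _ h]
  · exfalso
    obtain ⟨f, hf⟩ := hP i j hij
    refine hA σ hσ τ hτ ⟨fun k => (σ * (o i)⁻¹) (f k),
      (Equiv.injective _).comp f.injective, fun k => ?_⟩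
    have hadj : (cycleGraph 10).Adj k (k + 1) := by
      rw [cycleGraph_adj]; right; exact add_sub_cancel_left k 1
    have := hf hadj
    rw [walkUnion, Subgraph.spanningCoe_adj, Subgraph.sup_adj] at this
    refine this.imp (fun h1 => ?_) fun h1 => ?_
    · have := pathAdj_of_toSubgraph_adj (hham i) (ho i) h1
      simpa [PathAdj, Equiv.Perm.inv_def] using this
    · have := pathAdj_of_toSubgraph_adj (hham j) (ho j) h1
      rw [h]
      simpa [PathAdj, Equiv.Perm.inv_def] using this

/-- Two Hamilton paths which coincide on and around the positions `I`, where `I` consists of long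
intervals, and which elsewhere only use edges of a graph without 10-cycles, do not have a 10-cycle
in their union. -/
lemma not_hasC10_pathAdj {n : ℕ} {r : Fin n → Fin n → Prop} (hsymm : ∀ a b, r a b → r b a)
    (hr : ¬ HasC10 r) {I : Fin n → Prop}
    (hI : ∀ x, I x → ∃ a : ℕ, a ≤ x ∧ (x : ℕ) < a + 11 ∧ ∀ t < 11, ∃ h : a + t < n, I ⟨a + t, h⟩)
    {σ τ : Equiv.Perm (Fin n)}
    (hagree : ∀ x, I x → σ x = τ x)
    (hagree' : ∀ x y : Fin n, I x → ((x : ℕ) + 1 = y ∨ (y : ℕ) + 1 = x) → σ y = τ y)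
    (hσ : ∀ x y, ¬ I x → ¬ I y → (x : ℕ) + 1 = y → r (σ x) (σ y))
    (hτ : ∀ x y, ¬ I x → ¬ I y → (x : ℕ) + 1 = y → r (τ x) (τ y)) :
    ¬ HasC10 fun a b => PathAdj σ a b ∨ PathAdj τ a b := by
  rintro ⟨f, hf, hadj⟩
  have hsame : ∀ v, I (σ.symm v) → τ.symm v = σ.symm v := by
    intro v hv
    rw [Equiv.symm_apply_eq, ← hagree _ hv, Equiv.apply_symm_apply]
  have hnb : ∀ v w, I (σ.symm v) → (PathAdj σ v w ∨ PathAdj τ v w) →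
      (σ.symm v : ℕ) + 1 = σ.symm w ∨ (σ.symm w : ℕ) + 1 = σ.symm v := by
    intro v w hv h
    rcases h with h | h
    · exact h
    · rw [PathAdj, hsame v hv] at h
      have : σ.symm w = τ.symm w := by
        rw [Equiv.symm_apply_eq, hagree' _ _ hv h, Equiv.apply_symm_apply]
      rwa [this]
  by_cases hex : ∃ i, I (σ.symm (f i))
  · obtain ⟨i₀, hi₀⟩ := hex
    have hclosed : ∀ i, I (σ.symm (f i)) → (∃ j, (σ.symm (f j) : ℕ) = σ.symm (f i) + 1) ∧
        ∃ j, (σ.symm (f j) : ℕ) + 1 = σ.symm (f i) := by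
      intro i hi
      have h1 := hnb _ _ hi (hadj i)
      have h2 : PathAdj σ (f i) (f (i - 1)) ∨ PathAdj τ (f i) (f (i - 1)) := by
        have := hadj (i - 1)
        rw [sub_add_cancel] at this
        exact this.imp Or.symm Or.symm
      have h2 := hnb _ _ hi h2
      have h3 : (σ.symm (f (i + 1)) : ℕ) ≠ σ.symm (f (i - 1)) := by
        intro h
        exact (by decide : ∀ i : Fin 10, i + 1 ≠ i - 1) i (hf (σ.symm.injective (Fin.ext h)))
      rcases h1 with h1 | h1 <;> rcases h2 with h2 | h2
      · omega
      · exact ⟨⟨i + 1, h1.symm⟩, ⟨i - 1, h2⟩⟩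
      · exact ⟨⟨i - 1, h2.symm⟩, ⟨i + 1, h1⟩⟩
      · omega
    obtain ⟨a, ha1, ha2, ha3⟩ := hI _ hi₀
    have hI' : ∀ t < 11, ∀ j, (σ.symm (f j) : ℕ) = a + t → I (σ.symm (f j)) := by
      intro t ht j hj
      obtain ⟨h, h'⟩ := ha3 t ht
      convert h'
    have hup : ∀ k, (σ.symm (f i₀) : ℕ) - a + k < 11 → ∃ j, (σ.symm (f j) : ℕ) =
        σ.symm (f i₀) + k := by
      intro k
      induction k with
      | zero => exact fun _ => ⟨i₀, rfl⟩
      | succ k ih =>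
        intro hk
        obtain ⟨j, hj⟩ := ih (by omega)
        obtain ⟨⟨j', hj'⟩, -⟩ := hclosed j (hI' (σ.symm (f i₀) - a + k) (by omega) j (by omega))
        exact ⟨j', by omega⟩
    have hdown : ∀ k, k ≤ (σ.symm (f i₀) : ℕ) - a → ∃ j, (σ.symm (f j) : ℕ) + k =
        σ.symm (f i₀) := by
      intro k
      induction k with
      | zero => exact fun _ => ⟨i₀, rfl⟩
      | succ k ih =>
        intro hk
        obtain ⟨j, hj⟩ := ih (by omega)
        obtain ⟨-, ⟨j', hj'⟩⟩ := hclosed j (hI' (σ.symm (f i₀) - a - k) (by omega) j (by omega))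
        exact ⟨j', by omega⟩
    have hall : ∀ t : Fin 11, ∃ j, (σ.symm (f j) : ℕ) = a + t := by
      intro t
      rcases le_total (a + (t : ℕ)) (σ.symm (f i₀)) with h | h
      · obtain ⟨j, hj⟩ := hdown (σ.symm (f i₀) - (a + t)) (by omega)
        exact ⟨j, by omega⟩
      · obtain ⟨j, hj⟩ := hup (a + t - σ.symm (f i₀)) (by omega)
        exact ⟨j, by omega⟩
    choose g hg using hall
    have hinj : Function.Injective g := by
      intro s t hst
      have h1 := hg s
      rw [hst, hg t] at h1
      exact Fin.ext (by omega)
    simpa using Fintype.card_le_of_injective g hinj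
  · push Not at hex
    have hex' : ∀ i, ¬ I (τ.symm (f i)) := by
      intro i hi
      apply hex i
      have : σ.symm (f i) = τ.symm (f i) := by
        rw [Equiv.symm_apply_eq, hagree _ hi, Equiv.apply_symm_apply]
      rwa [this]
    have key : ∀ ρ : Equiv.Perm (Fin n), (∀ i, ¬ I (ρ.symm (f i))) →
        (∀ x y, ¬ I x → ¬ I y → (x : ℕ) + 1 = y → r (ρ x) (ρ y)) →
        ∀ i, PathAdj ρ (f i) (f (i + 1)) → r (f i) (f (i + 1)) := by
      intro ρ h1 h2 i h
      rcases h with h | h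
      · simpa using h2 _ _ (h1 _) (h1 _) h
      · simpa using hsymm _ _ (h2 _ _ (h1 _) (h1 _) h)
    exact hr ⟨f, hf, fun i => (hadj i).elim (key σ hex hσ i) (key τ hex' hτ i)⟩

/-- Inserting a long gap after each element of `S`. -/
def spread {m : ℕ} (S : Finset (Fin m)) (j : Fin m) : ℕ :=
  j + 11 * (S.filter (· < j)).card

lemma spread_succ {m : ℕ} (S : Finset (Fin m)) {i j : Fin m} (h : (i : ℕ) + 1 = j) :
    spread S j = spread S i + 1 + (if i ∈ S then 11 else 0) := by
  have h1 : S.filter (· < j) = if i ∈ S then insert i (S.filter (· < i)) else S.filter (· < i) := by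
    ext x
    have : x < j ↔ x < i ∨ x = i := by
      rw [Fin.lt_def, Fin.lt_def, Fin.ext_iff]; omega
    split_ifs with hi <;> simp only [Finset.mem_filter, Finset.mem_insert, this] <;> grind
  rw [spread, spread, h1]
  split_ifs with hi
  · rw [Finset.card_insert_of_notMem (by simp)]
    omega
  · omega

lemma spread_strictMono {m : ℕ} (S : Finset (Fin m)) : StrictMono (spread S) := by
  intro i j hij
  have : (S.filter (· < i)).card ≤ (S.filter (· < j)).card :=
    Finset.card_le_card fun x hx => by
      simp only [Finset.mem_filter] at hx ⊢
      exact ⟨hx.1, hx.2.trans hij⟩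
  rw [Fin.lt_def] at hij
  rw [spread, spread]
  omega

lemma spread_last {m : ℕ} {S : Finset (Fin m)} {l : Fin m} (hl : (l : ℕ) + 1 = m) (hlS : l ∈ S) :
    spread S l + 12 = m + 11 * S.card := by
  have h1 : S = insert l (S.filter (· < l)) := by
    ext x
    simp only [Finset.mem_insert, Finset.mem_filter, Fin.lt_def, Fin.ext_iff]
    have := x.2
    constructor
    · intro hx
      by_cases h : (x : ℕ) = l
      · exact Or.inl h
      · exact Or.inr ⟨hx, by omega⟩
    · rintro (h | h)
      · rwa [Fin.ext h]
      · exact h.1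
  have h2 := congrArg Finset.card h1
  rw [Finset.card_insert_of_notMem (by simp)] at h2
  rw [spread]
  omega

/-- The positions outside the range of `spread S` are covered by intervals of length 11. -/
lemma exists_gap {m n : ℕ} {S : Finset (Fin m)} {l : Fin m} (hl : (l : ℕ) + 1 = m) (hlS : l ∈ S)
    (hn : m + 11 * S.card ≤ n) (x : Fin n) (hx : ∀ j, spread S j ≠ x) :
    ∃ a : ℕ, a ≤ x ∧ (x : ℕ) < a + 11 ∧ ∀ t < 11, a + t < n ∧ ∀ j, spread S j ≠ a + t := by
  have hmono := spread_strictMono S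
  have hlast := spread_last hl hlS
  have hm : 0 < m := by omega
  have h0 : spread S ⟨0, hm⟩ = 0 := by
    rw [spread]
    have : S.filter (· < (⟨0, hm⟩ : Fin m)) = ∅ := by
      ext y; simp [Fin.lt_def]
    simp [this]
  have hne : (Finset.univ.filter fun j => spread S j < x).Nonempty := by
    refine ⟨⟨0, hm⟩, ?_⟩
    have := hx ⟨0, hm⟩
    simp only [Finset.mem_filter, Finset.mem_univ, true_and]
    omega
  obtain ⟨j, hj, hjmax⟩ := Finset.exists_max_image _ id hne
  simp only [Finset.mem_filter, Finset.mem_univ, true_and, id] at hj hjmax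
  by_cases hjl : j = l
  · subst hjl
    have hgt : ∀ y, spread S y ≤ spread S j := fun y => hmono.monotone (by
      rw [Fin.le_def]; omega)
    by_cases hxs : (x : ℕ) < spread S j + 12
    · refine ⟨spread S j + 1, by omega, by omega, fun t ht => ⟨by omega, fun y => ?_⟩⟩
      have := hgt y
      omega
    · refine ⟨x - 10, by omega, by omega, fun t ht => ⟨?_, fun y => ?_⟩⟩
      · omega
      · have := hgt y
        omega
  · have hj1 : (j : ℕ) + 1 < m := by
      have := j.2
      have : (j : ℕ) ≠ l := fun h => hjl (Fin.ext h)
      omega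
    set j' : Fin m := ⟨j + 1, hj1⟩ with hj'
    have hs := spread_succ S (i := j) (j := j') rfl
    have hge : (x : ℕ) < spread S j' := by
      by_contra h
      have h1 := hjmax j' (lt_of_le_of_ne (not_lt.1 h) (hx j'))
      rw [Fin.le_def] at h1
      simp [hj'] at h1
    have hjS : j ∈ S := by
      by_contra h
      rw [if_neg h] at hs
      omega
    rw [if_pos hjS] at hs
    refine ⟨spread S j + 1, by omega, by omega, fun t ht => ⟨?_, fun y => ?_⟩⟩
    · have := hmono.monotone (show j' ≤ l by rw [Fin.le_def]; simp only [hj']; omega)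
      omega
    · rcases le_or_gt y j with h | h
      · have := hmono.monotone h
        omega
      · have := hmono.monotone (show j' ≤ y by rw [Fin.lt_def] at h; rw [Fin.le_def]; exact h)
        omega

/-- The successor of a position (the last position is its own successor). -/
def nextPos {m : ℕ} (j : Fin m) : Fin m :=
  if h : (j : ℕ) + 1 < m then ⟨j + 1, h⟩ else j

open Classical in
/-- The positions `j` at which the ordering `g` does not continue along an edge of `r`. -/
noncomputable def breaks {m : ℕ} (r : Fin m → Fin m → Prop) (g : Equiv.Perm (Fin m)) :
    Finset (Fin m) :=
  Finset.univ.filter fun j => ¬ ((j : ℕ) + 1 < m ∧ r (g j) (g (nextPos j)))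

lemma mem_breaks {m : ℕ} {r : Fin m → Fin m → Prop} {g : Equiv.Perm (Fin m)} {j : Fin m} :
    j ∈ breaks r g ↔ ¬ ((j : ℕ) + 1 < m ∧ r (g j) (g (nextPos j))) := by
  simp [breaks]

/-- The orderings obtained from those with breaks exactly at `S` and fixed values around the breaks,
by inserting fixed long segments at the breaks, pairwise create no 10-cycle. -/
lemma not_hasC10_extend {n m : ℕ} {r : Fin m → Fin m → Prop} (hsymm : ∀ a b, r a b → r b a)
    (hr : ¬ HasC10 r) (hm : 0 < m) {S : Finset (Fin m)} (hn : m + 11 * S.card ≤ n) {e : Fin m ↪ Fin n}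
    (he : ∀ j, (e j : ℕ) = spread S j) {g g' : Equiv.Perm (Fin m)}
    (hg : breaks r g = S) (hg' : breaks r g' = S)
    (hagree : ∀ j ∈ S, g j = g' j ∧ g (nextPos j) = g' (nextPos j)) :
    ¬ HasC10 fun a b => PathAdj (g.viaFintypeEmbedding e) a b ∨
      PathAdj (g'.viaFintypeEmbedding e) a b := by
  obtain ⟨l, hl⟩ : ∃ l : Fin m, (l : ℕ) + 1 = m := ⟨⟨m - 1, by omega⟩, by simp; omega⟩
  have hlS : l ∈ S := by
    rw [← hg, mem_breaks]
    omega
  have hmono := spread_strictMono S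
  have hlast := spread_last hl hlS
  have hle : ∀ y, spread S y ≤ spread S l := fun y => hmono.monotone (by
    rw [Fin.le_def]; omega)
  have hnext : ∀ i j : Fin m, (i : ℕ) + 1 = j → j = nextPos i := by
    intro i j hij
    rw [nextPos, dif_pos (by omega)]
    exact Fin.ext hij.symm
  have hfix : ∀ (ρ : Equiv.Perm (Fin m)) (x : Fin n), (∀ j, spread S j ≠ x) →
      ρ.viaFintypeEmbedding e x = x := by
    intro ρ x hx
    refine Equiv.Perm.viaFintypeEmbedding_apply_notMem_range _ _ ?_
    rintro ⟨j, hj⟩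
    exact hx j (by rw [← he, hj])
  have happ : ∀ (ρ : Equiv.Perm (Fin m)) (j : Fin m) (x : Fin n), spread S j = x →
      ρ.viaFintypeEmbedding e x = e (ρ j) := by
    intro ρ j x hx
    have : x = e j := Fin.ext (by rw [he, hx])
    rw [this, Equiv.Perm.viaFintypeEmbedding_apply_image]
  have hedge : ∀ ρ : Equiv.Perm (Fin m), breaks r ρ = S → ∀ x y : Fin n,
      ¬ (∀ j, spread S j ≠ x) → ¬ (∀ j, spread S j ≠ y) → (x : ℕ) + 1 = y →
      ∃ i j, e i = ρ.viaFintypeEmbedding e x ∧ e j = ρ.viaFintypeEmbedding e y ∧ r i j := by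
    intro ρ hρ x y hx hy hxy
    push Not at hx hy
    obtain ⟨i, hi⟩ := hx
    obtain ⟨j, hj⟩ := hy
    have hil : (i : ℕ) + 1 < m := by
      by_contra h
      have : i = l := Fin.ext (by omega)
      subst this
      have := hle j
      omega
    have hs := spread_succ S (i := i) (j := ⟨i + 1, hil⟩) rfl
    have hj' : j = ⟨i + 1, hil⟩ := by
      refine le_antisymm (hmono.le_iff_le.1 (by omega)) ?_
      have : i < j := hmono.lt_iff_lt.1 (by omega)
      rw [Fin.le_def]
      exact this
    have hiS : i ∉ S := by
      intro h
      rw [if_pos h, ← hj'] at hs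
      omega
    rw [← hρ, mem_breaks, not_not] at hiS
    refine ⟨ρ i, ρ j, (happ ρ i x hi).symm, (happ ρ j y hj).symm, ?_⟩
    rw [hnext i j (by rw [hj'])]
    exact hiS.2
  refine not_hasC10_pathAdj (r := fun a b => ∃ i j, e i = a ∧ e j = b ∧ r i j)
    (I := fun x => ∀ j, spread S j ≠ x) ?_ ?_ ?_ ?_ ?_ (hedge g hg) (hedge g' hg')
  · rintro _ _ ⟨i, j, rfl, rfl, h⟩
    exact ⟨j, i, rfl, rfl, hsymm _ _ h⟩
  · rintro ⟨f, hf, hadj⟩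
    choose i j h1 h2 h3 using hadj
    have h4 : ∀ k, j k = i (k + 1) := fun k => e.injective (by rw [h2, h1])
    refine hr ⟨i, fun k k' hk => hf (by rw [← h1, ← h1, hk]), fun k => ?_⟩
    rw [← h4]
    exact h3 k
  · intro x hx
    obtain ⟨a, ha1, ha2, ha3⟩ := exists_gap hl hlS hn x hx
    exact ⟨a, ha1, ha2, fun t ht => ⟨(ha3 t ht).1, (ha3 t ht).2⟩⟩
  · intro x hx
    rw [hfix g x hx, hfix g' x hx]
  · intro x y hx hxy
    by_cases hy : ∀ j, spread S j ≠ y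
    · rw [hfix g y hy, hfix g' y hy]
    · push Not at hy
      obtain ⟨j, hj⟩ := hy
      rw [happ g j y hj, happ g' j y hj]
      congr 1
      rcases hxy with h | h
      · have hj0 : 0 < (j : ℕ) := by
          by_contra h0
          have : S.filter (· < j) = ∅ := by
            ext y
            simp only [Finset.mem_filter, Fin.lt_def, Finset.notMem_empty, iff_false]
            omega
          rw [spread, this, Finset.card_empty] at hj
          omega
        have hs := spread_succ S (i := ⟨j - 1, by omega⟩) (j := j) (by simp; omega)
        have hi : (⟨j - 1, by omega⟩ : Fin m) ∈ S := by
          by_contra hi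
          rw [if_neg hi] at hs
          exact hx ⟨j - 1, by omega⟩ (by omega)
        have := (hagree _ hi).2
        rwa [← hnext _ j (by simp; omega)] at this
      · refine (hagree j ?_).1
        by_contra hjS
        have hjl : (j : ℕ) + 1 < m := by
          by_contra hjl
          have : j = l := Fin.ext (by omega)
          exact hjS (this ▸ hlS)
        have hs := spread_succ S (i := j) (j := ⟨j + 1, hjl⟩) rfl
        rw [if_neg hjS] at hs
        exact hx ⟨j + 1, hjl⟩ (by omega)

open Classical in
/-- Many orderings with few breaks along a graph without 10-cycles give an upper bound for families
of Hamilton paths pairwise creating a 10-cycle. -/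
lemma card_mul_card_le_of_breaks {n m M b : ℕ}
    (P : Fin M → Σ u : Fin n, Σ v : Fin n, (⊤ : SimpleGraph (Fin n)).Walk u v)
    (hham : ∀ i, (P i).2.2.IsHamiltonian)
    (hP : ∀ i j, i ≠ j → ContainsCopy (cycleGraph 10) (walkUnion (P i).2.2 (P j).2.2))
    {r : Fin m → Fin m → Prop} (hsymm : ∀ a b, r a b → r b a)
    (hr : ¬ HasC10 r) (hm : 0 < m) (hn : m + 11 * b ≤ n) (Γ : Finset (Equiv.Perm (Fin m)))
    (hΓ : ∀ g ∈ Γ, (breaks r g).card ≤ b) :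
    M * Γ.card ≤ n.factorial * (m ^ (2 * b) * 2 ^ m) := by
  rcases Nat.eq_zero_or_pos M with hM | hM
  · simp [hM]
  have hclass : ∀ S : Finset (Fin m), S.card ≤ b → ∀ c : S → Fin m × Fin m,
      ((Γ.filter fun g => breaks r g = S).filter
        fun g => (fun j : S => (g j, g (nextPos j))) = c).card ≤ n.factorial / M := by
    intro S hS c
    rw [Nat.le_div_iff_mul_le hM, mul_comm]
    set A := (Γ.filter fun g => breaks r g = S).filter
        fun g => (fun j : S => (g j, g (nextPos j))) = c with hA
    rcases A.eq_empty_or_nonempty with h0 | ⟨g₀, hg₀⟩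
    · simp [h0]
    simp only [hA, Finset.mem_filter] at hg₀
    obtain ⟨l, hl⟩ : ∃ l : Fin m, (l : ℕ) + 1 = m := ⟨⟨m - 1, by omega⟩, by simp; omega⟩
    have hlS : l ∈ S := by
      rw [← hg₀.1.2, mem_breaks]
      omega
    have hmono := spread_strictMono S
    have hlast := spread_last hl hlS
    have hlt : ∀ y, spread S y < n := fun y => by
      have := hmono.monotone (show y ≤ l by rw [Fin.le_def]; omega)
      omega
    let e : Fin m ↪ Fin n := ⟨fun j => ⟨spread S j, hlt j⟩, fun i j h =>
      hmono.injective (congrArg Fin.val h)⟩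
    have hinj : Function.Injective
        fun g : Equiv.Perm (Fin m) => g.viaFintypeEmbedding e := by
      intro g g' h
      ext1 j
      have := congrArg (fun ρ : Equiv.Perm (Fin n) => ρ (e j)) h
      simp only [Equiv.Perm.viaFintypeEmbedding_apply_image] at this
      exact e.injective this
    rw [← Finset.card_image_of_injective A hinj]
    refine card_mul_card_le_factorial P hham hP _ ?_
    simp only [Finset.mem_image, forall_exists_index, and_imp, forall_apply_eq_imp_iff₂]
    intro g hg g' hg'
    simp only [hA, Finset.mem_filter] at hg hg'
    refine not_hasC10_extend hsymm hr hm (by omega) (fun _ => rfl) hg.1.2 hg'.1.2 fun j hj => ?_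
    have := congrFun (hg.2.trans hg'.2.symm) ⟨j, hj⟩
    simpa using this
  have hS : ∀ S : Finset (Fin m), (Γ.filter fun g => breaks r g = S).card ≤
      n.factorial / M * m ^ (2 * b) := by
    intro S
    by_cases hS : S.card ≤ b
    · refine (Finset.card_le_mul_card_image_of_maps_to (fun g _ => Finset.mem_univ _) _
        fun c _ => hclass S hS c).trans (Nat.mul_le_mul_left _ ?_)
      rw [Finset.card_univ, Fintype.card_fun, Fintype.card_prod, Fintype.card_fin,
        Fintype.card_coe, ← sq, ← pow_mul]
      exact Nat.pow_le_pow_right hm (by omega)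
    · rw [Finset.filter_eq_empty_iff.2]
      · simp
      · rintro g hg rfl
        exact hS (hΓ g hg)
  have htot := Finset.card_le_mul_card_image_of_maps_to
    (s := Γ) (t := Finset.univ) (fun g _ => Finset.mem_univ (breaks r g)) _ fun S _ => hS S
  rw [Finset.card_univ, Fintype.card_finset, Fintype.card_fin] at htot
  calc M * Γ.card ≤ M * (n.factorial / M * m ^ (2 * b) * 2 ^ m) := Nat.mul_le_mul_left _ htot
    _ = M * (n.factorial / M) * (m ^ (2 * b) * 2 ^ m) := by ring
    _ ≤ _ := Nat.mul_le_mul_right _ (Nat.mul_div_le _ _)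

lemma HasC10.of_comap {U V : Type*} {r : V → V → Prop} {φ : U → V} (hφ : Function.Injective φ)
    (h : HasC10 fun a b => r (φ a) (φ b)) : HasC10 r :=
  let ⟨f, hf, hr⟩ := h
  ⟨φ ∘ f, hφ.comp hf, hr⟩

/-- Disjoint copies, indexed by `C`, of the bipartite incidence graph in which the point `(x, u)` and
the line `(y, w)` are adjacent when `u k + w k = x ^ (k + 1) * y` for all `k < 4`.
The first component of a vertex tells points (`true`) from lines. -/
def WengerAdj {C F : Type*} [Field F] (a b : Bool × C × F × (Fin 4 → F)) : Prop :=
  a.1 ≠ b.1 ∧ a.2.1 = b.2.1 ∧ ∀ k : Fin 4, a.2.2.2 k + b.2.2.2 k =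
    bif a.1 then a.2.2.1 ^ (k + 1 : ℕ) * b.2.2.1 else b.2.2.1 ^ (k + 1 : ℕ) * a.2.2.1

lemma WengerAdj.symm {C F : Type*} [Field F] {a b : Bool × C × F × (Fin 4 → F)}
    (h : WengerAdj a b) : WengerAdj b a := by
  obtain ⟨a1, a2, a3, a4⟩ := a
  obtain ⟨b1, b2, b3, b4⟩ := b
  obtain ⟨h1, h2, h3⟩ := h
  refine ⟨h1.symm, h2.symm, fun k => ?_⟩
  have := h3 k
  cases a1 <;> cases b1 <;> simp_all [add_comm]

/-- Two neighbours of a vertex with the same coordinate are equal. -/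
lemma WengerAdj.eq_of_coord_eq {C F : Type*} [Field F] {a b c : Bool × C × F × (Fin 4 → F)}
    (hab : WengerAdj a b) (hac : WengerAdj a c) (h : b.2.2.1 = c.2.2.1) : b = c := by
  obtain ⟨a1, a2, a3, a4⟩ := a
  obtain ⟨b1, b2, b3, b4⟩ := b
  obtain ⟨c1, c2, c3, c4⟩ := c
  obtain ⟨h1, h2, h3⟩ := hab
  obtain ⟨h4, h5, h6⟩ := hac
  simp only at h h1 h2 h3 h4 h5 h6
  subst h h2 h5
  have : b4 = c4 := by
    funext k
    have := (h3 k).trans (h6 k).symm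
    exact add_left_cancel this
  subst this
  have : b1 = c1 := by cases a1 <;> cases b1 <;> cases c1 <;> simp_all
  rw [this]

lemma eq_zero_of_moments {F : Type*} [Field F] {x₀ x₁ x₂ x₃ x₄ d₀ d₁ d₂ d₃ d₄ : F}
    (h : ∀ j < 5, d₀ * x₀ ^ j + d₁ * x₁ ^ j + d₂ * x₂ ^ j + d₃ * x₃ ^ j + d₄ * x₄ ^ j = 0)
    (h₁ : x₀ ≠ x₁) (h₂ : x₀ ≠ x₂) (h₃ : x₀ ≠ x₃) (h₄ : x₀ ≠ x₄) : d₀ = 0 := by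
  have : d₀ * ((x₀ - x₁) * (x₀ - x₂) * (x₀ - x₃) * (x₀ - x₄)) = 0 := by
    linear_combination h 4 (by norm_num) - (x₁ + x₂ + x₃ + x₄) * h 3 (by norm_num) +
      (x₁ * x₂ + x₁ * x₃ + x₁ * x₄ + x₂ * x₃ + x₂ * x₄ + x₃ * x₄) * h 2 (by norm_num) -
      (x₁ * x₂ * x₃ + x₁ * x₂ * x₄ + x₁ * x₃ * x₄ + x₂ * x₃ * x₄) * h 1 (by norm_num) +
      x₁ * x₂ * x₃ * x₄ * h 0 (by norm_num)
  simpa [sub_eq_zero, h₁, h₂, h₃, h₄] using this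

lemma exists_eq_zero_of_cyclic_moments {F : Type*} [Field F] {x₀ x₁ x₂ x₃ x₄ d₀ d₁ d₂ d₃ d₄ : F}
    (h : ∀ j < 5, d₀ * x₀ ^ j + d₁ * x₁ ^ j + d₂ * x₂ ^ j + d₃ * x₃ ^ j + d₄ * x₄ ^ j = 0)
    (h₀ : x₀ ≠ x₁) (h₁ : x₁ ≠ x₂) (h₂ : x₂ ≠ x₃) (h₃ : x₃ ≠ x₄) (h₄ : x₄ ≠ x₀) :
    d₀ = 0 ∨ d₁ = 0 ∨ d₂ = 0 ∨ d₃ = 0 ∨ d₄ = 0 := by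
  by_cases e02 : x₀ = x₂
  · by_cases e13 : x₁ = x₃
    · exact .inr <| .inr <| .inr <| .inr <| eq_zero_of_moments (d₁ := d₀) (d₂ := d₁) (d₃ := d₂)
        (d₄ := d₃) (fun j hj => by linear_combination h j hj) h₄ (e13 ▸ h₃.symm) (e02 ▸ h₄) h₃.symm
    · by_cases e14 : x₁ = x₄
      · exact .inr <| .inr <| .inr <| .inl <| eq_zero_of_moments (d₁ := d₀) (d₂ := d₁) (d₃ := d₂)
          (d₄ := d₄) (fun j hj => by linear_combination h j hj) (e02 ▸ h₂.symm) (Ne.symm e13)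
          h₂.symm h₃
      · exact .inr <| .inl <| eq_zero_of_moments (d₁ := d₀) (d₂ := d₂) (d₃ := d₃)
          (d₄ := d₄) (fun j hj => by linear_combination h j hj) h₀.symm h₁ e13 e14
  · by_cases e03 : x₀ = x₃
    · by_cases e14 : x₁ = x₄
      · exact .inr <| .inr <| .inl <| eq_zero_of_moments (d₁ := d₀) (d₂ := d₁) (d₃ := d₃)
          (d₄ := d₄) (fun j hj => by linear_combination h j hj) (Ne.symm e02) h₁.symm
          h₂ (e14 ▸ h₁.symm)
      · by_cases e24 : x₂ = x₄
        · exact .inr <| .inl <| eq_zero_of_moments (d₁ := d₀) (d₂ := d₂) (d₃ := d₃)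
            (d₄ := d₄) (fun j hj => by linear_combination h j hj) h₀.symm h₁ (e03 ▸ h₀.symm) e14
        · exact .inr <| .inr <| .inr <| .inr <| eq_zero_of_moments (d₁ := d₀) (d₂ := d₁) (d₃ := d₂)
            (d₄ := d₃) (fun j hj => by linear_combination h j hj) h₄ (Ne.symm e14) (Ne.symm e24)
            h₃.symm
    · exact .inl <| eq_zero_of_moments h h₀ e02 e03 h₄.symm

/-- There are no 10-cycles through a point. -/
lemma WengerAdj.not_cycle {C F : Type*} [Field F] {f : Fin 10 → Bool × C × F × (Fin 4 → F)}
    (hf : Function.Injective f) (h : ∀ i, WengerAdj (f i) (f (i + 1))) (h0 : (f 0).1 = true) :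
    False := by
  have hne : ∀ i, (f i).2.2.1 ≠ (f (i + 2)).2.2.1 := fun i hi => by
    exact (by decide : ∀ i : Fin 10, i ≠ i + 2) i <| hf <| WengerAdj.eq_of_coord_eq (h i).symm
      (show WengerAdj (f (i + 1)) (f (i + 2)) by simpa [add_assoc] using h (i + 1)) hi
  have s1 : (f 1).1 = false := by simpa [h0] using (h 0).1
  have s2 : (f 2).1 = true := by simpa [s1] using (h 1).1
  have s3 : (f 3).1 = false := by simpa [s2] using (h 2).1
  have s4 : (f 4).1 = true := by simpa [s3] using (h 3).1
  have s5 : (f 5).1 = false := by simpa [s4] using (h 4).1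
  have s6 : (f 6).1 = true := by simpa [s5] using (h 5).1
  have s7 : (f 7).1 = false := by simpa [s6] using (h 6).1
  have s8 : (f 8).1 = true := by simpa [s7] using (h 7).1
  have s9 : (f 9).1 = false := by simpa [s8] using (h 8).1
  have hsum : ∀ k : Fin 4, _ := fun k => And.intro ((h 0).2.2 k) <| And.intro ((h 1).2.2 k) <|
    And.intro ((h 2).2.2 k) <| And.intro ((h 3).2.2 k) <| And.intro ((h 4).2.2 k) <|
    And.intro ((h 5).2.2 k) <| And.intro ((h 6).2.2 k) <| And.intro ((h 7).2.2 k) <|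
    And.intro ((h 8).2.2 k) ((h 9).2.2 k)
  simp only [Fin.isValue, zero_add, Fin.reduceAdd, h0, s1, s2, s3, s4, s5, s6, s7, s8, s9, cond_true,
    cond_false] at hsum
  have key := exists_eq_zero_of_cyclic_moments (x₀ := (f 0).2.2.1) (x₁ := (f 2).2.2.1)
    (x₂ := (f 4).2.2.1) (x₃ := (f 6).2.2.1) (x₄ := (f 8).2.2.1)
    (d₀ := (f 9).2.2.1 - (f 1).2.2.1) (d₁ := (f 1).2.2.1 - (f 3).2.2.1)
    (d₂ := (f 3).2.2.1 - (f 5).2.2.1) (d₃ := (f 5).2.2.1 - (f 7).2.2.1)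
    (d₄ := (f 7).2.2.1 - (f 9).2.2.1) ?_ (hne 0) (hne 2) (hne 4) (hne 6) (hne 8)
  · simp only [sub_eq_zero] at key
    rcases key with e | e | e | e | e
    exacts [hne 9 e, hne 1 e, hne 3 e, hne 5 e, hne 7 e]
  · rintro (_ | j) hj
    · ring
    · obtain ⟨e0, e1, e2, e3, e4, e5, e6, e7, e8, e9⟩ := hsum ⟨j, by omega⟩
      simp only at e0 e1 e2 e3 e4 e5 e6 e7 e8 e9
      linear_combination e0 - e1 + e2 - e3 + e4 - e5 + e6 - e7 + e8 - e9

lemma not_hasC10_wengerAdj {C F : Type*} [Field F] :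
    ¬ HasC10 (WengerAdj : (Bool × C × F × (Fin 4 → F)) → _ → Prop) := by
  rintro ⟨f, hf, h⟩
  cases h0 : (f 0).1
  · refine WengerAdj.not_cycle (f := fun i => f (i + 1)) (hf.comp (add_left_injective 1))
      (fun i => h (i + 1)) ?_
    simpa [h0] using (h 0).1
  · exact WengerAdj.not_cycle hf h h0

open Classical in
/-- Composing permutations between consecutive layers, most of which follow a relation `Q`,
gives many orderings that run through the layers with few breaks. -/
lemma exists_orderings {k m : ℕ} {W : Type*} [Fintype W] {Q : Fin (k + 1) × W → Fin (k + 1) × W → Prop}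
    {e : Fin (k + 1) × W ≃ Fin m}
    (he : ∀ (i : Fin k) w, (e (i.succ, w) : ℕ) = e (i.castSucc, w) + 1) {T β : ℝ} (hT0 : 0 ≤ T)
    (hT : ∀ i : Fin k, T ≤ (Finset.univ.filter fun σ : Equiv.Perm W =>
      ((Finset.univ.filter fun w => ¬ Q (i.castSucc, w) (i.succ, σ w)).card : ℝ) ≤ β).card) :
    ∃ Γ : Finset (Equiv.Perm (Fin m)), T ^ k ≤ Γ.card ∧
      ∀ g ∈ Γ, ((breaks (fun a b => Q (e.symm a) (e.symm b)) g).card : ℝ) ≤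
        k * β + Fintype.card W := by
  set S : Fin k → Finset (Equiv.Perm W) := fun i => Finset.univ.filter fun σ : Equiv.Perm W =>
      ((Finset.univ.filter fun w => ¬ Q (i.castSucc, w) (i.succ, σ w)).card : ℝ) ≤ β with hS
  set τ : (Fin k → Equiv.Perm W) → Fin (k + 1) → Equiv.Perm W := fun σ i =>
    (Fin.partialProd (fun i => (σ i)⁻¹) i)⁻¹ with hτ
  have hτs : ∀ σ (i : Fin k), τ σ i.succ = σ i * τ σ i.castSucc := fun σ i => by
    simp [hτ, Fin.partialProd_succ]
  set G : (Fin k → Equiv.Perm W) → Equiv.Perm (Fin m) := fun σ =>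
    e.permCongr ((Equiv.refl _).prodShear (τ σ)) with hG
  have hGe : ∀ σ i w, G σ (e (i, w)) = e (i, τ σ i w) := fun σ i w => by
    simp [hG, Equiv.permCongr_apply]
  have hGinj : Function.Injective G := by
    intro σ σ' h
    have hττ : ∀ i, τ σ i = τ σ' i := fun i => by
      ext w
      have := congrArg (fun g : Equiv.Perm (Fin m) => g (e (i, w))) h
      simpa [hGe] using this
    funext i
    have := hτs σ i
    rw [hττ, hττ, hτs] at this
    exact (mul_right_cancel this).symm
  refine ⟨(Fintype.piFinset S).image G, ?_, ?_⟩
  · rw [Finset.card_image_of_injective _ hGinj, Fintype.card_piFinset]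
    push_cast
    calc T ^ k = ∏ _i : Fin k, T := by simp
      _ ≤ _ := Finset.prod_le_prod (fun _ _ => hT0) fun i _ => hT i
  · simp only [Finset.mem_image, Fintype.mem_piFinset]
    rintro _ ⟨σ, hσ, rfl⟩
    set r := fun a b => Q (e.symm a) (e.symm b) with hr
    have h1 : (breaks r (G σ)).card =
        ∑ i, (Finset.univ.filter fun w => e (i, w) ∈ breaks r (G σ)).card := by
      simp only [Finset.card_filter]
      rw [← Fintype.sum_prod_type' (fun i w => if e (i, w) ∈ breaks r (G σ) then 1 else 0),
        e.sum_comp (fun j => if j ∈ breaks r (G σ) then 1 else 0)]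
      simp
    have h2 : ∀ i : Fin k,
        ((Finset.univ.filter fun w => e (i.castSucc, w) ∈ breaks r (G σ)).card : ℝ) ≤ β := by
      intro i
      refine le_trans ?_ (Finset.mem_filter.1 (hσ i)).2
      norm_cast
      refine Finset.card_le_card_of_injOn (τ σ i.castSucc) ?_ (Equiv.injective _).injOn
      intro w hw
      simp only [Finset.coe_filter, Finset.mem_univ, true_and, Set.mem_ofPred_eq] at hw ⊢
      contrapose! hw
      rw [mem_breaks, not_not]
      have hlt : (e (i.castSucc, w) : ℕ) + 1 < m := he i w ▸ (e (i.succ, w)).2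
      have hnext : nextPos (e (i.castSucc, w)) = e (i.succ, w) := by
        rw [nextPos, dif_pos hlt]
        exact Fin.ext (he i w).symm
      refine ⟨hlt, ?_⟩
      rw [hnext, hGe, hGe, hτs]
      simpa [hr] using hw
    rw [h1, Fin.sum_univ_castSucc]
    push_cast
    refine add_le_add ?_ (by exact_mod_cast Finset.card_le_univ _)
    calc _ ≤ ∑ _i : Fin k, β := Finset.sum_le_sum fun i _ => h2 i
      _ = _ := by simp

/-- The vertices of one of several layers: copy, coordinate within the layer, vector. -/
abbrev WengerLayer (t d p : ℕ) : Type := Fin t × Fin d × (Fin 4 → ZMod p)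

/-- The vertex of the layered incidence graph given by `w` in the `i`-th layer. Points are in the
even layers, and the coordinates in the `i`-th layer are in `[i * d, (i + 1) * d)`. -/
def wengerVertex {t d p : ℕ} (i : ℕ) (w : WengerLayer t d p) :
    Bool × Fin t × ZMod p × (Fin 4 → ZMod p) :=
  (decide (i % 2 = 0), w.1, ((i * d + w.2.1 : ℕ) : ZMod p), w.2.2)

lemma wengerVertex_injective {t d p k : ℕ} (hp : (k + 1) * d ≤ p) :
    Function.Injective fun x : Fin (k + 1) × WengerLayer t d p => wengerVertex x.1 x.2 := by
  have hlt : ∀ (i : Fin (k + 1)) (r : Fin d), (i : ℕ) * d + r < p := fun i r => by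
    have := Nat.mul_le_mul_right d (Nat.succ_le_of_lt i.2)
    rw [Nat.succ_mul] at this
    omega
  rintro ⟨i, c, r, v⟩ ⟨i', c', r', v'⟩ h
  simp only [wengerVertex, Prod.mk.injEq] at h ⊢
  obtain ⟨-, hc, hz, hv⟩ := h
  rw [ZMod.natCast_eq_natCast_iff'] at hz
  rw [Nat.mod_eq_of_lt (hlt i r), Nat.mod_eq_of_lt (hlt i' r')] at hz
  have hd : 0 < d := r.pos
  have h1 : (i : ℕ) = i' := by
    have := congrArg (· / d) hz
    simpa [Nat.add_div_of_dvd_right, hd, Nat.div_eq_of_lt] using this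
  refine ⟨Fin.ext h1, hc, Fin.ext ?_, hv⟩
  rw [h1] at hz
  omega

open Classical in
lemma card_wengerAdj {t d p i j : ℕ} [Fact p.Prime] (hij : i % 2 ≠ j % 2) (w : WengerLayer t d p) :
    (Finset.univ.filter fun w' : WengerLayer t d p =>
      WengerAdj (wengerVertex i w) (wengerVertex j w')).card = d := by
  set z : Fin d → ZMod p := fun r => ((j * d + r : ℕ) : ZMod p) with hz
  set x : ZMod p := ((i * d + w.2.1 : ℕ) : ZMod p) with hx
  set V : Fin d → WengerLayer t d p := fun r => (w.1, r, fun k =>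
    (bif decide (i % 2 = 0) then x ^ (k + 1 : ℕ) * z r else z r ^ (k + 1 : ℕ) * x) - w.2.2 k)
    with hV
  have hVinj : Function.Injective V := fun r r' h => by
    simp only [hV, Prod.mk.injEq] at h
    exact h.2.1
  have : (Finset.univ.filter fun w' : WengerLayer t d p =>
      WengerAdj (wengerVertex i w) (wengerVertex j w')) = Finset.univ.image V := by
    ext ⟨c, r, v⟩
    simp only [Finset.mem_filter, Finset.mem_univ, true_and, Finset.mem_image]
    constructor
    · rintro ⟨-, hc, h⟩
      refine ⟨r, ?_⟩
      simp only [hV, Prod.mk.injEq, true_and]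
      refine ⟨hc, funext fun k => ?_⟩
      rw [sub_eq_iff_eq_add']
      exact (h k).symm
    · rintro ⟨r', h⟩
      simp only [hV, Prod.mk.injEq] at h
      obtain ⟨rfl, rfl, rfl⟩ := h
      refine ⟨?_, rfl, fun k => ?_⟩
      · simp only [wengerVertex, ne_eq, decide_eq_decide]
        omega
      · simp [wengerVertex, hx, hz]
  rw [this, Finset.card_image_of_injective _ hVinj, Finset.card_univ, Fintype.card_fin]

lemma card_wengerLayer {t d p : ℕ} [NeZero p] :
    Fintype.card (WengerLayer t d p) = t * (d * p ^ 4) := by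
  simp [WengerLayer, ZMod.card]

open Classical in
/-- The bound on a family of Hamilton paths coming from the layered incidence graph with `k + 1`
layers, in terms of the number `T` of permutations that mostly follow a given `d`-regular
relation. -/
lemma card_mul_pow_le {n M t d p k b N : ℕ} [Fact p.Prime]
    (P : Fin M → Σ u : Fin n, Σ v : Fin n, (⊤ : SimpleGraph (Fin n)).Walk u v)
    (hham : ∀ i, (P i).2.2.IsHamiltonian)
    (hP : ∀ i j, i ≠ j → ContainsCopy (cycleGraph 10) (walkUnion (P i).2.2 (P j).2.2))
    (hp : (k + 1) * d ≤ p) (hN : t * (d * p ^ 4) = N) (hN0 : 0 < N) {T β : ℝ} (hT0 : 0 ≤ T)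
    (hT : ∀ (W : Type) [Fintype W], Fintype.card W = N → ∀ R : W → W → Prop,
      (∀ w, (Finset.univ.filter fun w' => R w w').card = d) →
      (∀ w', (Finset.univ.filter fun w => R w w').card = d) →
      T ≤ (Finset.univ.filter fun σ : Equiv.Perm W =>
        ((Finset.univ.filter fun w => ¬ R w (σ w)).card : ℝ) ≤ β).card)
    (hb : k * β + N ≤ b) (hn : N * (k + 1) + 11 * b ≤ n) :
    M * T ^ k ≤ (n.factorial * ((N * (k + 1)) ^ (2 * b) * 2 ^ (N * (k + 1))) : ℝ) := by
  set e : Fin (k + 1) × WengerLayer t d p ≃ Fin (N * (k + 1)) := (Equiv.prodComm _ _).trans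
    (((Fintype.equivFinOfCardEq (card_wengerLayer.trans hN)).prodCongr (Equiv.refl _)).trans
      finProdFinEquiv) with he
  set Q : Fin (k + 1) × WengerLayer t d p → Fin (k + 1) × WengerLayer t d p → Prop := fun x y =>
    WengerAdj (wengerVertex x.1 x.2) (wengerVertex y.1 y.2) with hQ
  have hstep : ∀ (i : Fin k) w, (e (i.succ, w) : ℕ) = e (i.castSucc, w) + 1 := fun i w => by
    simp only [he, Equiv.trans_apply, Equiv.prodComm_apply, Prod.swap_prod_mk,
      Equiv.prodCongr_apply, Prod.map_apply, Equiv.refl_apply, finProdFinEquiv_apply_val,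
      Fin.val_succ, Fin.val_castSucc]
    ring
  have hreg := fun i : Fin k => hT (WengerLayer t d p) (card_wengerLayer.trans hN)
    (fun w w' => Q (i.castSucc, w) (i.succ, w'))
    (fun w => by
      simp only [hQ, Fin.val_castSucc, Fin.val_succ]
      exact card_wengerAdj (by omega) w)
    (fun w' => by
      simp only [hQ, Fin.val_castSucc, Fin.val_succ]
      exact (congrArg Finset.card <| Finset.filter_congr fun w _ =>
        ⟨WengerAdj.symm, WengerAdj.symm⟩).trans (card_wengerAdj (by omega) w'))
  obtain ⟨Γ, hΓ, hΓb⟩ := exists_orderings hstep hT0 hreg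
  have key := card_mul_card_le_of_breaks P hham hP (r := fun a b => Q (e.symm a) (e.symm b))
    (fun a b h => h.symm) (fun h => not_hasC10_wengerAdj <| HasC10.of_comap
      (φ := fun a => wengerVertex (e.symm a).1 (e.symm a).2)
      ((wengerVertex_injective hp).comp e.symm.injective) h)
    (by positivity) hn Γ fun g hg => by
      have := hΓb g hg
      rw [card_wengerLayer, hN] at this
      exact_mod_cast this.trans hb
  calc M * T ^ k ≤ (M : ℝ) * Γ.card := by gcongr
    _ ≤ _ := by exact_mod_cast key

/-- The choice of the parameters of the layered incidence graph. -/
lemma exists_wengerParams (k : ℕ) : ∃ A : ℕ, 0 < A ∧ ∀ d₀ : ℕ, ∃ n₀ : ℕ, ∀ n : ℕ, n₀ ≤ n →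
    ∃ d p t : ℕ, d₀ ≤ d ∧ 0 < d ∧ p.Prime ∧ (k + 1) * d ≤ p ∧ 0 < t * (d * p ^ 4) ∧ n ≤ A * d ^ 5 ∧
      (k + 23) * (t * (d * p ^ 4)) ≤ n ∧ n ≤ (k + 24) * (t * (d * p ^ 4)) := by
  set B : ℕ := 16 * (k + 23) ^ 2 * (k + 1) ^ 4 with hB
  have hB0 : 0 < B := by positivity
  refine ⟨32 * B, by positivity, fun d₀ => ⟨B * (d₀ + 1) ^ 5, fun n hn => ?_⟩⟩
  have hex : ∃ d, n < B * (d + 1) ^ 5 :=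
    ⟨n, calc n < n + 1 := n.lt_succ_self
      _ ≤ (n + 1) ^ 5 := Nat.le_self_pow (by norm_num) _
      _ ≤ B * (n + 1) ^ 5 := Nat.le_mul_of_pos_left _ hB0⟩
  obtain ⟨d, hd, hmin⟩ : ∃ d, n < B * (d + 1) ^ 5 ∧ ∀ m < d, ¬ n < B * (m + 1) ^ 5 :=
    ⟨Nat.find hex, Nat.find_spec hex, fun m hm => Nat.find_min hex hm⟩
  have hdd : d₀ < d := by
    by_contra! h
    have : B * (d + 1) ^ 5 ≤ B * (d₀ + 1) ^ 5 := by gcongr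
    omega
  have hd0 : 0 < d := by omega
  have hBd : B * d ^ 5 ≤ n := by
    have := hmin (d - 1) (by omega)
    rwa [Nat.sub_add_cancel hd0, not_lt] at this
  obtain ⟨p, hp, hp1, hp2⟩ := Nat.exists_prime_lt_and_le_two_mul ((k + 1) * d) (by positivity)
  have hp0 := hp.pos
  set q := (k + 23) * (d * p ^ 4) with hq
  have hq0 : 0 < q := by positivity
  have hqn : (k + 23) * q ≤ n := by
    calc (k + 23) * q ≤ (k + 23) * ((k + 23) * (d * (2 * ((k + 1) * d)) ^ 4)) := by
          rw [hq]
          gcongr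
      _ = B * d ^ 5 := by ring
      _ ≤ n := hBd
  have ht : k + 23 ≤ n / q := (Nat.le_div_iff_mul_le hq0).2 hqn
  have h1 : n / q * q ≤ n := Nat.div_mul_le_self n q
  have h2 : n < (n / q + 1) * q :=
     (Nat.div_lt_iff_lt_mul hq0).1 (Nat.lt_succ_self _)
  refine ⟨d, p, n / q, hdd.le, hd0, hp, hp1.le, ?_, ?_, ?_, ?_⟩
  · have : 0 < n / q := by omega
    positivity
  · calc n ≤ B * (d + 1) ^ 5 := hd.le
      _ ≤ B * (2 * d) ^ 5 := by gcongr; omega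
      _ = 32 * B * d ^ 5 := by ring
  · calc _ = n / q * q := by rw [hq]; ring
      _ ≤ n := h1
  · calc n ≤ n / q * q + q := by linarith
      _ = n / q * q + (k + 23) * (d * p ^ 4) := by rw [hq]
      _ ≤ n / q * q + n / q * (d * p ^ 4) := by gcongr
      _ = _ := by rw [hq]; ring

lemma le_of_log_bound {n N k x y l a c D ε T : ℝ} (hk : 0 ≤ k) (hN : 0 ≤ N) (hl : 0 ≤ l)
    (ha : 0 ≤ a) (hc : 0 ≤ c) (hD : D = 3 * Real.log 2 + c + a / 5) (hDl : D ≤ ε / 2 * l)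
    (hε : 0 < ε) (hεk : 18 ≤ ε * (k + 1)) (h1 : (k + 23) * N ≤ n) (h2 : n ≤ (k + 24) * N)
    (hy : l - a ≤ 5 * y) (hT : (1 - 1 / (k + 1)) * N * (y - c) - 2 * N * Real.log 2 ≤ T)
    (hx : x + k * T ≤ n * l + 4 * N * l + n * Real.log 2) :
    x ≤ (4 / 5 + ε) * n * l := by
  have hlog : 0 ≤ Real.log 2 := Real.log_nonneg (by norm_num)
  have hk1 : 0 < k + 1 := by linarith
  have hn : 0 ≤ n := le_trans (by positivity) h1
  set S := k * (1 - 1 / (k + 1)) * N with hS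
  have hS' : (k + 1) * S = k ^ 2 * N := by
    rw [hS]
    field_simp
    ring
  have hS0 : 0 ≤ S := by
    by_contra! h
    nlinarith [mul_nonneg (sq_nonneg k) hN]
  have hSk : S ≤ k * N := by
    by_contra! h
    nlinarith [mul_nonneg hk hN]
  have hSk' : (k - 1) * N ≤ S := by
    by_contra! h
    nlinarith
  have e1 : S * ((l - a) / 5 - c) - 2 * (k * N) * Real.log 2 ≤ k * T := by
    have := mul_le_mul_of_nonneg_left hT hk
    have h3 : S * ((l - a) / 5 - c) ≤ S * (y - c) := mul_le_mul_of_nonneg_left (by linarith) hS0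
    calc _ ≤ S * (y - c) - 2 * (k * N) * Real.log 2 := by linarith
      _ = k * ((1 - 1 / (k + 1)) * N * (y - c) - 2 * N * Real.log 2) := by rw [hS]; ring
      _ ≤ _ := this
  have hkN : k * N ≤ n := by nlinarith
  have e2 : S * (a / 5 + c) ≤ n * (a / 5 + c) :=
    mul_le_mul_of_nonneg_right (hSk.trans hkN) (by positivity)
  have e3 : 2 * (k * N) * Real.log 2 ≤ 2 * n * Real.log 2 := by gcongr
  have e4 : n * D ≤ n * (ε / 2 * l) := mul_le_mul_of_nonneg_left hDl hn
  have e5 : n / 5 + 4 * N - S / 5 ≤ ε / 2 * n := by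
    have : 18 * N ≤ ε * (k + 1) * N := mul_le_mul_of_nonneg_right hεk hN
    have h3 : ε * ((k + 1) * N) ≤ ε * n := mul_le_mul_of_nonneg_left (by nlinarith) hε.le
    linarith
  have e6 := mul_le_mul_of_nonneg_right e5 hl
  rw [hD] at e4
  nlinarith

/-- H_n(C₁₀) ≤ n ^ ((4/5) n + o(n)). -/
theorem Hn_C10_upper :
    ∀ ε : ℝ, 0 < ε → ∃ n₀ : ℕ, ∀ n : ℕ, n₀ ≤ n →
      ∀ (m : ℕ) (P : Fin m → Σ u : Fin n, Σ v : Fin n, (⊤ : SimpleGraph (Fin n)).Walk u v),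
        Function.Injective P →
        (∀ i, (P i).2.2.IsHamiltonian) →
        (∀ i j, i ≠ j → ContainsCopy (cycleGraph 10) (walkUnion (P i).2.2 (P j).2.2)) →
        (m : ℝ) ≤ (n : ℝ) ^ ((4 / 5 + ε) * n) := by
  intro ε hε
  obtain ⟨k, hk⟩ : ∃ k : ℕ, 18 ≤ ε * (k + 1) := by
    obtain ⟨k, hk⟩ := exists_nat_ge (18 / ε)
    refine ⟨k, ?_⟩
    rw [div_le_iff₀ hε] at hk
    linarith
  set δ : ℝ := 1 / (4 * (k + 1)) with hδ
  have hδ0 : 0 < δ := by positivity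
  have hδk : 4 * δ * (k + 1) = 1 := by
    rw [hδ]
    field_simp
  set C : ℝ := 4 / δ ^ 2 with hC
  have hC0 : 0 < C := by positivity
  have hC1 : 1 ≤ C := by
    have : δ ≤ 1 := by nlinarith
    rw [hC, le_div_iff₀ (by positivity)]
    nlinarith
  obtain ⟨d₀, hd₀⟩ := exists_many_perms hδ0
  obtain ⟨A, hA0, hA⟩ := exists_wengerParams k
  obtain ⟨n₁, hn₁⟩ := hA (max d₀ ⌈C⌉₊)
  obtain ⟨n₂, hn₂⟩ := Filter.eventually_atTop.1 <|
    (Real.tendsto_log_atTop.comp tendsto_natCast_atTop_atTop).eventually_ge_atTop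
      ((3 * Real.log 2 + Real.log C + Real.log A / 5) / (ε / 2))
  refine ⟨max n₁ n₂, fun n hn M P _ hham hP => ?_⟩
  obtain ⟨d, p, t, hd, hd0, hp, hkp, hN0, hnA, hn1, hn2⟩ := hn₁ n (by omega)
  have hlogn := hn₂ n (by omega)
  rw [div_le_iff₀ (by positivity), Function.comp_apply] at hlogn
  have : Fact p.Prime := ⟨hp⟩
  obtain ⟨N, hN⟩ : ∃ N, t * (d * p ^ 4) = N := ⟨_, rfl⟩
  rw [hN] at hN0 hn1 hn2
  have hdC : C ≤ d := (Nat.le_ceil C).trans (Nat.cast_le.2 (by omega))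
  have hd0' : (0 : ℝ) < d := by exact_mod_cast hd0
  have hN1 : (1 : ℝ) ≤ N := by exact_mod_cast hN0
  have hn0 : 0 < n := by nlinarith
  have hn0' : (0 : ℝ) < n := by exact_mod_cast hn0
  rcases M.eq_zero_or_pos with rfl | hM
  · rw [Nat.cast_zero]
    positivity
  have hM' : (0 : ℝ) < M := by exact_mod_cast hM
  set T : ℝ := 1 / 2 / (2 ^ N * (C / d) ^ ((1 - 2 * δ) * N)) with hT
  have hT0 : 0 < T := by positivity
  have key := card_mul_pow_le P hham hP hkp hN hN0 hT0.le (β := 4 * δ * N) (b := 2 * N)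
    (fun W _ hW R h1 h2 => by
      have : Nonempty W := Fintype.card_pos_iff.1 (hW ▸ hN0)
      have := hd₀ d (by omega) R h1 h2
      rw [hW] at this
      rw [hT, div_le_iff₀ (by positivity)]
      linarith)
    (by push_cast; nlinarith) (by linarith)
  have hle : M * T ^ k ≤ (n : ℝ) ^ n * ((n : ℝ) ^ (4 * N) * 2 ^ n) := by
    have hNk : N * (k + 1) ≤ n := by nlinarith
    refine key.trans ?_
    rw [show 2 * (2 * N) = 4 * N by ring]
    gcongr
    · exact_mod_cast n.factorial_le_pow
    · exact_mod_cast hNk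
    · norm_num
  rw [Real.le_rpow_iff_log_le hM' hn0']
  have hlog2 : 0 ≤ Real.log 2 := Real.log_nonneg (by norm_num)
  refine le_of_log_bound (n := n) (N := N) (k := k) (y := Real.log d) (T := Real.log T)
    (Nat.cast_nonneg _) (Nat.cast_nonneg _) (Real.log_natCast_nonneg _) (Real.log_natCast_nonneg A)
    (Real.log_nonneg hC1) rfl (by linarith) hε hk (by exact_mod_cast hn1) (by exact_mod_cast hn2)
    ?_ ?_ ?_
  · have : Real.log n ≤ Real.log (A * d ^ 5) := Real.log_le_log hn0' (by exact_mod_cast hnA)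
    rw [Real.log_mul (by positivity) (by positivity), Real.log_pow] at this
    push_cast at this
    linarith
  · have h0 : Real.log T = -Real.log 2 -
        (N * Real.log 2 + (1 - 2 * δ) * N * (Real.log C - Real.log d)) := by
      rw [hT, Real.log_div (by norm_num) (by positivity),
        Real.log_mul (by positivity) (by positivity), Real.log_pow, Real.log_rpow (by positivity),
        Real.log_div hC0.ne' hd0'.ne', one_div, Real.log_inv]
    have h1 : 0 ≤ Real.log d - Real.log C := sub_nonneg.2 (Real.log_le_log hC0 hdC)
    have h2 : 1 - 1 / (k + 1 : ℝ) ≤ 1 - 2 * δ := by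
      have : 1 / (k + 1 : ℝ) = 4 * δ := by
        rw [hδ]
        field_simp
      linarith
    have h3 := mul_le_mul_of_nonneg_right
      (mul_le_mul_of_nonneg_right h2 (Nat.cast_nonneg (α := ℝ) N)) h1
    have h4 := mul_le_mul_of_nonneg_right hN1 hlog2
    linarith
  · have := Real.log_le_log (by positivity) hle
    rw [Real.log_mul (by positivity) (by positivity), Real.log_mul (by positivity) (by positivity),
      Real.log_mul (by positivity) (by positivity), Real.log_pow, Real.log_pow, Real.log_pow,
      Real.log_pow] at this
    push_cast at this
    linarith
end

section
/- For every integer k ≥ 2 and every ε > 0 there exists n₀ such that for all integers n ≥ n₀, H_n(C_{2k}) ≤ n^{(1 − 2/(3k) + ε)n}; that is, the maximum size of a family of Hamilton paths in K_n the union of any two of which contains a cycle of length 2k is at most n^{(1 − 2/(3k))n + o(n)}. -/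
open SimpleGraph

open Polynomial in
/-- The truncated polynomial ring `F[X] / (X ^ h)`. -/
abbrev TruncPoly (F : Type) [Field F] (h : ℕ) : Type :=
  F[X] ⧸ Ideal.span {(X : F[X]) ^ h}

namespace TruncPoly

open Polynomial Matrix

variable {F : Type} [Field F] {h : ℕ}

/-- The quotient map onto the truncated polynomial ring. -/
noncomputable abbrev proj (F : Type) [Field F] (h : ℕ) : F[X] →+* TruncPoly F h :=
  Ideal.Quotient.mk (Ideal.span {(X : F[X]) ^ h})

theorem proj_eq_zero_iff {f : F[X]} : proj F h f = 0 ↔ X ^ h ∣ f := by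
  rw [Ideal.Quotient.eq_zero_iff_mem, Ideal.mem_span_singleton]

theorem proj_eq_proj_iff {f g : F[X]} :
    proj F h f = proj F h g ↔ ∀ j < h, f.coeff j = g.coeff j := by
  rw [← sub_eq_zero, ← map_sub, proj_eq_zero_iff, X_pow_dvd_iff]
  simp [sub_eq_zero]

/-- The coefficient of `X` of a truncated polynomial. -/
noncomputable def linCoeff (r : TruncPoly F h) : F :=
  (Function.surjInv (Ideal.Quotient.mk_surjective (I := Ideal.span {(X : F[X]) ^ h})) r).coeff 1

theorem linCoeff_proj (hh : 1 < h) (f : F[X]) : linCoeff (proj F h f) = f.coeff 1 := by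
  have := Function.surjInv_eq
    (Ideal.Quotient.mk_surjective (I := Ideal.span {(X : F[X]) ^ h})) (proj F h f)
  exact proj_eq_proj_iff.1 this 1 hh

theorem isUnit_proj {f : F[X]} (hf : f.coeff 0 = 1) : IsUnit (proj F h f) := by
  obtain ⟨g, hg⟩ : (X : F[X]) ∣ f - 1 := by rw [X_dvd_iff]; simp [hf]
  have : proj F h f = 1 + proj F h (X * g) := by rw [← hg]; simp
  rw [this]
  refine IsNilpotent.isUnit_one_add ⟨h, ?_⟩
  rw [← map_pow, proj_eq_zero_iff, mul_pow]
  exact Dvd.intro _ rfl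

end TruncPoly

section TransvectionWords

open Polynomial Matrix

variable {F : Type} [Field F]

/-- The upper transvection with entry `a X`. -/
noncomputable def upperX (a : F) : Matrix (Fin 2) (Fin 2) F[X] := !![1, C a * X; 0, 1]

/-- The lower transvection with entry `a X`. -/
noncomputable def lowerX (a : F) : Matrix (Fin 2) (Fin 2) F[X] := !![1, 0; C a * X, 1]

theorem upperX_mul (a b : F) : upperX a * upperX b = upperX (a + b) := by
  ext i j : 1
  fin_cases i <;> fin_cases j <;> simp [upperX, Matrix.mul_apply, Fin.sum_univ_two]; ring

theorem lowerX_mul (a b : F) : lowerX a * lowerX b = lowerX (a + b) := by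
  ext i j : 1
  fin_cases i <;> fin_cases j <;> simp [lowerX, Matrix.mul_apply, Fin.sum_univ_two]; ring

theorem upperX_zero : upperX (0 : F) = 1 := by
  ext i j : 1
  fin_cases i <;> fin_cases j <;> simp [upperX]

theorem lowerX_zero : lowerX (0 : F) = 1 := by
  ext i j : 1
  fin_cases i <;> fin_cases j <;> simp [lowerX]

theorem det_upperX (a : F) : (upperX a).det = 1 := by simp [upperX, det_fin_two]

theorem det_lowerX (a : F) : (lowerX a).det = 1 := by simp [lowerX, det_fin_two]

/-- An alternating word in lower and upper transvections. -/
noncomputable def altWord (c b : ℕ → F) : ℕ → Matrix (Fin 2) (Fin 2) F[X]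
  | 0 => 1
  | n + 1 => altWord c b n * (lowerX (c n) * upperX (b n))

theorem det_altWord (c b : ℕ → F) (n : ℕ) : (altWord c b n).det = 1 := by
  induction n with
  | zero => simp [altWord]
  | succ n ih => simp [altWord, ih, det_upperX, det_lowerX]

theorem lowerX_mul_upperX (a b : F) :
    lowerX a * upperX b = !![1, C b * X; C a * X, 1 + C (a * b) * X ^ 2] := by
  ext i j : 1
  fin_cases i <;> fin_cases j <;> simp [lowerX, upperX, Matrix.mul_apply, Fin.sum_univ_two]; ring

theorem coeff_altWord (c b : ℕ → F) (n : ℕ) :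
    (∀ j, 2 * n ≤ j → 1 ≤ j → (altWord c b n 0 0).coeff j = 0) ∧
    (∀ j, 2 * n ≤ j → (altWord c b n 0 1).coeff j = 0) ∧
    (∀ j, 2 * n ≤ j → (altWord c b n 1 0).coeff j = 0) ∧
    (∀ j, 2 * n < j → (altWord c b n 1 1).coeff j = 0) ∧
    (altWord c b n 1 1).coeff (2 * n) = ∏ i ∈ Finset.range n, c i * b i := by
  induction n with
  | zero =>
    refine ⟨fun j _ hj => ?_, ?_, ?_, fun j hj => ?_, ?_⟩ <;> simp [altWord]
    · rw [coeff_one, if_neg (by omega)]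
    · rw [coeff_one, if_neg (by omega)]
  | succ n ih =>
    obtain ⟨hA, hB, hC, hD, hL⟩ := ih
    have key : ∀ i : Fin 2, ∀ j,
        (altWord c b (n + 1) i 0).coeff (j + 2) =
          (altWord c b n i 0).coeff (j + 2) + c n * (altWord c b n i 1).coeff (j + 1) ∧
        (altWord c b (n + 1) i 1).coeff (j + 2) =
          b n * (altWord c b n i 0).coeff (j + 1) + (altWord c b n i 1).coeff (j + 2) +
            c n * b n * (altWord c b n i 1).coeff j := by
      intro i j
      constructor
      · simp only [altWord, lowerX_mul_upperX, Matrix.mul_apply, Fin.sum_univ_two]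
        simp only [Matrix.of_apply, Matrix.cons_val', Matrix.cons_val_one, Matrix.cons_val_zero,
          Matrix.cons_val_fin_one, mul_one]
        have e : altWord c b n i 0 + altWord c b n i 1 * (C (c n) * X) =
            altWord c b n i 0 + C (c n) * (altWord c b n i 1 * X) := by ring
        rw [e, coeff_add, coeff_C_mul, coeff_mul_X]
      · simp only [altWord, lowerX_mul_upperX, Matrix.mul_apply, Fin.sum_univ_two]
        simp only [Matrix.of_apply, Matrix.cons_val', Matrix.cons_val_one, Matrix.cons_val_zero,
          Matrix.cons_val_fin_one]
        have e : altWord c b n i 0 * (C (b n) * X) +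
            altWord c b n i 1 * (1 + C (c n * b n) * X ^ 2) =
            C (b n) * (altWord c b n i 0 * X) + altWord c b n i 1 +
              C (c n * b n) * (altWord c b n i 1 * X ^ 2) := by ring
        rw [e, coeff_add, coeff_add, coeff_C_mul, coeff_C_mul, coeff_mul_X, coeff_mul_X_pow]
    refine ⟨?_, ?_, ?_, ?_, ?_⟩
    · intro j hj _
      obtain ⟨j, rfl⟩ := Nat.exists_eq_add_of_le' (show 2 ≤ j by omega)
      rw [(key 0 j).1, hA _ (by omega) (by omega), hB _ (by omega)]; simp
    · intro j hj
      obtain ⟨j, rfl⟩ := Nat.exists_eq_add_of_le' (show 2 ≤ j by omega)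
      rw [(key 0 j).2, hA _ (by omega) (by omega), hB _ (by omega), hB _ (by omega)]; simp
    · intro j hj
      obtain ⟨j, rfl⟩ := Nat.exists_eq_add_of_le' (show 2 ≤ j by omega)
      rw [(key 1 j).1, hC _ (by omega), hD _ (by omega)]; simp
    · intro j hj
      obtain ⟨j, rfl⟩ := Nat.exists_eq_add_of_le' (show 2 ≤ j by omega)
      rw [(key 1 j).2, hC _ (by omega), hD _ (by omega), hD _ (by omega)]; simp
    · rw [show 2 * (n + 1) = 2 * n + 2 by ring, (key 1 _).2, hC _ (by omega), hD _ (by omega), hL,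
        Finset.prod_range_succ]
      ring

/-- A nontrivial alternating word of length `2 k` is not the identity modulo `X ^ (k + 1)`:
by the determinant condition its trace would be `2` modulo `X ^ (2 k + 2)`. -/
theorem altWord_not_congr_one (c b : ℕ → F) (hc : ∀ i, c i ≠ 0) (hb : ∀ i, b i ≠ 0) {k : ℕ}
    (hk : 1 ≤ k) :
    (altWord c b k).map (TruncPoly.proj F (k + 1)) ≠ 1 := by
  intro h
  have h00 := congrFun (congrFun h 0) 0
  have h01 := congrFun (congrFun h 0) 1
  have h10 := congrFun (congrFun h 1) 0
  have h11 := congrFun (congrFun h 1) 1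
  simp only [Matrix.map_apply, Matrix.one_apply, if_true, zero_ne_one, one_ne_zero, if_false]
    at h00 h01 h10 h11
  rw [← sub_eq_zero, ← map_one (TruncPoly.proj F (k + 1)), ← map_sub,
    TruncPoly.proj_eq_zero_iff] at h00 h11
  rw [TruncPoly.proj_eq_zero_iff] at h01 h10
  have hdet := det_altWord c b k
  rw [det_fin_two] at hdet
  obtain ⟨hA, -, -, -, hL⟩ := coeff_altWord c b k
  set A := altWord c b k 0 0
  set B := altWord c b k 0 1
  set C' := altWord c b k 1 0
  set D := altWord c b k 1 1
  have hdvd : (X : F[X]) ^ (2 * k + 2) ∣ A + D - 2 := by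
    have e : A + D - 2 = B * C' - (A - 1) * (D - 1) := by linear_combination hdet
    rw [e, show 2 * k + 2 = (k + 1) + (k + 1) by ring, pow_add]
    exact dvd_sub (mul_dvd_mul h01 h10) (mul_dvd_mul h00 h11)
  have h0 := X_pow_dvd_iff.1 hdvd (2 * k) (by omega)
  have h2 : (2 : F[X]).coeff (2 * k) = 0 := by
    rw [← C_ofNat, coeff_C, if_neg (by omega)]
  rw [coeff_sub, coeff_add, hA _ le_rfl (by omega), hL, h2, zero_add, sub_zero,
    Finset.prod_eq_zero_iff] at h0
  obtain ⟨i, -, hi⟩ := h0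
  exact mul_ne_zero (hc i) (hb i) hi

end TransvectionWords

section ParityMatrices

open Polynomial Matrix

variable {F : Type} [Field F] {k : ℕ}

/-- Determinant one matrices over `F[X] / (X ^ (k + 1))` whose diagonal entries are even and whose
off-diagonal entries are odd polynomials, and whose upper left constant coefficient is `1`. -/
def IsParityUnimodular (M : Matrix (Fin 2) (Fin 2) (TruncPoly F (k + 1))) : Prop :=
  M.det = 1 ∧ ∃ p q r s : F[X], p.coeff 0 = 1 ∧
    M = (!![expand F 2 p, X * expand F 2 q; X * expand F 2 r, expand F 2 s]).map
      (TruncPoly.proj F (k + 1))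

/-- The type of all parity unimodular matrices. -/
abbrev ParityMatrix (F : Type) [Field F] (k : ℕ) : Type :=
  {M : Matrix (Fin 2) (Fin 2) (TruncPoly F (k + 1)) // IsParityUnimodular M}

/-- The reduction of an upper transvection. -/
noncomputable abbrev upperT (F : Type) [Field F] (k : ℕ) (a : F) :
    Matrix (Fin 2) (Fin 2) (TruncPoly F (k + 1)) :=
  (upperX a).map (TruncPoly.proj F (k + 1))

/-- The reduction of a lower transvection. -/
noncomputable abbrev lowerT (F : Type) [Field F] (k : ℕ) (a : F) :
    Matrix (Fin 2) (Fin 2) (TruncPoly F (k + 1)) :=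
  (lowerX a).map (TruncPoly.proj F (k + 1))

theorem upperT_mul (a b : F) : upperT F k a * upperT F k b = upperT F k (a + b) := by
  rw [← Matrix.map_mul, upperX_mul]

theorem lowerT_mul (a b : F) : lowerT F k a * lowerT F k b = lowerT F k (a + b) := by
  rw [← Matrix.map_mul, lowerX_mul]

theorem upperT_zero : upperT F k 0 = 1 := by
  rw [upperT, upperX_zero, Matrix.map_one _ (map_zero _) (map_one _)]

theorem lowerT_zero : lowerT F k 0 = 1 := by
  rw [lowerT, lowerX_zero, Matrix.map_one _ (map_zero _) (map_one _)]

theorem det_map_proj (M : Matrix (Fin 2) (Fin 2) F[X]) :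
    (M.map (TruncPoly.proj F (k + 1))).det = TruncPoly.proj F (k + 1) M.det := by
  rw [RingHom.map_det]; rfl

theorem det_upperT (a : F) : (upperT F k a).det = 1 := by
  rw [det_map_proj, det_upperX, map_one]

theorem det_lowerT (a : F) : (lowerT F k a).det = 1 := by
  rw [det_map_proj, det_lowerX, map_one]

theorem isParityUnimodular_mul_upperT {M : Matrix (Fin 2) (Fin 2) (TruncPoly F (k + 1))}
    (hM : IsParityUnimodular M) (a : F) : IsParityUnimodular (M * upperT F k a) := by
  obtain ⟨hd, p, q, r, s, hp, rfl⟩ := hM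
  refine ⟨by rw [det_mul, hd, det_upperT, one_mul], p, C a * p + q, r, C a * X * r + s, hp, ?_⟩
  rw [← Matrix.map_mul]
  congr 1
  ext i j : 1
  fin_cases i <;> fin_cases j <;> simp [upperX, Matrix.mul_apply, Fin.sum_univ_two] <;> ring

theorem isParityUnimodular_mul_lowerT {M : Matrix (Fin 2) (Fin 2) (TruncPoly F (k + 1))}
    (hM : IsParityUnimodular M) (a : F) : IsParityUnimodular (M * lowerT F k a) := by
  obtain ⟨hd, p, q, r, s, hp, rfl⟩ := hM
  refine ⟨by rw [det_mul, hd, det_lowerT, one_mul], p + C a * X * q, q, r + C a * s, s,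
    by simpa using hp, ?_⟩
  rw [← Matrix.map_mul]
  congr 1
  ext i j : 1
  fin_cases i <;> fin_cases j <;> simp [lowerX, Matrix.mul_apply, Fin.sum_univ_two] <;> ring

theorem linCoeff_mul_upperT (hk : 1 ≤ k) {M : Matrix (Fin 2) (Fin 2) (TruncPoly F (k + 1))}
    (hM : IsParityUnimodular M) (a : F) :
    TruncPoly.linCoeff ((M * upperT F k a) 0 1) = TruncPoly.linCoeff (M 0 1) + a ∧
    (M * upperT F k a) 1 0 = M 1 0 := by
  obtain ⟨hd, p, q, r, s, hp, rfl⟩ := hM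
  constructor
  · rw [← Matrix.map_mul, Matrix.map_apply, Matrix.map_apply,
      TruncPoly.linCoeff_proj (by omega), TruncPoly.linCoeff_proj (by omega)]
    simp only [upperX, Matrix.mul_apply, Fin.sum_univ_two]
    have e : expand F 2 p * (C a * X) = C a * (expand F 2 p * X) := by ring
    simp [e, coeff_expand, hp, add_comm, coeff_mul_X]
  · rw [← Matrix.map_mul, Matrix.map_apply]
    simp [upperX, Matrix.mul_apply, Fin.sum_univ_two]

theorem linCoeff_mul_lowerT (hk : 1 ≤ k) {M : Matrix (Fin 2) (Fin 2) (TruncPoly F (k + 1))}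
    (hM : IsParityUnimodular M) (a : F) :
    TruncPoly.linCoeff ((M * lowerT F k a) 1 0) = TruncPoly.linCoeff (M 1 0) + a ∧
    (M * lowerT F k a) 0 1 = M 0 1 := by
  obtain ⟨hd, p, q, r, s, hp, rfl⟩ := hM
  have hs : s.coeff 0 = 1 := by
    rw [det_map_proj, ← map_one (TruncPoly.proj F (k + 1)),
      TruncPoly.proj_eq_proj_iff] at hd
    have := hd 0 (by omega)
    simpa [det_fin_two, mul_coeff_zero, coeff_expand, hp] using this
  constructor
  · rw [← Matrix.map_mul, Matrix.map_apply, Matrix.map_apply,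
      TruncPoly.linCoeff_proj (by omega), TruncPoly.linCoeff_proj (by omega)]
    simp only [lowerX, Matrix.mul_apply, Fin.sum_univ_two]
    have e : expand F 2 s * (C a * X) = C a * (expand F 2 s * X) := by ring
    simp [e, coeff_expand, hs, coeff_mul_X]
  · rw [← Matrix.map_mul, Matrix.map_apply]
    simp [lowerX, Matrix.mul_apply, Fin.sum_univ_two]

theorem exists_injective_parityMatrix (F : Type) [Field F] (k : ℕ) :
    ∃ φ : ParityMatrix F k →
      (Fin (k / 2) → F) × (Fin ((k + 1) / 2) → F) × (Fin ((k + 1) / 2) → F),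
      Function.Injective φ := by
  choose p q r s hp hM using fun M : ParityMatrix F k => M.2.2
  refine ⟨fun M => (fun i => (p M).coeff (i + 1), fun i => (q M).coeff i,
    fun i => (r M).coeff i), fun M N h => ?_⟩
  simp only [Prod.mk.injEq] at h
  obtain ⟨h1, h2, h3⟩ := h
  have hodd : ∀ f g : F[X], (∀ i : Fin ((k + 1) / 2), f.coeff i = g.coeff i) →
      TruncPoly.proj F (k + 1) (X * expand F 2 f) =
        TruncPoly.proj F (k + 1) (X * expand F 2 g) := by
    intro f g hfg
    rw [TruncPoly.proj_eq_proj_iff]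
    rintro (_ | j) hj
    · simp
    · rw [coeff_X_mul, coeff_X_mul, coeff_expand two_pos, coeff_expand two_pos]
      split_ifs with h
      · exact hfg ⟨j / 2, by omega⟩
      · rfl
  have e00 : M.1 0 0 = N.1 0 0 := by
    rw [hM M, hM N]
    change TruncPoly.proj F (k + 1) (expand F 2 (p M)) = TruncPoly.proj F (k + 1) (expand F 2 (p N))
    rw [TruncPoly.proj_eq_proj_iff]
    intro j hj
    rw [coeff_expand two_pos, coeff_expand two_pos]
    split_ifs with h
    · rcases Nat.eq_zero_or_pos (j / 2) with h0 | h0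
      · rw [h0, hp, hp]
      · have := congrFun h1 ⟨j / 2 - 1, by omega⟩
        simpa [Nat.sub_add_cancel h0] using this
    · rfl
  have e01 : M.1 0 1 = N.1 0 1 := by
    rw [hM M, hM N]; exact hodd _ _ (congrFun h2)
  have e10 : M.1 1 0 = N.1 1 0 := by
    rw [hM M, hM N]; exact hodd _ _ (congrFun h3)
  have hu : IsUnit (M.1 0 0) := by
    rw [hM M]
    exact TruncPoly.isUnit_proj (f := expand F 2 (p M)) (by simp [coeff_expand, hp])
  have e11 : M.1 1 1 = N.1 1 1 := by
    have d1 := M.2.1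
    have d2 := N.2.1
    rw [det_fin_two] at d1 d2
    rw [← e00, ← e01, ← e10] at d2
    exact hu.mul_left_cancel (by linear_combination d1 - d2)
  apply Subtype.ext
  ext i j : 1
  fin_cases i <;> fin_cases j <;> assumption

end ParityMatrices

/-- A bipartite graph with coloured vertices, in which every vertex has exactly one neighbour of
each colour. -/
structure LabelledBigraph (X Y F : Type) where
  Adj : X → Y → Prop
  colX : X → F
  colY : Y → F
  existsUnique_right : ∀ x b, ∃! y, Adj x y ∧ colY y = b
  existsUnique_left : ∀ y c, ∃! x, Adj x y ∧ colX x = c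

/-- There is no closed non-backtracking walk of length `2 k`. -/
def LabelledBigraph.NoClosedWalk {X Y F : Type} (G : LabelledBigraph X Y F) (k : ℕ) : Prop :=
  ∀ (x : ℕ → X) (y : ℕ → Y), (∀ i, x (i + k) = x i) → (∀ i, y (i + k) = y i) →
    (∀ i, G.Adj (x i) (y i)) → (∀ i, G.Adj (x (i + 1)) (y i)) →
    (∀ i, x i ≠ x (i + 1)) → (∀ i, y i ≠ y (i + 1)) → False

section TransvectionGraph

open Polynomial Matrix

variable {F : Type} [Field F] {k : ℕ}

/-- The entry above the diagonal, to first order. -/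
noncomputable abbrev upCol (M : ParityMatrix F k) : F := TruncPoly.linCoeff (M.1 0 1)

/-- The entry below the diagonal, to first order. -/
noncomputable abbrev lowCol (M : ParityMatrix F k) : F := TruncPoly.linCoeff (M.1 1 0)

theorem eq_mul_upperT_iff {M N : Matrix (Fin 2) (Fin 2) (TruncPoly F (k + 1))} {a : F} :
    M * upperT F k a = N ↔ M = N * upperT F k (-a) := by
  constructor
  · rintro rfl; rw [mul_assoc, upperT_mul, add_neg_cancel, upperT_zero, mul_one]
  · rintro rfl; rw [mul_assoc, upperT_mul, neg_add_cancel, upperT_zero, mul_one]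

theorem eq_mul_lowerT_iff {M N : Matrix (Fin 2) (Fin 2) (TruncPoly F (k + 1))} {a : F} :
    M * lowerT F k a = N ↔ M = N * lowerT F k (-a) := by
  constructor
  · rintro rfl; rw [mul_assoc, lowerT_mul, add_neg_cancel, lowerT_zero, mul_one]
  · rintro rfl; rw [mul_assoc, lowerT_mul, neg_add_cancel, lowerT_zero, mul_one]

/-- The incidence graph of cosets of upper and lower transvections; each coset is represented by
its normalised element. -/
noncomputable def transvectionGraph (F : Type) [Field F] (k : ℕ) (hk : 1 ≤ k) :
    LabelledBigraph {M : ParityMatrix F k // upCol M = 0} {M : ParityMatrix F k // lowCol M = 0}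
      F where
  Adj x y := x.1.1 * upperT F k (upCol y.1) = y.1.1 * lowerT F k (lowCol x.1)
  colX x := lowCol x.1
  colY y := upCol y.1
  existsUnique_right := by
    intro x b
    have h1 := isParityUnimodular_mul_upperT x.1.2 b
    have l1 := linCoeff_mul_upperT hk x.1.2 b
    have h2 := isParityUnimodular_mul_lowerT h1 (-lowCol x.1)
    have l2 := linCoeff_mul_lowerT hk h1 (-lowCol x.1)
    have hx : TruncPoly.linCoeff (x.1.1 0 1) = 0 := x.2
    have eup : TruncPoly.linCoeff
        ((x.1.1 * upperT F k b * lowerT F k (-lowCol x.1)) 0 1) = b := by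
      rw [l2.2, l1.1, hx, zero_add]
    have elow : TruncPoly.linCoeff
        ((x.1.1 * upperT F k b * lowerT F k (-lowCol x.1)) 1 0) = 0 := by
      rw [l2.1, l1.2, add_neg_cancel]
    refine ⟨⟨⟨_, h2⟩, elow⟩, ⟨?_, eup⟩, ?_⟩
    · change x.1.1 * upperT F k (TruncPoly.linCoeff
        ((x.1.1 * upperT F k b * lowerT F k (-lowCol x.1)) 0 1)) =
        x.1.1 * upperT F k b * lowerT F k (-lowCol x.1) * lowerT F k (lowCol x.1)
      rw [eup, mul_assoc _ (lowerT F k _), lowerT_mul, neg_add_cancel, lowerT_zero, mul_one]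
    · rintro y ⟨hy, rfl⟩
      apply Subtype.ext
      apply Subtype.ext
      exact eq_mul_lowerT_iff.1 hy.symm
  existsUnique_left := by
    intro y c
    have h1 := isParityUnimodular_mul_lowerT y.1.2 c
    have l1 := linCoeff_mul_lowerT hk y.1.2 c
    have h2 := isParityUnimodular_mul_upperT h1 (-upCol y.1)
    have l2 := linCoeff_mul_upperT hk h1 (-upCol y.1)
    have hy : TruncPoly.linCoeff (y.1.1 1 0) = 0 := y.2
    have elow : TruncPoly.linCoeff
        ((y.1.1 * lowerT F k c * upperT F k (-upCol y.1)) 1 0) = c := by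
      rw [l2.2, l1.1, hy, zero_add]
    have eup : TruncPoly.linCoeff
        ((y.1.1 * lowerT F k c * upperT F k (-upCol y.1)) 0 1) = 0 := by
      rw [l2.1, l1.2, add_neg_cancel]
    refine ⟨⟨⟨_, h2⟩, eup⟩, ⟨?_, elow⟩, ?_⟩
    · change y.1.1 * lowerT F k c * upperT F k (-upCol y.1) * upperT F k (upCol y.1) =
        y.1.1 * lowerT F k (TruncPoly.linCoeff
        ((y.1.1 * lowerT F k c * upperT F k (-upCol y.1)) 1 0))
      rw [elow, mul_assoc _ (upperT F k _), upperT_mul, neg_add_cancel, upperT_zero, mul_one]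
    · rintro x ⟨hx, rfl⟩
      apply Subtype.ext
      apply Subtype.ext
      exact eq_mul_upperT_iff.1 hx

theorem transvectionGraph_noClosedWalk (hk : 1 ≤ k) :
    (transvectionGraph F k hk).NoClosedWalk k := by
  intro x y hx hy h1 h2 hx' hy'
  set G := transvectionGraph F k hk
  set b : ℕ → F := fun i => G.colY (y i) with hb
  set c : ℕ → F := fun i => G.colX (x i) with hc
  have h1' : ∀ i, (x i).1.1 * upperT F k (b i) = (y i).1.1 * lowerT F k (c i) := h1
  have h2' : ∀ i, (x (i + 1)).1.1 * upperT F k (b i) = (y i).1.1 * lowerT F k (c (i + 1)) := h2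
  have hbne : ∀ i, b (i + 1) - b i ≠ 0 := fun i h =>
    hy' i ((G.existsUnique_right (x (i + 1)) (b i)).unique ⟨h2 i, rfl⟩
      ⟨h1 (i + 1), sub_eq_zero.1 h⟩)
  have hcne : ∀ i, c (i + 1) - c i ≠ 0 := fun i h =>
    hx' i ((G.existsUnique_left (y i) (c i)).unique ⟨h1 i, rfl⟩ ⟨h2 i, sub_eq_zero.1 h⟩)
  have step : ∀ n, (x n).1.1 * upperT F k (b n) = (x 0).1.1 * upperT F k (b 0) *
      (altWord (fun i => c (i + 1) - c i) (fun i => b (i + 1) - b i) n).map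
        (TruncPoly.proj F (k + 1)) := by
    intro n
    induction n with
    | zero => simp [altWord, Matrix.map_one]
    | succ n ih =>
      rw [altWord, Matrix.map_mul, ← mul_assoc, ← ih, Matrix.map_mul, h1' n, ← mul_assoc,
        mul_assoc (y n).1.1, lowerT_mul, add_sub_cancel, ← h2', mul_assoc, upperT_mul,
        add_sub_cancel]
  have hk' := step k
  have e1 : x k = x 0 := by simpa using hx 0
  have e2 : b k = b 0 := by
    have : y k = y 0 := by simpa using hy 0
    simp [hb, this]
  rw [e1, e2] at hk'
  have hdet : ((x 0).1.1 * upperT F k (b 0)).det = 1 := by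
    rw [det_mul, (x 0).1.2.1, det_upperT, one_mul]
  have hu : IsUnit ((x 0).1.1 * upperT F k (b 0)) := by
    rw [Matrix.isUnit_iff_isUnit_det, hdet]; exact isUnit_one
  exact altWord_not_congr_one _ _ hcne hbne hk (hu.mul_left_cancel (by rw [← hk', mul_one]))

theorem finite_parityMatrix [Finite F] : Finite (ParityMatrix F k) :=
  let ⟨_, h⟩ := exists_injective_parityMatrix F k
  Finite.of_injective _ h

theorem card_parityMatrix_le [Finite F] :
    Nat.card (ParityMatrix F k) ≤ Nat.card F ^ (k / 2 + 2 * ((k + 1) / 2)) := by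
  obtain ⟨φ, h⟩ := exists_injective_parityMatrix F k
  refine (Nat.card_le_card_of_injective φ h).trans (le_of_eq ?_)
  simp only [Nat.card_prod, Nat.card_fun, Nat.card_eq_fintype_card, Fintype.card_fin]
  ring

theorem card_upCol_eq_zero_mul_le [Finite F] (hk : 1 ≤ k) :
    Nat.card {M : ParityMatrix F k // upCol M = 0} * Nat.card F ≤
      Nat.card F ^ (k / 2 + 2 * ((k + 1) / 2)) := by
  have := finite_parityMatrix (F := F) (k := k)
  rw [← Nat.card_prod]
  refine (Nat.card_le_card_of_injective
    (fun z : {M : ParityMatrix F k // upCol M = 0} × F =>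
      (⟨_, isParityUnimodular_mul_upperT z.1.1.2 z.2⟩ : ParityMatrix F k)) ?_).trans
    card_parityMatrix_le
  rintro ⟨M, a⟩ ⟨N, b⟩ h
  have h : M.1.1 * upperT F k a = N.1.1 * upperT F k b := congrArg Subtype.val h
  have ha := (linCoeff_mul_upperT hk M.1.2 a).1
  have hb := (linCoeff_mul_upperT hk N.1.2 b).1
  have hM0 : TruncPoly.linCoeff (M.1.1 0 1) = 0 := M.2
  have hN0 : TruncPoly.linCoeff (N.1.1 0 1) = 0 := N.2
  rw [hM0, zero_add] at ha
  rw [hN0, zero_add, ← h, ha] at hb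
  subst hb
  rw [eq_mul_upperT_iff, mul_assoc, upperT_mul, add_neg_cancel, upperT_zero, mul_one] at h
  simp only [Prod.mk.injEq, and_true]
  exact Subtype.ext (Subtype.ext h)

theorem card_lowCol_eq_zero_mul_le [Finite F] (hk : 1 ≤ k) :
    Nat.card {M : ParityMatrix F k // lowCol M = 0} * Nat.card F ≤
      Nat.card F ^ (k / 2 + 2 * ((k + 1) / 2)) := by
  have := finite_parityMatrix (F := F) (k := k)
  rw [← Nat.card_prod]
  refine (Nat.card_le_card_of_injective
    (fun z : {M : ParityMatrix F k // lowCol M = 0} × F =>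
      (⟨_, isParityUnimodular_mul_lowerT z.1.1.2 z.2⟩ : ParityMatrix F k)) ?_).trans
    card_parityMatrix_le
  rintro ⟨M, a⟩ ⟨N, b⟩ h
  have h : M.1.1 * lowerT F k a = N.1.1 * lowerT F k b := congrArg Subtype.val h
  have ha := (linCoeff_mul_lowerT hk M.1.2 a).1
  have hb := (linCoeff_mul_lowerT hk N.1.2 b).1
  have hM0 : TruncPoly.linCoeff (M.1.1 1 0) = 0 := M.2
  have hN0 : TruncPoly.linCoeff (N.1.1 1 0) = 0 := N.2
  rw [hM0, zero_add] at ha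
  rw [hN0, zero_add, ← h, ha] at hb
  subst hb
  rw [eq_mul_lowerT_iff, mul_assoc, lowerT_mul, add_neg_cancel, lowerT_zero, mul_one] at h
  simp only [Prod.mk.injEq, and_true]
  exact Subtype.ext (Subtype.ext h)

theorem nonempty_upCol_eq_zero (hk : 1 ≤ k) : Nonempty {M : ParityMatrix F k // upCol M = 0} := by
  have h1 : IsParityUnimodular (1 : Matrix (Fin 2) (Fin 2) (TruncPoly F (k + 1))) := by
    refine ⟨det_one, 1, 0, 0, 1, by simp, ?_⟩
    ext i j : 1
    fin_cases i <;> fin_cases j <;> simp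
  refine ⟨⟨⟨1, h1⟩, ?_⟩⟩
  have := TruncPoly.linCoeff_proj (F := F) (h := k + 1) (by omega) 0
  rwa [map_zero, coeff_zero] at this

end TransvectionGraph

/-- There is a closed non-backtracking walk of length `ℓ`. -/
def HasNbWalk {V : Type*} (G : SimpleGraph V) (ℓ : ℕ) : Prop :=
  ∃ c : ℕ → V, (∀ i, c (i + ℓ) = c i) ∧ (∀ i, G.Adj (c i) (c (i + 1))) ∧ ∀ i, c i ≠ c (i + 2)

theorem HasNbWalk.map {V W : Type*} {G : SimpleGraph V} {H : SimpleGraph W} {ℓ : ℕ} (f : V → W)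
    (hf : Function.Injective f) (hGH : ∀ u v, G.Adj u v → H.Adj (f u) (f v))
    (h : HasNbWalk G ℓ) : HasNbWalk H ℓ := by
  obtain ⟨c, h1, h2, h3⟩ := h
  exact ⟨fun i => f (c i), fun i => by simp only [h1], fun i => hGH _ _ (h2 i),
    fun i h => h3 i (hf h)⟩

/-- A graph with a regular orientation, which becomes acyclic once the out-edges of a small set of
vertices are removed, and without closed non-backtracking walks of length `ℓ`. -/
structure LayeredGraph (V : Type) [Fintype V] (d ℓ L : ℕ) where
  graph : SimpleGraph V
  nbr : V → Fin d → V
  cut : Finset V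
  rank : V → ℕ
  adj_nbr : ∀ v a, graph.Adj v (nbr v a)
  nbr_injective : ∀ v, Function.Injective (nbr v)
  card_nbr_eq : ∀ w, Nat.card {z : V × Fin d // nbr z.1 z.2 = w} = d
  rank_nbr : ∀ v a, v ∉ cut → rank (nbr v a) = rank v + 1
  card_cut : L * cut.card ≤ Fintype.card V
  not_hasNbWalk : ¬ HasNbWalk graph ℓ

namespace LabelledBigraph

variable {X Y F : Type} (G : LabelledBigraph X Y F)

/-- The underlying simple graph on the disjoint union of both sides. -/
def toSimpleGraph : SimpleGraph (X ⊕ Y) where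
  Adj u v := match u, v with
    | .inl x, .inr y => G.Adj x y
    | .inr y, .inl x => G.Adj x y
    | _, _ => False
  symm := ⟨by rintro (x | y) (x' | y') h <;> exact h⟩
  loopless := ⟨by rintro (x | y) h <;> exact h⟩

/-- The colour of a vertex on either side. -/
def col : X ⊕ Y → F := Sum.elim G.colX G.colY

/-- The side of a vertex. -/
def side (w : X ⊕ Y) : ZMod 2 := Sum.elim (fun _ => 0) (fun _ => 1) w

theorem existsUnique_adj (w : X ⊕ Y) (b : F) :
    ∃! v, G.toSimpleGraph.Adj w v ∧ G.col v = b := by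
  rcases w with x | y
  · obtain ⟨y, hy, hy'⟩ := G.existsUnique_right x b
    refine ⟨.inr y, hy, ?_⟩
    rintro (x' | y') ⟨h1, h2⟩
    · exact h1.elim
    · rw [hy' y' ⟨h1, h2⟩]
  · obtain ⟨x, hx, hx'⟩ := G.existsUnique_left y b
    refine ⟨.inl x, hx, ?_⟩
    rintro (x' | y') ⟨h1, h2⟩
    · rw [hx' x' ⟨h1, h2⟩]
    · exact h1.elim

theorem side_of_adj {u v : X ⊕ Y} (h : G.toSimpleGraph.Adj u v) : side v = side u + 1 := by
  rcases u with x | y <;> rcases v with x' | y'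
  · exact h.elim
  · simp [side]
  · simp only [side, Sum.elim_inl, Sum.elim_inr]; decide
  · exact h.elim

theorem not_hasNbWalk {k : ℕ} (hG : G.NoClosedWalk k) : ¬ HasNbWalk G.toSimpleGraph (2 * k) := by
  have key : ∀ c : ℕ → X ⊕ Y, (∀ i, c (i + 2 * k) = c i) →
      (∀ i, G.toSimpleGraph.Adj (c i) (c (i + 1))) → (∀ i, c i ≠ c (i + 2)) →
      side (c 0) = 0 → False := by
    intro c h1 h2 h3 h0
    have hs : ∀ i, side (c (2 * i)) = 0 := by
      intro i
      induction i with
      | zero => exact h0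
      | succ i ih =>
        rw [show 2 * (i + 1) = 2 * i + 1 + 1 by ring, G.side_of_adj (h2 _), G.side_of_adj (h2 _),
          ih]
        decide
    have hx : ∀ i, ∃ x, c (2 * i) = .inl x := by
      intro i
      rcases h : c (2 * i) with x | y
      · exact ⟨x, rfl⟩
      · have := hs i
        rw [h] at this
        simp [side] at this
    choose x hx using hx
    have hy : ∀ i, ∃ y, c (2 * i + 1) = .inr y := by
      intro i
      have := h2 (2 * i)
      rcases h : c (2 * i + 1) with x | y
      · rw [h, hx] at this
        exact this.elim
      · exact ⟨y, rfl⟩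
    choose y hy using hy
    refine hG x y (fun i => ?_) (fun i => ?_) (fun i => ?_) (fun i => ?_) (fun i => ?_)
      (fun i => ?_)
    · apply Sum.inl_injective (β := Y)
      rw [← hx, ← hx, mul_add, h1]
    · apply Sum.inr_injective (α := X)
      rw [← hy, ← hy, mul_add, add_right_comm, h1]
    · have := h2 (2 * i)
      rwa [hx, hy] at this
    · have := h2 (2 * i + 1)
      rwa [hy, show 2 * i + 1 + 1 = 2 * (i + 1) by ring, hx] at this
    · intro h
      apply h3 (2 * i)
      rw [hx, show 2 * i + 2 = 2 * (i + 1) by ring, hx, h]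
    · intro h
      apply h3 (2 * i + 1)
      rw [hy, show 2 * i + 1 + 2 = 2 * (i + 1) + 1 by ring, hy, h]
  rintro ⟨c, h1, h2, h3⟩
  rcases h : c 0 with x | y
  · exact key c h1 h2 h3 (by rw [h]; rfl)
  · refine key (fun i => c (i + 1)) (fun i => ?_) (fun i => h2 _) (fun i => ?_) ?_
    · simp only [add_right_comm, h1]
    · exact h3 (i + 1)
    · rw [G.side_of_adj (h2 0), h]
      simp only [side, Sum.elim_inr]
      decide

section Layers

variable {L d : ℕ} (ι : ZMod (2 * L) × Fin d → F)

/-- Vertices whose colour is one of the colours reserved for some layer of the right side. -/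
abbrev LayerVertex : Type :=
  {v : (X ⊕ Y) × (ZMod (2 * L) × Fin d) //
    G.col v.1 = ι v.2 ∧ side v.1 = ZMod.castHom (dvd_mul_right 2 L) (ZMod 2) v.2.1}

variable {ι}

theorem LayerVertex.ext (hι : Function.Injective ι) {u v : G.LayerVertex ι}
    (h : u.1.1 = v.1.1) : u = v := by
  apply Subtype.ext
  apply Prod.ext h
  apply hι
  rw [← u.2.1, ← v.2.1, h]

theorem exists_next (v : G.LayerVertex ι) (a : Fin d) : ∃ w : G.LayerVertex ι,
    G.toSimpleGraph.Adj v.1.1 w.1.1 ∧ w.1.2 = (v.1.2.1 + 1, a) := by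
  obtain ⟨w, hw, -⟩ := G.existsUnique_adj v.1.1 (ι (v.1.2.1 + 1, a))
  refine ⟨⟨(w, (v.1.2.1 + 1, a)), hw.2, ?_⟩, hw.1, rfl⟩
  rw [G.side_of_adj hw.1, v.2.2, map_add, map_one]

theorem exists_prev (w : G.LayerVertex ι) (b : Fin d) : ∃ v : G.LayerVertex ι,
    G.toSimpleGraph.Adj v.1.1 w.1.1 ∧ v.1.2 = (w.1.2.1 - 1, b) := by
  obtain ⟨v, hv, -⟩ := G.existsUnique_adj w.1.1 (ι (w.1.2.1 - 1, b))
  refine ⟨⟨(v, (w.1.2.1 - 1, b)), hv.2, ?_⟩, hv.1.symm, rfl⟩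
  rw [G.side_of_adj hv.1, w.2.2, map_sub, map_one, sub_eq_add_neg]
  rfl

/-- The layered graph on the reserved vertices. -/
noncomputable def layeredGraph [Fintype (G.LayerVertex ι)] {k : ℕ} (hL : 1 ≤ L)
    (hι : Function.Injective ι) (hG : G.NoClosedWalk k) :
    LayeredGraph (G.LayerVertex ι) d (2 * k) L := by
  classical
  have : NeZero (2 * L) := ⟨by omega⟩
  have : Fact (1 < 2 * L) := ⟨by omega⟩
  choose nx hnx hnx' using G.exists_next (ι := ι)
  choose pr hpr hpr' using G.exists_prev (ι := ι)
  have uniq : ∀ u v w : G.LayerVertex ι, G.toSimpleGraph.Adj u.1.1 v.1.1 →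
      G.toSimpleGraph.Adj u.1.1 w.1.1 → v.1.2 = w.1.2 → v = w := by
    intro u v w h1 h2 h
    refine LayerVertex.ext G hι ((G.existsUnique_adj u.1.1 (ι v.1.2)).unique ⟨h1, v.2.1⟩
      ⟨h2, ?_⟩)
    rw [w.2.1, h]
  have hpn : ∀ v a, pr (nx v a) v.1.2.2 = v := by
    intro v a
    refine uniq (nx v a) _ _ (hpr _ _).symm (hnx _ _).symm ?_
    rw [hpr', hnx', add_sub_cancel_right]
  have hnp : ∀ w b, nx (pr w b) w.1.2.2 = w := by
    intro w b
    refine uniq (pr w b) _ _ (hnx _ _) (hpr _ _) ?_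
    rw [hnx', hpr', sub_add_cancel]
  let e : G.LayerVertex ι × Fin d ≃ G.LayerVertex ι × Fin d :=
    { toFun := fun z => (nx z.1 z.2, z.1.1.2.2)
      invFun := fun z => (pr z.1 z.2, z.1.1.2.2)
      left_inv := by
        rintro ⟨v, a⟩
        simp only [hpn, hnx']
      right_inv := by
        rintro ⟨w, b⟩
        simp only [hnp, hpr'] }
  have hdiv : ∀ t : ZMod (2 * L), d * Fintype.card {v : G.LayerVertex ι // v.1.2.1 = t} =
      d * Fintype.card {v : G.LayerVertex ι // v.1.2.1 = t + 1} := by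
    intro t
    have E : ∀ t : ZMod (2 * L), Fintype.card {z : G.LayerVertex ι × Fin d // z.1.1.2.1 = t} =
        d * Fintype.card {v : G.LayerVertex ι // v.1.2.1 = t} := by
      intro t
      refine (Fintype.card_congr (β := {v : G.LayerVertex ι // v.1.2.1 = t} × Fin d)
        { toFun := fun z => (⟨z.1.1, z.2⟩, z.1.2)
          invFun := fun z => ⟨(z.1.1, z.2), z.1.2⟩
          left_inv := fun _ => rfl
          right_inv := fun _ => rfl }).trans ?_
      rw [Fintype.card_prod, Fintype.card_fin, mul_comm]
    rw [← E, ← E]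
    refine Fintype.card_congr (e.subtypeEquiv ?_)
    rintro ⟨v, a⟩
    simp only [e, Equiv.coe_fn_mk, hnx', add_left_inj]
  refine
    { graph := G.toSimpleGraph.comap fun v => v.1.1
      nbr := nx
      cut := Finset.univ.filter fun v => v.1.2.1 = -1
      rank := fun v => v.1.2.1.val
      adj_nbr := hnx
      nbr_injective := ?_
      card_nbr_eq := ?_
      rank_nbr := ?_
      card_cut := ?_
      not_hasNbWalk := ?_ }
  · intro v a b h
    have := hnx' v a
    rw [h, hnx'] at this
    exact (Prod.ext_iff.1 this).2.symm
  · intro w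
    refine (Nat.card_congr (e.subtypeEquiv (q := fun z => z.1 = w) fun z => Iff.rfl)).trans ?_
    rw [Nat.card_congr (β := Fin d)
        { toFun := fun z => z.1.2
          invFun := fun b => ⟨(w, b), rfl⟩
          left_inv := by rintro ⟨⟨v, b⟩, rfl⟩; rfl
          right_inv := fun _ => rfl }, Nat.card_eq_fintype_card, Fintype.card_fin]
  · intro v a hv
    simp only [Finset.mem_filter, Finset.mem_univ, true_and] at hv
    rw [hnx']
    have h1 : v.1.2.1.val + 1 < 2 * L := by
      by_contra h
      have h2 := ZMod.val_lt v.1.2.1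
      apply hv
      have h3 : v.1.2.1.val + 1 = 2 * L := by omega
      have h4 : ((v.1.2.1.val + 1 : ℕ) : ZMod (2 * L)) = 0 := by rw [h3]; exact ZMod.natCast_self _
      rw [Nat.cast_add, ZMod.natCast_val, ZMod.cast_id, Nat.cast_one] at h4
      exact eq_neg_of_add_eq_zero_left h4
    rw [ZMod.val_add_of_lt] <;> rw [ZMod.val_one]
    exact h1
  · rcases Nat.eq_zero_or_pos d with hd | hd
    · have : IsEmpty (G.LayerVertex ι) := ⟨fun v => by
        have := v.1.2.2.2
        omega⟩
      simp
    have hall : ∀ t : ZMod (2 * L), Fintype.card {v : G.LayerVertex ι // v.1.2.1 = t} =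
        Fintype.card {v : G.LayerVertex ι // v.1.2.1 = -1} := by
      have hn : ∀ n : ℕ, Fintype.card {v : G.LayerVertex ι // v.1.2.1 = (-1 + n)} =
          Fintype.card {v : G.LayerVertex ι // v.1.2.1 = -1} := by
        intro n
        induction n with
        | zero => simp
        | succ n ih =>
          rw [← ih, Nat.cast_succ, ← add_assoc]
          exact (Nat.eq_of_mul_eq_mul_left hd (hdiv _)).symm
      intro t
      have := hn (t + 1).val
      rwa [ZMod.natCast_val, ZMod.cast_id, neg_add_cancel_comm_assoc] at this
    have hcard : Fintype.card (G.LayerVertex ι) =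
        ∑ t : ZMod (2 * L), Fintype.card {v : G.LayerVertex ι // v.1.2.1 = t} := by
      rw [← Fintype.card_sigma]
      exact Fintype.card_congr (Equiv.sigmaFiberEquiv fun v : G.LayerVertex ι => v.1.2.1).symm
    rw [hcard, Finset.sum_congr rfl fun t _ => hall t, Finset.sum_const, smul_eq_mul,
      Finset.card_univ, ZMod.card, Fintype.card_subtype]
    exact Nat.mul_le_mul_right _ (by omega)
  · exact fun h => G.not_hasNbWalk hG (h.map _ (fun u v h => LayerVertex.ext G hι h)
      fun _ _ h => h)

end Layers

end LabelledBigraph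

/-- Disjoint copies of a layered graph. -/
def LayeredGraph.copies {V : Type} [Fintype V] {d ℓ L : ℕ} (G : LayeredGraph V d ℓ L) (c : ℕ) :
    LayeredGraph (Fin c × V) d ℓ L where
  graph :=
    { Adj := fun u v => u.1 = v.1 ∧ G.graph.Adj u.2 v.2
      symm := ⟨fun _ _ h => ⟨h.1.symm, h.2.symm⟩⟩
      loopless := ⟨fun _ h => h.2.ne rfl⟩ }
  nbr v a := (v.1, G.nbr v.2 a)
  cut := Finset.univ ×ˢ G.cut
  rank v := G.rank v.2
  adj_nbr v a := ⟨rfl, G.adj_nbr v.2 a⟩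
  nbr_injective v a b h := G.nbr_injective v.2 (Prod.ext_iff.1 h).2
  card_nbr_eq w := by
    refine (Nat.card_congr (β := {z : V × Fin d // G.nbr z.1 z.2 = w.2})
      { toFun := fun z => ⟨(z.1.1.2, z.1.2), (Prod.ext_iff.1 z.2).2⟩
        invFun := fun z => ⟨((w.1, z.1.1), z.1.2), Prod.ext rfl z.2⟩
        left_inv := by
          rintro ⟨⟨⟨i, v⟩, a⟩, rfl⟩
          rfl
        right_inv := fun _ => rfl }).trans (G.card_nbr_eq w.2)
  rank_nbr v a hv := G.rank_nbr v.2 a fun h => hv (by simpa using h)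
  card_cut := by
    rw [Finset.card_product, Fintype.card_prod, Finset.card_univ, mul_left_comm]
    exact Nat.mul_le_mul_left _ G.card_cut
  not_hasNbWalk := by
    rintro ⟨w, h1, h2, h3⟩
    have h0 : ∀ i, (w i).1 = (w 0).1 := by
      intro i
      induction i with
      | zero => rfl
      | succ i ih => rw [← (h2 i).1, ih]
    refine G.not_hasNbWalk ⟨fun i => (w i).2, fun i => by simp only [h1], fun i => (h2 i).2,
      fun i h => h3 i (Prod.ext ?_ h)⟩
    rw [h0, h0 (i + 2)]

theorem exists_layeredGraph {k p L d : ℕ} (hk : 1 ≤ k) (hp : p.Prime) (hL : 1 ≤ L) (hd : 1 ≤ d)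
    (h : 2 * L * d ≤ p) : ∃ (V : Type) (_ : Fintype V) (_ : LayeredGraph V d (2 * k) L),
      0 < Fintype.card V ∧ Fintype.card V * p ≤ 2 * p ^ (k / 2 + 2 * ((k + 1) / 2)) := by
  classical
  have := Fact.mk hp
  have : NeZero (2 * L) := ⟨by omega⟩
  obtain ⟨ι⟩ : Nonempty (ZMod (2 * L) × Fin d ↪ ZMod p) := by
    apply Function.Embedding.nonempty_of_card_le
    rwa [Fintype.card_prod, ZMod.card, ZMod.card, Fintype.card_fin]
  have := finite_parityMatrix (F := ZMod p) (k := k)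
  let G := transvectionGraph (ZMod p) k hk
  have hfin : Finite (G.LayerVertex ι) := Subtype.finite
  refine ⟨G.LayerVertex ι, Fintype.ofFinite _, ?_⟩
  let _ := Fintype.ofFinite (G.LayerVertex ι)
  refine ⟨G.layeredGraph hL ι.injective (transvectionGraph_noClosedWalk hk), ?_, ?_⟩
  · obtain ⟨x⟩ := nonempty_upCol_eq_zero (F := ZMod p) hk
    obtain ⟨y, hy, -⟩ := G.existsUnique_right x 0
    obtain ⟨x', hx', -⟩ := G.existsUnique_left y (ι (0, ⟨0, hd⟩))
    refine Fintype.card_pos_iff.2 ⟨⟨(Sum.inl x', (0, ⟨0, hd⟩)), hx'.2, ?_⟩⟩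
    rw [map_zero]
    rfl
  · have hX := card_upCol_eq_zero_mul_le (F := ZMod p) hk
    have hY := card_lowCol_eq_zero_mul_le (F := ZMod p) hk
    rw [Nat.card_zmod] at hX hY
    have hle := Nat.card_le_card_of_injective (fun v : G.LayerVertex ι => v.1.1)
      fun u v h => LabelledBigraph.LayerVertex.ext G ι.injective h
    rw [Nat.card_sum, Nat.card_eq_fintype_card] at hle
    calc _ ≤ _ := Nat.mul_le_mul_right p hle
      _ ≤ _ := by rw [add_mul, two_mul]; exact add_le_add hX hY

/-- A partial injection along the arcs `v → nbr v a`, undefined at exactly `r` vertices, among which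
all vertices of `Z`. -/
structure IsLinking {V : Type} {d : ℕ} (nbr : V → Fin d → V) (Z : Finset V) (r : ℕ)
    (f : V → Option V) : Prop where
  injective : ∀ u v w, f u = some w → f v = some w → u = v
  exists_nbr : ∀ v w, f v = some w → ∃ a, nbr v a = w
  eq_none : ∀ v ∈ Z, f v = none
  card_none : Nat.card {v // f v = none} = r

section Linking

open Finset

variable {V : Type} [Fintype V] [DecidableEq V] {d D : ℕ} (nbr : V → Fin d → V)

/-- The in-degree of `y` when every vertex `x` selects the arcs `φ (x, i)`. -/
def selDegree (φ : V × Fin D → Fin d) (y : V) : ℕ := #{z : V × Fin D | nbr z.1 (φ z) = y}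

variable {nbr}

theorem sum_exp_selDegree_le (hd : 0 < d)
    (hin : ∀ w, Nat.card {z : V × Fin d // nbr z.1 z.2 = w} = d) (y : V) {t : ℝ} :
    ∑ φ : V × Fin D → Fin d, Real.exp (t * selDegree nbr φ y) ≤
      (d : ℝ) ^ (Fintype.card V * D) * Real.exp (D * (Real.exp t - 1)) := by
  have h1 : ∀ φ : V × Fin D → Fin d, Real.exp (t * selDegree nbr φ y) =
      ∏ z, if nbr z.1 (φ z) = y then Real.exp t else 1 := by
    intro φ
    rw [prod_ite, prod_const, prod_const_one, mul_one, selDegree, ← Real.exp_nat_mul, mul_comm]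
  have hd' : (0 : ℝ) < d := by exact_mod_cast hd
  have h2 : ∀ z : V × Fin D, (∑ a : Fin d, if nbr z.1 a = y then Real.exp t else 1) ≤
      d * Real.exp ((Real.exp t - 1) * (#{a | nbr z.1 a = y} / d)) := by
    intro z
    have : (∑ a : Fin d, if nbr z.1 a = y then Real.exp t else 1) =
        d * ((Real.exp t - 1) * (#{a | nbr z.1 a = y} / d) + 1) := by
      have : ∀ a : Fin d, (if nbr z.1 a = y then Real.exp t else 1) =
          (if nbr z.1 a = y then Real.exp t - 1 else 0) + 1 := by
        intro a; split_ifs <;> ring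
      rw [sum_congr rfl fun a _ => this a, sum_add_distrib, ← sum_filter, sum_const, sum_const,
        card_univ, Fintype.card_fin, nsmul_eq_mul, nsmul_eq_mul]
      field_simp
    rw [this]
    exact mul_le_mul_of_nonneg_left (Real.add_one_le_exp _) hd'.le
  have h3 : ∑ x, #{a | nbr x a = y} = d := by
    refine Eq.trans ?_ (hin y)
    rw [Nat.card_eq_fintype_card, Fintype.card_subtype, card_filter,
      ← univ_product_univ, sum_product]
    exact sum_congr rfl fun x _ => card_filter _ _
  calc _ = ∏ z : V × Fin D, ∑ a : Fin d, (if nbr z.1 a = y then Real.exp t else 1) := by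
        rw [prod_univ_sum, Fintype.piFinset_univ]
        exact sum_congr rfl fun φ _ => h1 φ
    _ ≤ ∏ z : V × Fin D, (d * Real.exp ((Real.exp t - 1) * (#{a | nbr z.1 a = y} / d))) :=
        prod_le_prod (fun z _ => sum_nonneg fun a _ => by positivity) fun z _ => h2 z
    _ = _ := by
        rw [prod_mul_distrib, prod_const, card_univ, Fintype.card_prod, Fintype.card_fin,
          ← Real.exp_sum, ← mul_sum, ← univ_product_univ, sum_product]
        simp only [sum_const, card_univ, Fintype.card_fin, nsmul_eq_mul]
        rw [← mul_sum, ← sum_div, ← Nat.cast_sum, h3, div_self hd'.ne']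
        ring_nf

theorem sum_excess_le {s : ℕ} (hs : 1 ≤ s) (hd : 0 < d)
    (hin : ∀ w, Nat.card {z : V × Fin d // nbr z.1 z.2 = w} = d) (y : V) :
    ∑ φ : V × Fin (s ^ 2) → Fin d, (selDegree nbr φ y - s ^ 2) ≤
      3 * s * d ^ (Fintype.card V * s ^ 2) := by
  have hs0 : (1 : ℝ) ≤ s := by exact_mod_cast hs
  have hs1 : (0 : ℝ) < s := by linarith
  have h1 : ∀ φ : V × Fin (s ^ 2) → Fin d, ((selDegree nbr φ y - s ^ 2 : ℕ) : ℝ) ≤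
      s * Real.exp (-s) * Real.exp ((s : ℝ)⁻¹ * selDegree nbr φ y) := by
    intro φ
    rw [mul_assoc, ← Real.exp_add]
    rcases le_total (selDegree nbr φ y) (s ^ 2) with h | h
    · rw [Nat.sub_eq_zero_of_le h, Nat.cast_zero]
      positivity
    · rw [Nat.cast_sub h]
      have := Real.add_one_le_exp (-(s : ℝ) + (s : ℝ)⁻¹ * selDegree nbr φ y)
      have h2 := mul_le_mul_of_nonneg_left this hs1.le
      have h3 : (s : ℝ) * (-(s : ℝ) + (s : ℝ)⁻¹ * selDegree nbr φ y + 1) =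
        selDegree nbr φ y - s ^ 2 + s := by field_simp; ring
      push_cast
      linarith
  have h4 : ((∑ φ : V × Fin (s ^ 2) → Fin d, (selDegree nbr φ y - s ^ 2) : ℕ) : ℝ) ≤
      3 * s * d ^ (Fintype.card V * s ^ 2) := by
    rw [Nat.cast_sum]
    calc _ ≤ _ := sum_le_sum fun φ _ => h1 φ
      _ ≤ s * Real.exp (-s) * ((d : ℝ) ^ (Fintype.card V * s ^ 2) *
          Real.exp ((s ^ 2 : ℕ) * (Real.exp (s : ℝ)⁻¹ - 1))) := by
        rw [← mul_sum]
        exact mul_le_mul_of_nonneg_left (sum_exp_selDegree_le hd hin y) (by positivity)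
      _ = s * d ^ (Fintype.card V * s ^ 2) *
          Real.exp (-s + (s ^ 2 : ℕ) * (Real.exp (s : ℝ)⁻¹ - 1)) := by
        rw [Real.exp_add]; ring
      _ ≤ s * d ^ (Fintype.card V * s ^ 2) * 3 := by
        refine mul_le_mul_of_nonneg_left ?_ (by positivity)
        have hinv : (s : ℝ)⁻¹ ≤ 1 := inv_le_one_of_one_le₀ hs0
        have := Real.abs_exp_sub_one_sub_id_le (x := (s : ℝ)⁻¹)
          (by rwa [abs_of_nonneg (by positivity)])
        have h5 := (abs_le.1 this).2
        have h6 := mul_le_mul_of_nonneg_left h5 (by positivity : (0 : ℝ) ≤ (s : ℝ) ^ 2)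
        have h7 : -(s : ℝ) + (s ^ 2 : ℕ) * (Real.exp (s : ℝ)⁻¹ - 1) ≤ 1 := by
          have h8 : (s : ℝ) ^ 2 * (s : ℝ)⁻¹ ^ 2 = 1 := by field_simp
          have h9 : (s : ℝ) ^ 2 * (Real.exp (s : ℝ)⁻¹ - 1 - (s : ℝ)⁻¹) =
              -(s : ℝ) + s ^ 2 * (Real.exp (s : ℝ)⁻¹ - 1) := by field_simp; ring
          push_cast
          linarith
        exact (Real.exp_le_exp.2 h7).trans (by linarith [Real.exp_one_lt_d9])
      _ = _ := by ring
  exact_mod_cast h4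

/-- At least half of all selections have small total excess. -/
theorem card_le_two_mul_card_excess_le {s : ℕ} (hs : 1 ≤ s) (hd : 0 < d)
    (hin : ∀ w, Nat.card {z : V × Fin d // nbr z.1 z.2 = w} = d) :
    d ^ (Fintype.card V * s ^ 2) ≤ 2 * #{φ : V × Fin (s ^ 2) → Fin d |
      ∑ y, (selDegree nbr φ y - s ^ 2) ≤ 6 * s * Fintype.card V} := by
  rcases Nat.eq_zero_or_pos (Fintype.card V) with hV | hV
  · have := Fintype.card_eq_zero_iff.1 hV
    rw [filter_true_of_mem fun φ _ => by simp, card_univ, Fintype.card_fun, Fintype.card_prod, hV]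
    simp
  set A : Finset (V × Fin (s ^ 2) → Fin d) :=
    {φ | ∑ y, (selDegree nbr φ y - s ^ 2) ≤ 6 * s * Fintype.card V} with hA
  have h1 : #Aᶜ * (6 * s * Fintype.card V) ≤
      Fintype.card V * (3 * s * d ^ (Fintype.card V * s ^ 2)) := by
    calc #Aᶜ * (6 * s * Fintype.card V) ≤ ∑ φ ∈ Aᶜ, ∑ y, (selDegree nbr φ y - s ^ 2) := by
          rw [← smul_eq_mul]
          refine card_nsmul_le_sum _ _ _ fun φ hφ => ?_
          rw [mem_compl, hA, mem_filter] at hφ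
          exact (not_le.1 fun h => hφ ⟨mem_univ _, h⟩).le
      _ ≤ ∑ φ, ∑ y, (selDegree nbr φ y - s ^ 2) :=
          sum_le_sum_of_subset (subset_univ _)
      _ = ∑ y, ∑ φ : V × Fin (s ^ 2) → Fin d, (selDegree nbr φ y - s ^ 2) := sum_comm
      _ ≤ ∑ y : V, 3 * s * d ^ (Fintype.card V * s ^ 2) :=
          sum_le_sum fun y _ => sum_excess_le hs hd hin y
      _ = _ := by rw [sum_const, card_univ, smul_eq_mul]
  have h2 : 2 * #Aᶜ ≤ d ^ (Fintype.card V * s ^ 2) := by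
    have : 0 < 3 * s * Fintype.card V := by positivity
    refine Nat.le_of_mul_le_mul_left ?_ this
    linarith
  have h3 := card_add_card_compl A
  rw [Fintype.card_fun, Fintype.card_prod, Fintype.card_fin, Fintype.card_fin] at h3
  omega

theorem exists_isLinking {s t r : ℕ} {Z : Finset V} (hs : 1 ≤ s)
    (hst : 6 * Fintype.card V ≤ s * t) (hr : t + #Z ≤ r) (hrV : r ≤ Fintype.card V)
    (φ : V × Fin (s ^ 2) → Fin d)
    (hφ : ∑ y, (selDegree nbr φ y - s ^ 2) ≤ 6 * s * Fintype.card V) :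
    ∃ f, IsLinking nbr Z r f ∧ ∀ v w, f v = some w → ∃ i, nbr v (φ (v, i)) = w := by
  let N : V → Finset V := fun x => univ.image fun i => nbr x (φ (x, i))
  let T : V → Finset (V ⊕ Fin t) := fun x => (N x).disjSum univ
  have hall : ∀ A : Finset V, #A ≤ #(A.biUnion T) := by
    intro A
    rcases A.eq_empty_or_nonempty with rfl | ⟨x₀, hx₀⟩
    · simp
    have h1 : (A.biUnion N).disjSum univ ⊆ A.biUnion T := by
      intro z hz
      rw [mem_disjSum] at hz
      rw [mem_biUnion]
      rcases hz with ⟨y, hy, rfl⟩ | ⟨i, -, rfl⟩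
      · obtain ⟨x, hx, hxy⟩ := mem_biUnion.1 hy
        exact ⟨x, hx, inl_mem_disjSum.2 hxy⟩
      · exact ⟨x₀, hx₀, inr_mem_disjSum.2 (mem_univ i)⟩
    have h2 := card_le_card h1
    rw [card_disjSum, card_univ, Fintype.card_fin] at h2
    have h3 : s ^ 2 * #A ≤ s ^ 2 * #(A.biUnion N) + 6 * s * Fintype.card V := by
      calc s ^ 2 * #A = #(A ×ˢ (univ : Finset (Fin (s ^ 2)))) := by
            rw [card_product, card_univ, Fintype.card_fin, mul_comm]
        _ = ∑ y ∈ A.biUnion N, #{z ∈ A ×ˢ univ | nbr z.1 (φ z) = y} :=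
            card_eq_sum_card_fiberwise fun z hz => by
              rw [mem_coe, mem_product] at hz
              exact mem_biUnion.2 ⟨z.1, hz.1, mem_image.2 ⟨z.2, mem_univ _, rfl⟩⟩
        _ ≤ ∑ y ∈ A.biUnion N, (s ^ 2 + (selDegree nbr φ y - s ^ 2)) := by
            refine sum_le_sum fun y _ => ?_
            have : #{z ∈ A ×ˢ univ | nbr z.1 (φ z) = y} ≤ selDegree nbr φ y :=
              card_le_card (filter_subset_filter _ (subset_univ _))
            omega
        _ ≤ _ := by
            rw [sum_add_distrib, sum_const, smul_eq_mul, mul_comm]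
            exact add_le_add_right
              ((sum_le_sum_of_subset (subset_univ (A.biUnion N))).trans hφ) _
    have h4 : s ^ 2 * #A ≤ s ^ 2 * (#(A.biUnion N) + t) := by nlinarith
    exact (Nat.le_of_mul_le_mul_left h4 (by positivity)).trans h2
  obtain ⟨h, hinj, hT⟩ := (all_card_le_biUnion_card_iff_exists_injective T).1 hall
  let S₀ : Finset V := Z ∪ univ.filter fun v => (h v).isRight
  have hS₀ : #S₀ ≤ r := by
    refine (card_union_le _ _).trans (le_trans ?_ hr)
    rw [add_comm]
    refine Nat.add_le_add_right ?_ _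
    calc #(univ.filter fun v => (h v).isRight) = #((univ.filter fun v => (h v).isRight).image h) :=
          (card_image_of_injective _ hinj).symm
      _ ≤ #((univ : Finset (Fin t)).image (Sum.inr : Fin t → V ⊕ Fin t)) := by
          refine card_le_card fun z hz => ?_
          obtain ⟨v, hv, rfl⟩ := mem_image.1 hz
          obtain ⟨i, hi⟩ := Sum.isRight_iff.1 (mem_filter.1 hv).2
          rw [hi]
          exact mem_image_of_mem _ (mem_univ i)
      _ ≤ t := card_image_le.trans (by simp)
  obtain ⟨S, hS, hSr⟩ := exists_superset_card_eq hS₀ hrV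
  have hf : ∀ v w, (if v ∈ S then none else (h v).getLeft?) = some w → h v = .inl w := by
    intro v w hv
    split_ifs at hv
    exact Sum.getLeft?_eq_some_iff.1 hv
  have hφ' : ∀ v w, (if v ∈ S then none else (h v).getLeft?) = some w →
      ∃ i, nbr v (φ (v, i)) = w := by
    intro v w hv
    have := hT v
    rw [hf v w hv] at this
    obtain ⟨i, -, hi⟩ := mem_image.1 (inl_mem_disjSum.1 this)
    exact ⟨i, hi⟩
  refine ⟨fun v => if v ∈ S then none else (h v).getLeft?, ⟨?_, ?_, ?_, ?_⟩, hφ'⟩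
  · intro u v w hu hv
    exact hinj ((hf u w hu).trans (hf v w hv).symm)
  · intro v w hv
    obtain ⟨i, hi⟩ := hφ' v w hv
    exact ⟨_, hi⟩
  · intro v hv
    exact if_pos (hS (mem_union_left _ hv))
  · rw [Nat.card_eq_fintype_card, Fintype.card_subtype, ← hSr]
    congr 1
    ext v
    simp only [mem_filter, mem_univ, true_and]
    constructor
    · intro hv
      by_contra hvS
      rw [if_neg hvS, Sum.getLeft?_eq_none_iff] at hv
      exact hvS (hS (mem_union_right _ (mem_filter.2 ⟨mem_univ v, hv⟩)))
    · exact fun hv => if_pos hv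

theorem card_selections_mul_le {r : ℕ} {Z : Finset V} (hinj : ∀ v, Function.Injective (nbr v))
    {f : V → Option V} (hf : IsLinking nbr Z r f) :
    Nat.card {φ : V × Fin D → Fin d // ∀ v w, f v = some w → ∃ i, nbr v (φ (v, i)) = w} *
      d ^ (Fintype.card V - r) ≤ D ^ (Fintype.card V - r) * d ^ (Fintype.card V * D) := by
  have hM : Fintype.card {v // f v ≠ none} = Fintype.card V - r := by
    rw [Fintype.card_subtype_compl, ← hf.card_none, Nat.card_eq_fintype_card]
  have hex : ∀ (φ : {φ : V × Fin D → Fin d // ∀ v w, f v = some w → ∃ i, nbr v (φ (v, i)) = w})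
      (v : {v // f v ≠ none}), ∃ i, some (nbr v (φ.1 (v, i))) = f v := by
    intro φ v
    obtain ⟨w, hw⟩ := Option.ne_none_iff_exists'.1 v.2
    obtain ⟨i, hi⟩ := φ.2 v w hw
    exact ⟨i, by rw [hi, hw]⟩
  choose I hI using hex
  let F : {φ : V × Fin D → Fin d // ∀ v w, f v = some w → ∃ i, nbr v (φ (v, i)) = w} ×
      ({v // f v ≠ none} → Fin d) → ({v // f v ≠ none} → Fin D) × (V × Fin D → Fin d) :=
    fun p => (I p.1, fun z => if h : f z.1 ≠ none then
      if I p.1 ⟨z.1, h⟩ = z.2 then p.2 ⟨z.1, h⟩ else p.1.1 z else p.1.1 z)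
  have hF : Function.Injective F := by
    rintro ⟨φ, b⟩ ⟨ψ, c⟩ h
    obtain ⟨h1, h2⟩ := Prod.ext_iff.1 h
    simp only [F] at h1 h2
    have hb : b = c := by
      funext v
      have := congrFun h2 (v.1, I φ v)
      simpa [v.2, h1] using this
    have hφ : φ = ψ := by
      apply Subtype.ext
      funext z
      have h3 := congrFun h2 z
      by_cases hz : f z.1 ≠ none
      · rw [dif_pos hz, dif_pos hz] at h3
        by_cases hi : I φ ⟨z.1, hz⟩ = z.2
        · have e1 := hI φ ⟨z.1, hz⟩
          have e2 := hI ψ ⟨z.1, hz⟩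
          rw [← h1, ← e1, Option.some_inj] at e2
          have := hinj _ e2
          simp only [hi] at this
          exact this.symm
        · rwa [if_neg hi, if_neg (by rwa [← h1])] at h3
      · rwa [dif_neg hz, dif_neg hz] at h3
    rw [hb, hφ]
  have := Nat.card_le_card_of_injective F hF
  simpa only [Nat.card_prod, Fintype.card_fun, Nat.card_eq_fintype_card, hM, Fintype.card_fin,
    Fintype.card_prod] using this

theorem pow_le_card_isLinking {s t r : ℕ} {Z : Finset V} (hs : 1 ≤ s) (hd : 0 < d)
    (hinj : ∀ v, Function.Injective (nbr v))
    (hin : ∀ w, Nat.card {z : V × Fin d // nbr z.1 z.2 = w} = d)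
    (hst : 6 * Fintype.card V ≤ s * t) (hr : t + #Z ≤ r) (hrV : r ≤ Fintype.card V) :
    d ^ (Fintype.card V - r) ≤
      2 * Nat.card {f // IsLinking nbr Z r f} * (s ^ 2) ^ (Fintype.card V - r) := by
  classical
  have h1 := card_le_two_mul_card_excess_le hs hd hin
  have h2 : #{φ : V × Fin (s ^ 2) → Fin d |
      ∑ y, (selDegree nbr φ y - s ^ 2) ≤ 6 * s * Fintype.card V} ≤
      ∑ f : {f // IsLinking nbr Z r f}, Nat.card {φ : V × Fin (s ^ 2) → Fin d //
        ∀ v w, f.1 v = some w → ∃ i, nbr v (φ (v, i)) = w} := by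
    simp only [Nat.card_eq_fintype_card, Fintype.card_subtype]
    refine le_trans (card_le_card ?_) card_biUnion_le
    intro φ hφ
    obtain ⟨f, hf, hfφ⟩ := exists_isLinking hs hst hr hrV φ (mem_filter.1 hφ).2
    exact mem_biUnion.2 ⟨⟨f, hf⟩, mem_univ _, mem_filter.2 ⟨mem_univ _, hfφ⟩⟩
  have h3 : (∑ f : {f // IsLinking nbr Z r f}, Nat.card {φ : V × Fin (s ^ 2) → Fin d //
        ∀ v w, f.1 v = some w → ∃ i, nbr v (φ (v, i)) = w}) * d ^ (Fintype.card V - r) ≤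
      Nat.card {f // IsLinking nbr Z r f} *
        ((s ^ 2) ^ (Fintype.card V - r) * d ^ (Fintype.card V * s ^ 2)) := by
    rw [sum_mul, Nat.card_eq_fintype_card, ← smul_eq_mul, ← card_univ]
    exact sum_le_card_nsmul _ _ _ fun f _ => card_selections_mul_le hinj f.2
  have hpos : 0 < d ^ (Fintype.card V * s ^ 2) := by positivity
  refine Nat.le_of_mul_le_mul_left ?_ hpos
  calc _ ≤ 2 * #{φ : V × Fin (s ^ 2) → Fin d |
        ∑ y, (selDegree nbr φ y - s ^ 2) ≤ 6 * s * Fintype.card V} * d ^ (Fintype.card V - r) :=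
        Nat.mul_le_mul_right _ h1
    _ ≤ 2 * (Nat.card {f // IsLinking nbr Z r f} *
        ((s ^ 2) ^ (Fintype.card V - r) * d ^ (Fintype.card V * s ^ 2))) := by
        rw [mul_assoc]
        exact Nat.mul_le_mul_left _ ((Nat.mul_le_mul_right _ h2).trans h3)
    _ = _ := by ring

end Linking

/-- A permutation consisting of a single cycle and moving every point to a neighbour. -/
def IsHamCycle {U : Type} (Γ : SimpleGraph U) (g : Equiv.Perm U) : Prop :=
  g.IsCycleOn Set.univ ∧ ∀ z, Γ.Adj z (g z)

section DoubleCount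

variable {U : Type} {Γ : SimpleGraph U} {n : ℕ}

theorem exists_equiv_getVert {u v : Fin n} {p : (⊤ : SimpleGraph (Fin n)).Walk u v}
    (hp : p.IsHamiltonian) : ∃ l : Fin n ≃ Fin n, ∀ t, l t = p.getVert t := by
  have hs : Function.Surjective fun t : Fin n => p.getVert t := by
    intro a
    obtain ⟨t, rfl, ht⟩ := Walk.mem_support_iff_exists_getVert.1 (hp.mem_support a)
    rw [hp.length_eq, Fintype.card_fin] at ht
    exact ⟨⟨t, by have := u.2; omega⟩, rfl⟩
  exact ⟨Equiv.ofBijective _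
    (Finite.injective_iff_bijective.1 (Finite.injective_iff_surjective.2 hs)),
    fun t => rfl⟩

theorem adj_of_toSubgraph_adj (x₀ : U) {g : Equiv.Perm U} (hg : IsHamCycle Γ g)
    {u v : Fin n} {p : (⊤ : SimpleGraph (Fin n)).Walk u v} (hp : p.IsHamiltonian)
    {ρ : Fin n ≃ U} (hρ : ∀ t, ρ t = (g ^ (t : ℕ)) x₀) {l : Fin n ≃ Fin n}
    (hl : ∀ t, l t = p.getVert t) {a b : Fin n} (hab : p.toSubgraph.Adj a b) :
    Γ.Adj ((ρ.symm.trans l).symm a) ((ρ.symm.trans l).symm b) := by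
  obtain ⟨t, ht, htl⟩ := (Walk.toSubgraph_adj_iff p).1 hab
  rw [hp.length_eq, Fintype.card_fin] at htl
  have h1 : p.getVert t = l ⟨t, by omega⟩ := (hl ⟨t, by omega⟩).symm
  have h2 : p.getVert (t + 1) = l ⟨t + 1, by omega⟩ := (hl ⟨t + 1, by omega⟩).symm
  have key : Γ.Adj (ρ ⟨t, by omega⟩) (ρ ⟨t + 1, by omega⟩) := by
    rw [hρ, hρ, pow_succ', Equiv.Perm.mul_apply]
    exact hg.2 _
  rw [h1, h2] at ht
  rcases Sym2.eq_iff.1 ht with ⟨rfl, rfl⟩ | ⟨rfl, rfl⟩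
  · simpa using key
  · simpa using key.symm

variable [Fintype U]

theorem IsHamCycle.exists_equiv (hU : Fintype.card U = n) (x₀ : U) {g : Equiv.Perm U}
    (hg : IsHamCycle Γ g) : ∃ ρ : Fin n ≃ U, ∀ t, ρ t = (g ^ (t : ℕ)) x₀ := by
  have hs : Function.Surjective fun t : Fin n => (g ^ (t : ℕ)) x₀ := by
    intro z
    have hg' : g.IsCycleOn (Finset.univ : Finset U) := by rw [Finset.coe_univ]; exact hg.1
    obtain ⟨t, ht, rfl⟩ := hg'.exists_pow_eq (Finset.mem_univ x₀) (Finset.mem_univ z)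
    rw [Finset.card_univ, hU] at ht
    exact ⟨⟨t, ht⟩, rfl⟩
  exact ⟨Equiv.ofBijective _ ((Fintype.bijective_iff_surjective_and_card _).2
    ⟨hs, by rw [Fintype.card_fin, hU]⟩), fun t => rfl⟩

theorem IsHamCycle.eq_of_pow_eq (hU : Fintype.card U = n) (x₀ : U) {g h : Equiv.Perm U}
    (hg : IsHamCycle Γ g) (hh : IsHamCycle Γ h) (H : ∀ t < n, (g ^ t) x₀ = (h ^ t) x₀) :
    g = h := by
  have hg' : g.IsCycleOn (Finset.univ : Finset U) := by rw [Finset.coe_univ]; exact hg.1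
  have hh' : h.IsCycleOn (Finset.univ : Finset U) := by rw [Finset.coe_univ]; exact hh.1
  have H' : ∀ t ≤ n, (g ^ t) x₀ = (h ^ t) x₀ := by
    intro t ht
    rcases ht.lt_or_eq with ht | rfl
    · exact H t ht
    · rw [← hU, ← Finset.card_univ, hg'.pow_card_apply (Finset.mem_univ x₀),
        hh'.pow_card_apply (Finset.mem_univ x₀)]
  ext z
  obtain ⟨t, ht, rfl⟩ := hg'.exists_pow_eq (Finset.mem_univ x₀) (Finset.mem_univ z)
  rw [Finset.card_univ, hU] at ht
  rw [← Equiv.Perm.mul_apply, ← pow_succ', H' _ ht, H' _ ht.le, ← Equiv.Perm.mul_apply, ← pow_succ']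

theorem mul_card_isHamCycle_le (hU : Fintype.card U = n) {k m : ℕ}
    (hΓ : ¬ ContainsCopy (cycleGraph (2 * k)) Γ)
    (P : Fin m → Σ u : Fin n, Σ v : Fin n, (⊤ : SimpleGraph (Fin n)).Walk u v)
    (hP : ∀ i, (P i).2.2.IsHamiltonian)
    (hP' : ∀ i j, i ≠ j → ContainsCopy (cycleGraph (2 * k)) (walkUnion (P i).2.2 (P j).2.2)) :
    m * Nat.card {g // IsHamCycle Γ g} ≤ n.factorial := by
  classical
  rcases isEmpty_or_nonempty U with hE | ⟨⟨x₀⟩⟩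
  · have hn : n = 0 := by rw [← hU, Fintype.card_eq_zero]
    subst hn
    have hm : m = 0 := by
      by_contra h
      exact (P ⟨0, Nat.pos_of_ne_zero h⟩).1.elim0
    simp [hm]
  choose ρ hρ using fun g : {g // IsHamCycle Γ g} => g.2.exists_equiv hU x₀
  choose l hl using fun i => exists_equiv_getVert (hP i)
  have hinj : Function.Injective fun z : Fin m × {g // IsHamCycle Γ g} =>
      (ρ z.2).symm.trans (l z.1) := by
    rintro ⟨i, g⟩ ⟨j, h⟩ hσ
    simp only at hσ
    have hij : i = j := by
      by_contra hij
      obtain ⟨f, hf⟩ := hP' i j hij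
      refine hΓ ⟨f.trans ((ρ g).symm.trans (l i)).symm.toEmbedding, fun a b hab => ?_⟩
      rcases hf hab with h1 | h1
      · exact adj_of_toSubgraph_adj x₀ g.2 (hP i) (hρ g) (hl i) h1
      · simp only [Function.Embedding.trans_apply, Equiv.coe_toEmbedding]
        rw [hσ]
        exact adj_of_toSubgraph_adj x₀ h.2 (hP j) (hρ h) (hl j) h1
    subst hij
    have hgh : g = h := by
      apply Subtype.ext
      refine g.2.eq_of_pow_eq hU x₀ h.2 fun t ht => ?_
      rw [← hρ g ⟨t, ht⟩, ← hρ h ⟨t, ht⟩]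
      have hρρ : (ρ g).symm = (ρ h).symm := by
        ext z : 1
        exact (l i).injective (Equiv.congr_fun hσ z)
      rw [← Equiv.symm_symm (ρ g), hρρ, Equiv.symm_symm]
    rw [hgh]
  have := Nat.card_le_card_of_injective _ hinj
  rwa [Nat.card_prod, Nat.card_eq_fintype_card (α := Fin m), Fintype.card_fin,
    Nat.card_eq_fintype_card (α := U ≃ Fin n),
    Fintype.card_equiv (Fintype.equivFinOfCardEq hU), hU] at this

end DoubleCount

theorem hasNbWalk_of_containsCopy {V : Type*} {G : SimpleGraph V} {k : ℕ} (hk : 2 ≤ k)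
    (h : ContainsCopy (cycleGraph (2 * k)) G) : HasNbWalk G (2 * k) := by
  obtain ⟨n, hn⟩ : ∃ n, 2 * k = n + 2 := ⟨2 * k - 2, by omega⟩
  rw [hn] at h ⊢
  obtain ⟨f, hf⟩ := h
  refine ⟨fun i => f ((i : ZMod (n + 2)) : Fin (n + 2)), fun i => ?_, fun i => hf ?_, fun i h => ?_⟩
  · change f ((i + (n + 2) : ℕ) : ZMod (n + 2)) = f ((i : ℕ) : ZMod (n + 2))
    rw [Nat.cast_add, ZMod.natCast_self, add_zero]
  · refine cycleGraph_adj.2 (Or.inr ?_)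
    change ((i + 1 : ℕ) : ZMod (n + 2)) - (i : ZMod (n + 2)) = 1
    push_cast
    ring
  · have h1 : (i : ZMod (n + 2)) = ((i + 2 : ℕ) : ZMod (n + 2)) := f.injective h
    rw [Nat.cast_add, left_eq_add, ZMod.natCast_eq_zero_iff] at h1
    have := Nat.le_of_dvd (by norm_num) h1
    omega

section Closing

variable {V : Type} {c : ℕ} {B : Fin c → ℕ}

/-- The vertex below a vertex of one of the paths `Fin (B i)`, the path being attached at its
bottom to `e i`. -/
def lowerNbr (e : Fin c → V) (w : Σ i, Fin (B i)) : V ⊕ Σ i, Fin (B i) :=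
  if (w.2 : ℕ) = 0 then .inl (e w.1) else .inr ⟨w.1, ⟨w.2 - 1, by omega⟩⟩

/-- The vertex above a vertex of one of the paths `Fin (B i)`, the path being attached at its
top to `s i`. -/
def upperNbr (s : Fin c → V) (w : Σ i, Fin (B i)) : V ⊕ Σ i, Fin (B i) :=
  if h : (w.2 : ℕ) + 1 < B w.1 then .inr ⟨w.1, ⟨w.2 + 1, h⟩⟩ else .inl (s w.1)

theorem upperNbr_eq_inr_iff {s e : Fin c → V} {w w' : Σ i, Fin (B i)} :
    upperNbr s w' = .inr w ↔ lowerNbr e w = .inr w' := by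
  obtain ⟨i, j, hj⟩ := w
  obtain ⟨i', j', hj'⟩ := w'
  unfold upperNbr lowerNbr
  constructor
  · intro h
    split_ifs at h with h1
    simp only [Sum.inr.injEq, Sigma.mk.injEq] at h
    obtain ⟨rfl, h⟩ := h
    simp only [heq_eq_eq, Fin.mk.injEq] at h
    subst h
    simp
  · intro h
    split_ifs at h with h1
    simp only [Sum.inr.injEq, Sigma.mk.injEq] at h
    obtain ⟨rfl, h⟩ := h
    simp only [heq_eq_eq, Fin.mk.injEq] at h
    subst h
    simp only at h1
    have h2 : j - 1 + 1 = j := by omega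
    simp [h2, hj]

/-- The graph `Γ` together with paths from `e i` to `s i` with `B i` inner vertices. -/
def closedGraph (Γ : SimpleGraph V) (B : Fin c → ℕ) (e s : Fin c → V) :
    SimpleGraph (V ⊕ Σ i, Fin (B i)) :=
  SimpleGraph.fromRel fun a b => match a, b with
    | .inl u, .inl v => Γ.Adj u v
    | .inl _, .inr _ => False
    | .inr w, z => z = lowerNbr e w ∨ z = upperNbr s w

variable {Γ : SimpleGraph V} {e s : Fin c → V}

theorem closedGraph_inl_inl {u v : V} :
    (closedGraph Γ B e s).Adj (.inl u) (.inl v) ↔ Γ.Adj u v := by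
  simp only [closedGraph, fromRel_adj, ne_eq, Sum.inl.injEq]
  constructor
  · rintro ⟨-, h | h⟩
    exacts [h, h.symm]
  · exact fun h => ⟨h.ne, .inl h⟩

theorem closedGraph_upperNbr (w : Σ i, Fin (B i)) :
    (closedGraph Γ B e s).Adj (.inr w) (upperNbr s w) := by
  simp only [closedGraph, fromRel_adj, ne_eq]
  refine ⟨?_, by simp⟩
  unfold upperNbr
  split_ifs with h
  · obtain ⟨i, j⟩ := w
    simp [Fin.ext_iff]
  · simp

theorem closedGraph_inl_inr (i : Fin c) (h : 0 < B i) :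
    (closedGraph Γ B e s).Adj (.inl (e i)) (.inr ⟨i, ⟨0, h⟩⟩) := by
  simp [closedGraph, fromRel_adj, lowerNbr]

theorem eq_or_eq_of_closedGraph_adj {w : Σ i, Fin (B i)} {z : V ⊕ Σ i, Fin (B i)}
    (h : (closedGraph Γ B e s).Adj (.inr w) z) : z = lowerNbr e w ∨ z = upperNbr s w := by
  simp only [closedGraph, fromRel_adj] at h
  obtain ⟨-, h | h⟩ := h
  · exact h
  · rcases z with v | w'
    · exact h.elim
    · rcases h with h | h
      · exact .inr (upperNbr_eq_inr_iff.2 h.symm).symm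
      · exact .inl (upperNbr_eq_inr_iff.1 h.symm).symm

theorem not_hasNbWalk_closedGraph {ℓ : ℕ} (hℓ : 1 ≤ ℓ) (hB : ∀ i, ℓ < B i)
    (hΓ : ¬ HasNbWalk Γ ℓ) : ¬ HasNbWalk (closedGraph Γ B e s) ℓ := by
  rintro ⟨p, h1, h2, h3⟩
  by_cases hp : ∃ a w, p a = .inr w
  · have hstep : ∀ a w, p a = .inr w →
        (∃ b, p b = lowerNbr e w) ∧ ∃ b, p b = upperNbr s w := by
      intro a w ha
      have e1 : p (a + ℓ - 1 + 1) = .inr w := by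
        rw [Nat.sub_add_cancel (by omega), h1, ha]
      have n1 := h2 (a + ℓ - 1)
      have n2 := h2 (a + ℓ - 1 + 1)
      have n3 := h3 (a + ℓ - 1)
      rw [e1] at n1 n2
      rcases eq_or_eq_of_closedGraph_adj n1.symm with h | h <;>
        rcases eq_or_eq_of_closedGraph_adj n2 with h' | h'
      · exact (n3 (h.trans h'.symm)).elim
      · exact ⟨⟨_, h⟩, ⟨_, h'⟩⟩
      · exact ⟨⟨_, h'⟩, ⟨_, h⟩⟩
      · exact (n3 (h.trans h'.symm)).elim
    obtain ⟨a, ⟨i, j₀⟩, ha⟩ := hp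
    have hdown : ∀ t, ∀ j : Fin (B i), (j : ℕ) = t → (∃ b, p b = .inr ⟨i, j⟩) →
        ∃ b, p b = .inr ⟨i, ⟨0, by have := j.2; omega⟩⟩ := by
      intro t
      induction t with
      | zero =>
        rintro ⟨j, hj⟩ rfl h
        exact h
      | succ t ih =>
        rintro ⟨j, hj⟩ rfl ⟨b, hb⟩
        obtain ⟨⟨b', hb'⟩, -⟩ := hstep b _ hb
        rw [lowerNbr, if_neg (by simp)] at hb'
        exact ih ⟨t, by omega⟩ rfl ⟨b', hb'⟩
    have hall : ∀ t (ht : t < B i), ∃ b, p b = .inr ⟨i, ⟨t, ht⟩⟩ := by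
      intro t
      induction t with
      | zero => exact fun _ => hdown j₀ j₀ rfl ⟨a, ha⟩
      | succ t ih =>
        intro ht
        obtain ⟨b, hb⟩ := ih (by omega)
        obtain ⟨-, ⟨b', hb'⟩⟩ := hstep b _ hb
        rw [upperNbr, dif_pos (by exact ht)] at hb'
        exact ⟨b', hb'⟩
    choose b hb using hall
    have hper : Function.Periodic p ℓ := h1
    have hinj : Function.Injective fun t : Fin (B i) =>
        (⟨b t t.2 % ℓ, Nat.mod_lt _ hℓ⟩ : Fin ℓ) := by
      intro t t' h
      have h' : b t t.2 % ℓ = b t' t'.2 % ℓ := Fin.mk.inj h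
      have := hb t t.2
      rw [← hper.map_mod_nat, h', hper.map_mod_nat, hb t' t'.2] at this
      simpa using this.symm
    have := Fintype.card_le_of_injective _ hinj
    rw [Fintype.card_fin, Fintype.card_fin] at this
    have := hB i
    omega
  · have hv : ∀ a, ∃ v, p a = .inl v := by
      intro a
      rcases h : p a with v | w
      · exact ⟨v, rfl⟩
      · exact (hp ⟨a, w, h⟩).elim
    choose v hv using hv
    refine hΓ ⟨v, fun a => ?_, fun a => ?_, fun a h => h3 a ?_⟩
    · apply Sum.inl_injective (β := Σ i, Fin (B i))
      rw [← hv, ← hv, h1]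
    · have := h2 a
      rwa [hv, hv, closedGraph_inl_inl] at this
    · rw [hv, hv, h]

end Closing

section Closing

variable {V : Type} [Fintype V] {c : ℕ} {Γ : SimpleGraph V} {f : V → Option V} {rank : V → ℕ}

/-- Following a rank-increasing partial map leads from every vertex to a last vertex. -/
theorem exists_last (hrank : ∀ v w, f v = some w → rank w = rank v + 1) :
    ∃ last : V → V, (∀ v, f (last v) = none) ∧ (∀ v, f v = none → last v = v) ∧
      (∀ v w, f v = some w → last w = last v) ∧
      ∀ r : V → V → Prop, Equivalence r → (∀ v w, f v = some w → r v w) → ∀ v, r v (last v) := by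
  let fwd : V → V := fun v => (f v).getD v
  have hsome : ∀ v w, f v = some w → fwd v = w := fun v w h => by simp [fwd, h]
  have hnone : ∀ v, f v = none → fwd v = v := fun v h => by simp [fwd, h]
  have hfix : ∀ t v, f v = none → fwd^[t] v = v := fun t v h =>
    Function.iterate_fixed (hnone v h) t
  have hlen : ∀ t v, f (fwd^[t] v) ≠ none → rank (fwd^[t] v) = rank v + t := by
    intro t
    induction t with
    | zero => exact fun v _ => rfl
    | succ t ih =>
      intro v h
      rw [Function.iterate_succ_apply] at h ⊢
      rcases hv : f v with _ | w
      · rw [hnone v hv, hfix t v hv] at h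
        exact (h hv).elim
      · rw [hsome v w hv] at h ⊢
        rw [ih w h, hrank v w hv]
        ring
  let M := Finset.univ.sup rank + 1
  have hend : ∀ v, f (fwd^[M] v) = none := by
    intro v
    by_contra h
    have h1 := hlen M v h
    have h2 : rank (fwd^[M] v) ≤ Finset.univ.sup rank := Finset.le_sup (Finset.mem_univ _)
    omega
  refine ⟨fwd^[M], hend, fun v hv => hfix M v hv, fun v w hv => ?_, fun r hr hfr v => ?_⟩
  · rw [← hsome v w hv, ← Function.iterate_succ_apply, Function.iterate_succ_apply',
      hnone _ (hend v)]
  · generalize M = t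
    induction t with
    | zero => exact hr.refl v
    | succ t ih =>
      rw [Function.iterate_succ_apply']
      rcases h : f (fwd^[t] v) with _ | w
      · rwa [hnone _ h]
      · rw [hsome _ _ h]
        exact hr.trans ih (hfr _ _ h)

theorem exists_isHamCycle {B : Fin (c + 1) → ℕ} (hB : ∀ i, 0 < B i)
    (hinj : ∀ u v w, f u = some w → f v = some w → u = v)
    (hadj : ∀ v w, f v = some w → Γ.Adj v w)
    (hrank : ∀ v w, f v = some w → rank w = rank v + 1)
    (hcard : Nat.card {v // f v = none} = c + 1) :
    ∃ (e s : Fin (c + 1) → V) (g : Equiv.Perm (V ⊕ Σ i, Fin (B i))),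
      IsHamCycle (closedGraph Γ B e s) g ∧ ∀ v w, f v = some w ↔ g (.inl v) = .inl w := by
  classical
  obtain ⟨last, hlast, hlast', hstep, hrel⟩ := exists_last hrank
  let e : Fin (c + 1) ≃ {v // f v = none} := (Finite.equivFinOfCardEq hcard).symm
  have hmin : ∀ i, ∃ v, last v = (e i).1 ∧ ∀ u, last u = (e i).1 → rank v ≤ rank u := by
    intro i
    obtain ⟨v, hv, hv'⟩ := Finset.exists_min_image
      (Finset.univ.filter fun v => last v = (e i).1) rank
      ⟨(e i).1, by simp [hlast' _ (e i).2]⟩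
    exact ⟨v, (Finset.mem_filter.1 hv).2, fun u hu => hv' u (by simp [hu])⟩
  choose st hst hst' using hmin
  have hst_inj : Function.Injective st := by
    intro i j h
    apply e.injective
    apply Subtype.ext
    rw [← hst, ← hst, h]
  have hst_range : ∀ v i, f v ≠ some (st i) := by
    intro v i h
    have h1 := hst' i v (by rw [← hstep v _ h, hst])
    have h2 := hrank _ _ h
    omega
  let s : Fin (c + 1) → V := fun i => st (i + 1)
  have hs_inj : Function.Injective s := fun i j h => add_right_cancel (hst_inj h)
  let g₀ : V ⊕ (Σ i, Fin (B i)) → V ⊕ Σ i, Fin (B i) := Sum.elim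
    (fun v => if h : f v = none then .inr ⟨e.symm ⟨v, h⟩, ⟨0, hB _⟩⟩
      else .inl ((f v).get (Option.isSome_iff_ne_none.2 h)))
    (upperNbr s)
  have g_some : ∀ v w, f v = some w → g₀ (.inl v) = .inl w := by
    intro v w h
    simp [g₀, h]
  have g_none : ∀ i, g₀ (.inl (e i).1) = .inr ⟨i, ⟨0, hB i⟩⟩ := by
    intro i
    simp only [g₀, Sum.elim_inl]
    rw [dif_pos (e i).2, Sum.inr.injEq]
    have : e.symm ⟨(e i).1, (e i).2⟩ = i := e.symm_apply_apply i
    exact congrArg (fun j => (⟨j, ⟨0, hB j⟩⟩ : Σ i, Fin (B i))) this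
  have g_inr : ∀ w, g₀ (.inr w) = upperNbr s w := fun w => rfl
  have hcases : ∀ v, (∃ w, f v = some w) ∨ ∃ i, v = (e i).1 := by
    intro v
    rcases h : f v with _ | w
    · exact .inr ⟨e.symm ⟨v, h⟩, by simp⟩
    · exact .inl ⟨w, rfl⟩
  have hup_zero : ∀ w i, upperNbr s w ≠ .inr ⟨i, ⟨0, hB i⟩⟩ := by
    intro w i h
    rw [upperNbr_eq_inr_iff (e := s)] at h
    simp [lowerNbr] at h
  have hup_inl : ∀ (w : Σ i, Fin (B i)) v, upperNbr s w = .inl v → v = s w.1 := by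
    intro w v h
    rw [upperNbr] at h
    split_ifs at h
    exact (Sum.inl_injective h).symm
  have hup_inj : Function.Injective (upperNbr (B := B) s) := by
    intro w w' h
    rcases h' : upperNbr s w with v | w''
    · have h1 := hup_inl w v h'
      have h2 := hup_inl w' v (h ▸ h')
      have h3 : w.1 = w'.1 := hs_inj (h1.symm.trans h2)
      rw [upperNbr] at h'
      split_ifs at h' with h4
      rw [upperNbr, dif_neg h4, upperNbr] at h
      split_ifs at h with h5
      obtain ⟨i, j⟩ := w
      obtain ⟨i', j'⟩ := w'
      simp only at h3 h4 h5
      subst h3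
      simp only [Sigma.mk.injEq, heq_eq_eq, true_and, Fin.ext_iff]
      omega
    · have h1 := (upperNbr_eq_inr_iff (e := s)).1 h'
      have h2 := (upperNbr_eq_inr_iff (e := s)).1 (h ▸ h')
      exact Sum.inr_injective (h1.symm.trans h2)
  have g_inj : Function.Injective g₀ := by
    rintro (u | w) (v | w') h
    · rcases hcases u with ⟨u', hu⟩ | ⟨i, rfl⟩ <;> rcases hcases v with ⟨v', hv⟩ | ⟨j, rfl⟩
      · rw [g_some u u' hu, g_some v v' hv, Sum.inl.injEq] at h
        subst h
        rw [hinj _ _ _ hu hv]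
      · rw [g_some u u' hu, g_none] at h
        exact (Sum.inl_ne_inr h).elim
      · rw [g_some v v' hv, g_none] at h
        exact (Sum.inr_ne_inl h).elim
      · rw [g_none, g_none, Sum.inr.injEq, Sigma.mk.injEq] at h
        rw [h.1]
    · rcases hcases u with ⟨u', hu⟩ | ⟨i, rfl⟩
      · rw [g_some u u' hu, g_inr] at h
        rw [hup_inl _ _ h.symm] at hu
        exact (hst_range _ _ hu).elim
      · rw [g_none, g_inr] at h
        exact (hup_zero _ _ h.symm).elim
    · rcases hcases v with ⟨v', hv⟩ | ⟨i, rfl⟩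
      · rw [g_some v v' hv, g_inr] at h
        rw [hup_inl _ _ h] at hv
        exact (hst_range _ _ hv).elim
      · rw [g_none, g_inr] at h
        exact (hup_zero _ _ h).elim
    · rw [hup_inj h]
  let g : Equiv.Perm (V ⊕ Σ i, Fin (B i)) :=
    Equiv.ofBijective g₀ (Finite.injective_iff_bijective.1 g_inj)
  have hg : ∀ z, g z = g₀ z := fun z => rfl
  have hsame : ∀ z, g.SameCycle z (g₀ z) := fun z => by
    rw [← hg, Equiv.Perm.sameCycle_apply_right]
  have hV : ∀ v, g.SameCycle (.inl v) (.inl (last v)) := by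
    refine hrel (fun u v => g.SameCycle (.inl u) (.inl v)) ⟨fun _ => .refl _ _, fun h => h.symm,
      fun h h' => h.trans h'⟩ fun v w h => ?_
    have := hsame (.inl v)
    rwa [g_some v w h] at this
  have hW₀ : ∀ i t (ht : t < B i), g.SameCycle (.inl (e i).1) (.inr ⟨i, ⟨t, ht⟩⟩) := by
    intro i t
    induction t with
    | zero =>
      intro ht
      have := hsame (.inl (e i).1)
      rwa [g_none] at this
    | succ t ih =>
      intro ht
      have := hsame (.inr ⟨i, ⟨t, by omega⟩⟩)
      rw [g_inr, upperNbr, dif_pos (by exact ht)] at this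
      exact (ih (by omega)).trans this
  have hnext : ∀ i, g.SameCycle (.inl (e i).1) (.inl (e (i + 1)).1) := by
    intro i
    have h1 := hW₀ i (B i - 1) (by have := hB i; omega)
    have h2 := hsame (.inr ⟨i, ⟨B i - 1, by have := hB i; omega⟩⟩)
    rw [g_inr, upperNbr, dif_neg (by simp only; omega)] at h2
    have h3 := hV (s i)
    rw [show last (s i) = _ from hst (i + 1)] at h3
    exact (h1.trans h2).trans h3
  have hE : ∀ i, g.SameCycle (.inl (e 0).1) (.inl (e i).1) := by
    intro i
    induction i using Fin.induction with
    | zero => exact .refl _ _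
    | succ i ih =>
      have := hnext i.castSucc
      rw [Fin.coeSucc_eq_succ] at this
      exact ih.trans this
  have hall : ∀ z, g.SameCycle (.inl (e 0).1) z := by
    rintro (v | ⟨i, t, ht⟩)
    · have h1 := hE (e.symm ⟨last v, hlast v⟩)
      rw [e.apply_symm_apply] at h1
      exact h1.trans (hV v).symm
    · exact (hE i).trans (hW₀ i t ht)
  refine ⟨fun i => (e i).1, s, g, ⟨⟨by simp,
    fun x _ y _ => (hall x).symm.trans (hall y)⟩, ?_⟩, ?_⟩
  · rintro (v | w)
    · rcases hcases v with ⟨w, hw⟩ | ⟨i, rfl⟩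
      · rw [hg, g_some v w hw, closedGraph_inl_inl]
        exact hadj v w hw
      · rw [hg, g_none]
        exact closedGraph_inl_inr (e := fun i => (e i).1) i (hB i)
    · exact closedGraph_upperNbr w
  · intro v w
    refine ⟨g_some v w, fun h => ?_⟩
    rcases hcases v with ⟨w', hw⟩ | ⟨i, rfl⟩
    · rw [hg, g_some v w' hw, Sum.inl.injEq] at h
      rw [hw, h]
    · rw [hg, g_none] at h
      exact (Sum.inr_ne_inl h).elim

theorem LayeredGraph.mul_card_isLinking_le {d k L n r m : ℕ} (hk : 2 ≤ k)
    (G : LayeredGraph V d (2 * k) L) (hr : 1 ≤ r)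
    (hn : Fintype.card V + (2 * k + 1) * r ≤ n)
    (P : Fin m → Σ u : Fin n, Σ v : Fin n, (⊤ : SimpleGraph (Fin n)).Walk u v)
    (hP : ∀ i, (P i).2.2.IsHamiltonian)
    (hP' : ∀ i j, i ≠ j → ContainsCopy (cycleGraph (2 * k)) (walkUnion (P i).2.2 (P j).2.2)) :
    m * Nat.card {f // IsLinking G.nbr G.cut r f} ≤
      Fintype.card V ^ (2 * r) * n.factorial := by
  obtain ⟨c, rfl⟩ : ∃ c, r = c + 1 := ⟨r - 1, by omega⟩
  let B : Fin (c + 1) → ℕ := Fin.cons (n - Fintype.card V - (2 * k + 1) * c) fun _ => 2 * k + 1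
  have hB : ∀ i, 2 * k < B i := by
    intro i
    cases i using Fin.cases with
    | zero => simp only [B, Fin.cons_zero]; rw [mul_add] at hn; omega
    | succ i => simp [B]
  have hcard : Fintype.card (V ⊕ Σ i, Fin (B i)) = n := by
    rw [Fintype.card_sum, Fintype.card_sigma]
    simp only [Fintype.card_fin, B, Fin.sum_univ_succ, Fin.cons_zero, Fin.cons_succ,
      Finset.sum_const, Finset.card_univ, smul_eq_mul]
    rw [mul_add] at hn
    rw [mul_comm c]
    omega
  have hex : ∀ f : {f // IsLinking G.nbr G.cut (c + 1) f},
      ∃ (e s : Fin (c + 1) → V) (g : Equiv.Perm (V ⊕ Σ i, Fin (B i))),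
      IsHamCycle (closedGraph G.graph B e s) g ∧ ∀ v w, f.1 v = some w ↔ g (.inl v) = .inl w := by
    rintro ⟨f, hf⟩
    refine exists_isHamCycle (rank := G.rank) (fun i => (Nat.zero_le _).trans_lt (hB i))
      hf.injective (fun v w h => ?_) (fun v w h => ?_) hf.card_none
    · obtain ⟨a, rfl⟩ := hf.exists_nbr v w h
      exact G.adj_nbr v a
    · obtain ⟨a, rfl⟩ := hf.exists_nbr v w h
      refine G.rank_nbr v a fun hv => ?_
      exact Option.some_ne_none _ (h.symm.trans (hf.eq_none v hv))
  choose e s g hg hfg using hex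
  let F : {f // IsLinking G.nbr G.cut (c + 1) f} →
      Σ p : (Fin (c + 1) → V) × (Fin (c + 1) → V),
        {g // IsHamCycle (closedGraph G.graph B p.1 p.2) g} := fun f => ⟨(e f, s f), ⟨g f, hg f⟩⟩
  have hF : Function.Injective F := by
    intro f f' h
    have hgg : g f = g f' := by
      have := congrArg (fun q : Σ p : (Fin (c + 1) → V) × (Fin (c + 1) → V),
        {g // IsHamCycle (closedGraph G.graph B p.1 p.2) g} => q.2.1) h
      exact this
    apply Subtype.ext
    funext v
    ext w
    rw [hfg, hfg, hgg]
  have hle := Nat.card_le_card_of_injective F hF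
  rw [Nat.card_sigma] at hle
  calc m * Nat.card {f // IsLinking G.nbr G.cut (c + 1) f}
      ≤ ∑ p : (Fin (c + 1) → V) × (Fin (c + 1) → V),
          m * Nat.card {g // IsHamCycle (closedGraph G.graph B p.1 p.2) g} := by
        rw [← Finset.mul_sum]
        exact Nat.mul_le_mul_left _ hle
    _ ≤ ∑ p : (Fin (c + 1) → V) × (Fin (c + 1) → V), n.factorial :=
        Finset.sum_le_sum fun p _ => mul_card_isHamCycle_le hcard
          (fun h => not_hasNbWalk_closedGraph (by omega) hB G.not_hasNbWalk
            (hasNbWalk_of_containsCopy hk h)) P hP hP'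
    _ = _ := by
        rw [Finset.sum_const, Finset.card_univ, smul_eq_mul, Fintype.card_prod, Fintype.card_fun,
          Fintype.card_fin]
        ring

end Closing

theorem exists_mul_pow_le {k Q n p r m : ℕ} (hk : 2 ≤ k) (hQ : 1 ≤ Q) (hp : p.Prime)
    (hQp : 2 * Q ≤ p) (hr : r = 2 * (n / Q) + 1)
    (hn : 2 * p ^ (k / 2 + 2 * ((k + 1) / 2) - 1) + (2 * k + 2) * r ≤ n)
    (P : Fin m → Σ u : Fin n, Σ v : Fin n, (⊤ : SimpleGraph (Fin n)).Walk u v)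
    (hP : ∀ i, (P i).2.2.IsHamiltonian)
    (hP' : ∀ i j, i ≠ j → ContainsCopy (cycleGraph (2 * k)) (walkUnion (P i).2.2 (P j).2.2)) :
    ∃ E ≤ n, n ≤ E + (2 * k + 2) * r + 2 * p ^ (k / 2 + 2 * ((k + 1) / 2) - 1) ∧
      m * (p / (2 * Q)) ^ E ≤ 2 * n ^ (2 * r) * n.factorial * (36 * Q ^ 2) ^ E := by
  classical
  have hd : 1 ≤ p / (2 * Q) := (Nat.one_le_div_iff (by omega)).2 hQp
  obtain ⟨V, _, G₀, hV0, hVp⟩ := exists_layeredGraph (by omega : 1 ≤ k) hp hQ hd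
    (Nat.mul_div_le p (2 * Q))
  have hVle : Fintype.card V ≤ 2 * p ^ (k / 2 + 2 * ((k + 1) / 2) - 1) := by
    refine Nat.le_of_mul_le_mul_right ?_ hp.pos
    rw [mul_assoc, ← pow_succ, Nat.sub_add_cancel (by omega)]
    exact hVp
  generalize hx : 2 * p ^ (k / 2 + 2 * ((k + 1) / 2) - 1) = x at hn hVle ⊢
  have hr1 : (2 * k + 2) * r = (2 * k + 1) * r + r := by ring
  set c := (n - (2 * k + 1) * r) / Fintype.card V with hc
  let G := G₀.copies c
  have hcard : Fintype.card (Fin c × V) = Fintype.card V * c := by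
    rw [Fintype.card_prod, Fintype.card_fin, mul_comm]
  have h1 : Fintype.card V * c ≤ n - (2 * k + 1) * r := Nat.mul_div_le _ _
  have h2 : n - (2 * k + 1) * r < Fintype.card V * (c + 1) := Nat.lt_mul_div_succ _ hV0
  rw [mul_add, mul_one] at h2
  rw [← hcard] at h1 h2
  have hcut : G.cut.card ≤ n / Q := by
    rw [Nat.le_div_iff_mul_le hQ, mul_comm]
    exact G.card_cut.trans (by omega)
  have hF := pow_le_card_isLinking (nbr := G.nbr) (Z := G.cut) (s := 6 * Q) (t := n / Q + 1)
    (r := r) (by omega) hd G.nbr_injective G.card_nbr_eq (by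
      have := Nat.lt_mul_div_succ n (show 0 < Q from hQ)
      rw [mul_assoc]
      omega) (by omega) (by omega)
  have hm := G.mul_card_isLinking_le (r := r) hk (by omega) (by omega) P hP hP'
  refine ⟨Fintype.card (Fin c × V) - r, by omega, by omega, ?_⟩
  generalize Nat.card {f // IsLinking G.nbr G.cut r f} = M at hF hm
  have hN : Fintype.card (Fin c × V) ≤ n := by omega
  calc m * (p / (2 * Q)) ^ (Fintype.card (Fin c × V) - r)
      ≤ m * (2 * M * ((6 * Q) ^ 2) ^ (Fintype.card (Fin c × V) - r)) :=
        Nat.mul_le_mul_left _ hF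
    _ = 2 * (m * M) * (36 * Q ^ 2) ^ (Fintype.card (Fin c × V) - r) := by
        rw [mul_pow 6 Q 2]; ring
    _ ≤ 2 * (n ^ (2 * r) * n.factorial) * (36 * Q ^ 2) ^ (Fintype.card (Fin c × V) - r) := by
        refine Nat.mul_le_mul_right _ (Nat.mul_le_mul_left _ (hm.trans ?_))
        exact Nat.mul_le_mul_right _ (Nat.pow_le_pow_left hN _)
    _ = _ := by ring

theorem exists_prime_mul_pow_le {k Q n : ℕ} (hk : 2 ≤ k) (hQ : 1 ≤ Q) {x : ℝ}
    (hx : 2 * (Q : ℝ) ≤ x) (hxn : x ^ (3 * k) = n) :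
    ∃ p : ℕ, p.Prime ∧ x ^ 2 / 2 ≤ p ∧ 2 * Q ≤ p ∧
      2 * p ^ (k / 2 + 2 * ((k + 1) / 2) - 1) * Q ≤ n := by
  have hQ' : (1 : ℝ) ≤ Q := by exact_mod_cast hQ
  have hx0 : 0 ≤ x ^ 2 / 2 := by positivity
  obtain ⟨p, hp, hap, hpa⟩ := Nat.exists_prime_lt_and_le_two_mul ⌊x ^ 2 / 2⌋₊
    (Nat.floor_pos.2 (by nlinarith)).ne'
  have h1 : x ^ 2 / 2 ≤ p := by
    have h := (Nat.floor_lt hx0).1 hap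
    exact h.le
  have h2 : (p : ℝ) ≤ x ^ 2 := by
    have h := Nat.floor_le hx0
    have h' : (p : ℝ) ≤ 2 * (⌊x ^ 2 / 2⌋₊ : ℝ) := by exact_mod_cast hpa
    linarith
  refine ⟨p, hp, h1, ?_, ?_⟩
  · have : (2 * Q : ℝ) ≤ p := by nlinarith
    exact_mod_cast this
  · have h3 : (p : ℝ) ^ (k / 2 + 2 * ((k + 1) / 2) - 1) ≤ x ^ (3 * k - 1) :=
      calc (p : ℝ) ^ (k / 2 + 2 * ((k + 1) / 2) - 1)
          ≤ (x ^ 2) ^ (k / 2 + 2 * ((k + 1) / 2) - 1) := pow_le_pow_left₀ (by positivity) h2 _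
        _ = x ^ (2 * (k / 2 + 2 * ((k + 1) / 2) - 1)) := (pow_mul _ _ _).symm
        _ ≤ x ^ (3 * k - 1) := pow_le_pow_right₀ (by linarith) (by omega)
    have h4 : x ^ (3 * k - 1) * x = n := by
      rw [← pow_succ, Nat.sub_add_cancel (by omega), hxn]
    have h5 : (2 * (p : ℝ) ^ (k / 2 + 2 * ((k + 1) / 2) - 1) * Q : ℝ) ≤ n := by
      rw [← h4]
      calc (2 * (p : ℝ) ^ (k / 2 + 2 * ((k + 1) / 2) - 1) * Q : ℝ)
          = (p : ℝ) ^ (k / 2 + 2 * ((k + 1) / 2) - 1) * (2 * Q) := by ring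
        _ ≤ x ^ (3 * k - 1) * x :=
            mul_le_mul h3 hx (by positivity) (pow_nonneg (by linarith) _)
    exact_mod_cast h5

theorem log_le_of_mul_pow_le {Q n d r m E : ℕ} (hQ : 1 ≤ Q) (hn : 1 ≤ n)
    (hm : 1 ≤ m) (hd : 1 ≤ d) (hE : E ≤ n)
    (h : m * d ^ E ≤ 2 * n ^ (2 * r) * n.factorial * (36 * Q ^ 2) ^ E) {t : ℝ}
    (ht : t - Real.log (8 * Q) ≤ Real.log d) :
    Real.log m ≤ (2 * r + n) * Real.log n - E * t
      + n * (1 + Real.log (36 * Q ^ 2) + Real.log (8 * Q)) := by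
  have hQ' : (1 : ℝ) ≤ Q := by exact_mod_cast hQ
  have hn' : (1 : ℝ) ≤ n := by exact_mod_cast hn
  have hm' : (0 : ℝ) < m := by exact_mod_cast hm
  have hd' : (0 : ℝ) < d := by exact_mod_cast hd
  have hE' : (E : ℝ) ≤ n := by exact_mod_cast hE
  have h1 : (m * d ^ E : ℝ) ≤ 2 * n ^ (2 * r + n) * (36 * Q ^ 2) ^ E := by
    have : m * d ^ E ≤ 2 * n ^ (2 * r + n) * (36 * Q ^ 2) ^ E := by
      refine h.trans (Nat.mul_le_mul_right _ ?_)
      rw [pow_add, ← mul_assoc]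
      exact Nat.mul_le_mul_left _ n.factorial_le_pow
    exact_mod_cast this
  have h2 := Real.log_le_log (by positivity) h1
  rw [Real.log_mul (by positivity) (by positivity), Real.log_mul (by positivity) (by positivity),
    Real.log_mul (by positivity) (by positivity), Real.log_pow, Real.log_pow, Real.log_pow] at h2
  push_cast at h2
  have h3 : Real.log 2 ≤ 1 := by linarith [Real.log_two_lt_d9]
  have h4 : 0 ≤ Real.log (36 * (Q : ℝ) ^ 2) := Real.log_nonneg (by nlinarith)
  have h5 : 0 ≤ Real.log (8 * (Q : ℝ)) := Real.log_nonneg (by nlinarith)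
  have h6 := mul_le_mul_of_nonneg_left ht (Nat.cast_nonneg (α := ℝ) E)
  have h7 := mul_le_mul_of_nonneg_right hE' h4
  have h8 := mul_le_mul_of_nonneg_right hE' h5
  nlinarith

/-- For every `k ≥ 2`, `H_n(C_{2k}) ≤ n ^ ((1 - 2/(3k)) n + o(n))`. -/
theorem Hn_C2k_upper :
    ∀ k : ℕ, 2 ≤ k → ∀ ε : ℝ, 0 < ε → ∃ n₀ : ℕ, ∀ n : ℕ, n₀ ≤ n →
      ∀ (m : ℕ) (P : Fin m → Σ u : Fin n, Σ v : Fin n, (⊤ : SimpleGraph (Fin n)).Walk u v),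
        Function.Injective P →
        (∀ i, (P i).2.2.IsHamiltonian) →
        (∀ i j, i ≠ j → ContainsCopy (cycleGraph (2 * k)) (walkUnion (P i).2.2 (P j).2.2)) →
        (m : ℝ) ≤ (n : ℝ) ^ ((1 - 2 / (3 * (k : ℝ)) + ε) * n) := by
  intro k hk ε hε
  have hk' : (2 : ℝ) ≤ k := by exact_mod_cast hk
  obtain ⟨Q₀, hQ₀⟩ := exists_nat_ge (2 * (4 * (k : ℝ) + 10) / ε)
  set Q := max Q₀ (8 * k + 12) with hQdef
  have hQk : 8 * k + 12 ≤ Q := le_max_right _ _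
  have hQ : 1 ≤ Q := by omega
  have hQ' : (1 : ℝ) ≤ Q := by exact_mod_cast hQ
  have hQε : 2 * (4 * (k : ℝ) + 10) ≤ ε * Q := by
    rw [div_le_iff₀ hε] at hQ₀
    have : (Q₀ : ℝ) ≤ Q := by exact_mod_cast le_max_left _ _
    nlinarith
  set C := 3 + Real.log (36 * (Q : ℝ) ^ 2) + Real.log (8 * Q) with hC
  have hev := ((tendsto_rpow_atTop (y := 1 / (3 * (k : ℝ))) (by positivity)).comp
    tendsto_natCast_atTop_atTop).eventually_ge_atTop (2 * (Q : ℝ))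
  have hev' := (Real.tendsto_log_atTop.comp
    tendsto_natCast_atTop_atTop).eventually_ge_atTop (2 * C / ε)
  obtain ⟨n₀, hn₀⟩ := Filter.eventually_atTop.1
    ((hev.and hev').and (Filter.eventually_ge_atTop ((2 * k + 2) * Q)))
  refine ⟨n₀, fun n hn m P _ hP hP' => ?_⟩
  obtain ⟨⟨hx, hL⟩, hnQ⟩ := hn₀ n hn
  simp only [Function.comp_apply] at hx hL
  have hn1 : 1 ≤ n := le_trans (by nlinarith) hnQ
  have hn' : (1 : ℝ) ≤ n := by exact_mod_cast hn1
  rcases Nat.eq_zero_or_pos m with rfl | hm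
  · simpa using Real.rpow_nonneg (Nat.cast_nonneg n) _
  generalize hxdef : (n : ℝ) ^ (1 / (3 * (k : ℝ))) = x at hx
  have hxn : x ^ (3 * k) = n := by
    rw [← hxdef, ← Real.rpow_natCast, ← Real.rpow_mul (by positivity)]
    push_cast
    rw [one_div_mul_cancel (by positivity), Real.rpow_one]
  have hx0 : 0 < x := by linarith
  have hlogx : Real.log x = Real.log n / (3 * k) := by
    rw [← hxdef, Real.log_rpow (by positivity)]; ring
  obtain ⟨p, hp, hxp, hQp, hpn⟩ := exists_prime_mul_pow_le hk hQ hx hxn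
  have hy : n / Q * Q ≤ n := Nat.div_mul_le_self n Q
  have hcond : 2 * p ^ (k / 2 + 2 * ((k + 1) / 2) - 1) + (2 * k + 2) * (2 * (n / Q) + 1) ≤ n := by
    refine Nat.le_of_mul_le_mul_right ?_ (show 0 < Q from hQ)
    nlinarith
  obtain ⟨E, hEn, hnE, hmE⟩ := exists_mul_pow_le hk hQ hp hQp rfl hcond P hP hP'
  have hd : 1 ≤ p / (2 * Q) := (Nat.one_le_div_iff (by omega)).2 hQp
  have hpd : p < 2 * Q * (p / (2 * Q) + 1) := Nat.lt_mul_div_succ _ (by omega)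
  generalize p / (2 * Q) = d at hmE hd hpd
  have hd' : (1 : ℝ) ≤ d := by exact_mod_cast hd
  have hlogd : 2 * (Real.log n / (3 * k)) - Real.log (8 * Q) ≤ Real.log d := by
    have hpd' : (p : ℝ) < 2 * Q * (d + 1) := by exact_mod_cast hpd
    have h : x ^ 2 ≤ d * (8 * Q) := by nlinarith
    have := Real.log_le_log (by positivity) h
    rw [Real.log_pow, Real.log_mul (by positivity) (by positivity), hlogx] at this
    push_cast at this
    linarith
  have hmain := log_le_of_mul_pow_le hQ hn1 hm hd hEn hmE hlogd
  have hL0 : 0 ≤ Real.log n := Real.log_nonneg hn'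
  have hLn : Real.log n ≤ n := (Real.log_le_sub_one_of_pos (by positivity)).trans (by linarith)
  have hEQ : (n : ℝ) * Q ≤ E * Q + (4 * k + 6) * n := by
    have : n * Q ≤ E * Q + (4 * k + 6) * n := by
      have := Nat.mul_le_mul_right Q hnE
      nlinarith
    exact_mod_cast this
  have hyQ : ((n / Q : ℕ) : ℝ) * Q ≤ n := by exact_mod_cast hy
  have hη : (n : ℝ) - ε / 2 * n + 4 * ((n / Q : ℕ) : ℝ) ≤ E := by
    refine le_of_mul_le_mul_right ?_ (show (0 : ℝ) < Q by linarith)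
    nlinarith
  push_cast at hmain
  have hCL : C * n ≤ ε / 2 * Real.log n * n := by
    rw [div_le_iff₀ hε] at hL
    exact mul_le_mul_of_nonneg_right (by linarith) (by linarith)
  have hθ : 2 / (3 * (k : ℝ)) ≤ 1 := by
    rw [div_le_one (by positivity)]; linarith
  have hEn' : (E : ℝ) ≤ n := by exact_mod_cast hEn
  have h1 : ((n : ℝ) - E) * (2 / (3 * (k : ℝ))) * Real.log n ≤ (n - E) * Real.log n :=
    mul_le_mul_of_nonneg_right (mul_le_of_le_one_right (by linarith) hθ) hL0
  have h2 := mul_le_mul_of_nonneg_right hη hL0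
  have h3 : 2 * (Real.log n / (3 * (k : ℝ))) = 2 / (3 * (k : ℝ)) * Real.log n := by ring
  rw [h3] at hmain
  rw [Real.rpow_def_of_pos (by linarith), ← Real.log_le_iff_le_exp (by exact_mod_cast hm)]
  rw [hC] at hCL
  linarith
end
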